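/- arXiv:2604.05092 — 18 statements merged into one kernel-verified Lean document; each statement's English description precedes it below -/
import Mathlib

section
/- Let p > 5 be a prime, h a positive integer, q = p^h, and let F be a finite field with q elements. Let r be a positive divisor of h with r < h, and let m > 2 be an integer with 2m·(p^r − 1) = q − 1. Let a, b ∈ F be nonzero with a^(p^r) = a, and assume that either b^(p^r) = b or b^(p^r) = −b. Then the number of pairs (x, y) ∈ F × F satisfying a·x^(2m) + b·y^m = 1 is exactly 2m²·(p^r − 2) + 3m. -/
/-- In a finite field with `k * l + 1` elements, `z` has exactly `k` roots of order `k`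
as soon as `z ^ l = 1`. -/
theorem card_filter_pow_eq_of_pow_eq_one {F : Type*} [Field F] [Fintype F] [DecidableEq F]
    {k l : ℕ} (hkl : k * l = Fintype.card F - 1) {z : F} (hz : z ^ l = 1) :
    (Finset.univ.filter (fun x : F => x ^ k = z)).card = k := by
  have hpos : 0 < k * l := by
    have := Fintype.one_lt_card (α := F)
    omega
  have hk : 0 < k := Nat.pos_of_mul_pos_right hpos
  have hl : 0 < l := Nat.pos_of_mul_pos_left hpos
  obtain ⟨g, hg⟩ := IsCyclic.exists_generator (α := Fˣ)
  have hord : orderOf g = k * l := by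
    rw [orderOf_eq_card_of_forall_mem_zpowers hg, Nat.card_eq_fintype_card,
      Fintype.card_units, hkl]
  have hprim : IsPrimitiveRoot (g : F) (k * l) := by
    rw [← hord, ← orderOf_units]
    exact IsPrimitiveRoot.orderOf _
  have hroot : IsPrimitiveRoot ((g : F) ^ l) k := hprim.pow hpos (mul_comm _ _)
  have hex : ∃ x : F, x ^ k = z := by
    have : NeZero l := ⟨hl.ne'⟩
    obtain ⟨i, -, hi⟩ := (hprim.pow hpos rfl).eq_pow_of_pow_eq_one hz
    exact ⟨(g : F) ^ i, by rw [← hi, ← pow_mul, ← pow_mul, mul_comm]⟩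
  have hz0 : z ≠ 0 := by
    rintro rfl
    simp [hl.ne'] at hz
  have hcard := hroot.card_nthRoots z
  rw [if_pos hex] at hcard
  have hfin : Finset.univ.filter (fun x : F => x ^ k = z) =
      (Polynomial.nthRoots k z).toFinset := by
    ext x
    simp [Polynomial.mem_nthRoots hk]
  rw [hfin, Multiset.toFinset_card_of_nodup (hroot.nthRoots_nodup hz0), hcard]

theorem count_points_n_eq_two_m
    (p h q : ℕ) (hp : p.Prime) (hp5 : 5 < p) (hh : 0 < h) (hq : q = p ^ h)
    (F : Type*) [Field F] [Fintype F] [DecidableEq F] (hcard : Fintype.card F = q)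
    (r : ℕ) (hr0 : 0 < r) (hrh : r < h) (hrdvd : r ∣ h)
    (m : ℕ) (hm : 2 < m) (hmq : 2 * m * (p ^ r - 1) = q - 1)
    (a b : F) (ha0 : a ≠ 0) (hb0 : b ≠ 0)
    (ha : a ^ p ^ r = a) (hb : b ^ p ^ r = b ∨ b ^ p ^ r = -b) :
    (Finset.univ.filter
      (fun xy : F × F => a * xy.1 ^ (2 * m) + b * xy.2 ^ m = 1)).card
      = 2 * m ^ 2 * (p ^ r - 2) + 3 * m := by
  have : Fact p.Prime := ⟨hp⟩
  have : CharP F p := charP_of_card_eq_prime_pow (hcard.trans hq)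
  have hQ : 2 ≤ p ^ r := (by omega : 2 ≤ p).trans (Nat.le_self_pow hr0.ne' p)
  have hq1 : 1 < q := hcard ▸ Fintype.one_lt_card (α := F)
  have pow_pred (z : F) : z ^ p ^ r = z ^ (p ^ r - 1) * z := by
    rw [← pow_succ, Nat.sub_add_cancel (by omega)]
  have pow_pred_eq_one {z : F} (hz : z ≠ 0) (h1 : z ^ p ^ r = z) : z ^ (p ^ r - 1) = 1 := by
    rw [pow_pred] at h1
    exact (mul_eq_right₀ hz).1 h1
  have pow_fixed (x : F) : (x ^ (2 * m)) ^ p ^ r = x ^ (2 * m) := by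
    rcases eq_or_ne x 0 with rfl | hx
    · rw [zero_pow (by omega : 2 * m ≠ 0), zero_pow (by omega : p ^ r ≠ 0)]
    · rw [pow_pred, ← pow_mul, hmq, ← hcard,
        FiniteField.pow_card_sub_one_eq_one x hx, one_mul]
  have hfib (x : F) : (Finset.univ.filter
      (fun y : F => a * x ^ (2 * m) + b * y ^ m = 1)).card =
      if x ^ (2 * m) = a⁻¹ then 1 else m := by
    have hiff (y : F) : a * x ^ (2 * m) + b * y ^ m = 1 ↔
        y ^ m = (1 - a * x ^ (2 * m)) * b⁻¹ := by
      rw [eq_mul_inv_iff_mul_eq₀ hb0, eq_sub_iff_add_eq', mul_comm b]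
    simp only [hiff]
    split_ifs with hx
    · rw [hx, mul_inv_cancel₀ ha0, sub_self, zero_mul]
      simp [show m ≠ 0 by omega, Finset.filter_eq']
    · refine card_filter_pow_eq_of_pow_eq_one (l := 2 * (p ^ r - 1))
        (by rw [hcard, ← hmq]; ring) ?_
      have hc0 : 1 - a * x ^ (2 * m) ≠ 0 := fun h0 =>
        hx (eq_inv_of_mul_eq_one_right (sub_eq_zero.1 h0).symm)
      have hc : (1 - a * x ^ (2 * m)) ^ p ^ r = 1 - a * x ^ (2 * m) := by
        rw [sub_pow_char_pow, one_pow, mul_pow, ha, pow_fixed]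
      have hb2 : b ^ (2 * (p ^ r - 1)) = 1 := by
        rw [mul_comm, pow_mul, sq_eq_one_iff]
        rw [pow_pred] at hb
        refine hb.imp (mul_eq_right₀ hb0).1 fun h1 => mul_right_cancel₀ hb0 ?_
        rw [h1, neg_one_mul]
      rw [mul_pow, inv_pow, hb2, mul_comm 2 (p ^ r - 1), pow_mul, pow_pred_eq_one hc0 hc]
      simp
  have hroots : (Finset.univ.filter (fun x : F => x ^ (2 * m) = a⁻¹)).card = 2 * m :=
    card_filter_pow_eq_of_pow_eq_one (by rw [hcard, hmq])
      (by rw [inv_pow, pow_pred_eq_one ha0 ha, inv_one])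
  have hcompl := Finset.card_filter_add_card_filter_not (s := (Finset.univ : Finset F))
    (fun x : F => x ^ (2 * m) = a⁻¹)
  rw [hroots, Finset.card_univ, hcard] at hcompl
  rw [Finset.card_filter, Fintype.sum_prod_type]
  simp only [← Finset.card_filter, hfib]
  rw [Finset.sum_ite, Finset.sum_const, Finset.sum_const, hroots]
  obtain ⟨t, ht⟩ := Nat.exists_eq_add_of_le hQ
  rw [ht, show 2 + t - 1 = t + 1 by omega] at hmq
  rw [ht, Nat.add_sub_cancel_left]
  have hn : (Finset.univ.filter (fun x : F => ¬x ^ (2 * m) = a⁻¹)).card = 2 * m * t + 1 := by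
    rw [mul_add] at hmq
    omega
  rw [hn, smul_eq_mul, smul_eq_mul]
  ring
end

section
/- Let p > 5 be a prime, h a positive integer, q = p^h, and let F be a finite field with q elements. Let r be a positive divisor of h with r < h, and let m be the integer with m·(p^r − 1) = q − 1. Let a, b ∈ F be nonzero with a^(p^r) = a and b^(p^r) = b. Then the number of pairs (x, y) ∈ F × F satisfying a·x^(2m) + b·y^m = 1 equals m²·(p^r − 3) + 3m if a^((p^r−1)/2) = 1 (i.e., a is a square in the subfield with p^r elements), and equals m²·(p^r − 1) + m otherwise. -/
theorem FiniteField.card_filter_pow_eq {F : Type*} [Field F] [Fintype F] [DecidableEq F]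
    {n k : ℕ} (hk : 0 < k) (hnk : n * k = Fintype.card F - 1) {c : F} (hc0 : c ≠ 0)
    (hc : c ^ k = 1) : (Finset.univ.filter (fun y : F => y ^ n = c)).card = n := by
  have hcard : 0 < Fintype.card F - 1 := Nat.sub_pos_of_lt Fintype.one_lt_card
  have hn : 0 < n := Nat.pos_of_mul_pos_right (hnk ▸ hcard)
  obtain ⟨g, hg⟩ := IsCyclic.exists_monoid_generator (α := Fˣ)
  have hord : orderOf g = n * k := by
    rw [orderOf_eq_card_of_forall_mem_powers hg, Nat.card_eq_fintype_card, Fintype.card_units, hnk]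
  have hprim : IsPrimitiveRoot ((g ^ k : Fˣ) : F) n := by
    refine IsPrimitiveRoot.coe_units_iff.2 ?_
    exact (IsPrimitiveRoot.orderOf g).pow (hord ▸ by positivity) (by rw [hord, mul_comm])
  have hex : ∃ y : F, y ^ n = c := by
    obtain ⟨j, hj⟩ := Submonoid.mem_powers_iff _ _ |>.1 (hg (Units.mk0 c hc0))
    have hjk : g ^ (j * k) = 1 := by
      rw [pow_mul, hj]
      ext
      simpa using hc
    obtain ⟨i, rfl⟩ : n ∣ j :=
      Nat.dvd_of_mul_dvd_mul_right hk (hord ▸ orderOf_dvd_of_pow_eq_one hjk)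
    refine ⟨((g ^ i : Fˣ) : F), ?_⟩
    rw [← Units.val_pow_eq_pow_val, ← pow_mul, mul_comm i n, hj, Units.val_mk0]
  have hfilter : Finset.univ.filter (fun y : F => y ^ n = c) = (Polynomial.nthRoots n c).toFinset := by
    ext y
    simp [Polynomial.mem_nthRoots hn]
  rw [hfilter, Multiset.toFinset_card_of_nodup (hprim.nthRoots_nodup hc0), hprim.card_nthRoots,
    if_pos hex]

theorem count_points_square_cases
    (p h q : ℕ) (hp : p.Prime) (hp5 : 5 < p) (hh : 0 < h) (hq : q = p ^ h)
    (F : Type*) [Field F] [Fintype F] [DecidableEq F] (hcard : Fintype.card F = q)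
    (r : ℕ) (hr0 : 0 < r) (hrh : r < h) (hrdvd : r ∣ h)
    (m : ℕ) (hmq : m * (p ^ r - 1) = q - 1)
    (a b : F) (ha0 : a ≠ 0) (hb0 : b ≠ 0)
    (ha : a ^ p ^ r = a) (hb : b ^ p ^ r = b) :
    (Finset.univ.filter
      (fun xy : F × F => a * xy.1 ^ (2 * m) + b * xy.2 ^ m = 1)).card
      = if a ^ ((p ^ r - 1) / 2) = 1 then m ^ 2 * (p ^ r - 3) + 3 * m
        else m ^ 2 * (p ^ r - 1) + m := by
  have : Fact p.Prime := ⟨hp⟩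
  have : CharP F p := by
    obtain ⟨p', hp'⟩ := CharP.exists F
    obtain ⟨n, hp'_prime, hn⟩ := FiniteField.card F p'
    have hdvd : p' ∣ p ^ h := by
      rw [← hq, ← hcard, hn]
      exact dvd_pow_self _ n.ne_zero
    rwa [← (Nat.prime_dvd_prime_iff_eq hp'_prime hp).1 (hp'_prime.dvd_of_dvd_pow hdvd)]
  have hQ : 5 < p ^ r := hp5.trans_le (Nat.le_self_pow hr0.ne' p)
  obtain ⟨t, ht⟩ : ∃ t, p ^ r = 2 * t + 1 := (hp.odd_of_ne_two (by omega)).pow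
  have hqpos : 1 < q := hcard ▸ Fintype.one_lt_card
  have hm : m ≠ 0 := by
    rintro rfl
    omega
  have hhalf : (p ^ r - 1) / 2 = t := by omega
  have hprod : 2 * m * t = Fintype.card F - 1 := by
    rw [hcard, ← hmq, ht, Nat.add_sub_cancel]
    ring
  have hqm : q = m * (2 * t) + 1 := by
    rw [ht, Nat.add_sub_cancel] at hmq
    omega
  have hpowx (x : F) : (x ^ (2 * m)) ^ p ^ r = x ^ (2 * m) := by
    rcases eq_or_ne x 0 with rfl | hx
    · simp [hm, hp.ne_zero]
    · rw [ht, pow_succ, mul_comm 2 t, pow_mul, ← pow_mul x, hprod,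
        FiniteField.pow_card_sub_one_eq_one x hx, one_pow, one_mul]
  have hfiber (x : F) : (Finset.univ.filter
      (fun y : F => a * x ^ (2 * m) + b * y ^ m = 1)).card
      = if x ^ (2 * m) = a⁻¹ then 1 else m := by
    have hiff (y : F) : a * x ^ (2 * m) + b * y ^ m = 1 ↔ y ^ m = (1 - a * x ^ (2 * m)) / b := by
      rw [eq_div_iff hb0, mul_comm (y ^ m), eq_sub_iff_add_eq']
    simp_rw [hiff]
    split_ifs with hx
    · rw [hx, mul_inv_cancel₀ ha0, sub_self, zero_div]
      simp [pow_eq_zero_iff hm, Finset.filter_eq']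
    · have hc0 : (1 - a * x ^ (2 * m)) / b ≠ 0 := by
        refine div_ne_zero (fun h0 => hx ?_) hb0
        exact eq_inv_of_mul_eq_one_right (sub_eq_zero.1 h0).symm
      refine FiniteField.card_filter_pow_eq (k := p ^ r - 1) (by omega) (by rw [hmq, hcard]) hc0 ?_
      refine mul_right_cancel₀ hc0 ?_
      rw [← pow_succ, Nat.sub_add_cancel (by omega), one_mul, div_pow, hb,
        sub_pow_char_pow, one_pow, mul_pow, ha, hpowx]
  have hsum : (Finset.univ.filter
      (fun xy : F × F => a * xy.1 ^ (2 * m) + b * xy.2 ^ m = 1)).card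
      = ∑ x : F, if x ^ (2 * m) = a⁻¹ then 1 else m := by
    simp_rw [← hfiber, Finset.card_filter]
    exact Fintype.sum_prod_type _
  rw [hsum, hhalf]
  split_ifs with hsq
  · have hA : (Finset.univ.filter (fun x : F => x ^ (2 * m) = a⁻¹)).card = 2 * m :=
      FiniteField.card_filter_pow_eq (by omega) hprod (inv_ne_zero ha0) (by rw [inv_pow, hsq, inv_one])
    have hAc := Finset.card_filter_add_card_filter_not (s := (Finset.univ : Finset F))
      (fun x : F => x ^ (2 * m) = a⁻¹)
    rw [hA, Finset.card_univ, hcard, hqm] at hAc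
    rw [Finset.sum_ite, Finset.sum_const, Finset.sum_const, hA]
    obtain ⟨s, rfl⟩ : ∃ s, t = s + 1 := ⟨t - 1, by omega⟩
    have hAc' : (Finset.univ.filter (fun x : F => ¬ x ^ (2 * m) = a⁻¹)).card = m * (2 * s) + 1 := by
      linarith
    rw [hAc', ht, show 2 * (s + 1) + 1 - 3 = 2 * s by omega, smul_eq_mul, smul_eq_mul]
    ring
  · have hne (x : F) : x ^ (2 * m) ≠ a⁻¹ := by
      intro hx
      have hx0 : x ≠ 0 := by
        rintro rfl
        exact inv_ne_zero ha0 (by rw [← hx, zero_pow (by omega)])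
      apply hsq
      rw [← inv_inj, ← inv_pow, ← hx, ← pow_mul, hprod, inv_one,
        FiniteField.pow_card_sub_one_eq_one x hx0]
    simp_rw [if_neg (hne _)]
    rw [Finset.sum_const, Finset.card_univ, hcard, hqm, ht, Nat.add_sub_cancel, smul_eq_mul]
    ring
end

section
/- Let p > 5 be a prime, h a positive integer, q = p^h, and let F be a finite field with q elements. Let r be a positive divisor of h with r < h, and let n be the integer with n·(p^r − 1) = q − 1. Let a, b, c ∈ F be nonzero with a^(p^r) = a, b^(p^r) = b, c^(p^r) = c, and b·c ≠ −a. Then the number of pairs (x, y) ∈ F × F satisfying a·x^n·y^n + b·x^n + c·y^n = 1 is exactly n²·(p^r − 3) + 2n. -/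
open Finset

section PowerFibers

variable {F : Type*} [Field F] [Fintype F]

theorem pow_pow_eq_one_of_mul_eq {n m : ℕ} (hnm : n * m = Fintype.card F - 1)
    {x : F} (hx : x ≠ 0) : (x ^ n) ^ m = 1 := by
  rw [← pow_mul, hnm, FiniteField.pow_card_sub_one_eq_one x hx]

variable [DecidableEq F]

theorem card_filter_pow_eq_le {n : ℕ} (hn : 0 < n) (u : F) :
    #{x : F | x ^ n = u} ≤ n := by
  calc #{x : F | x ^ n = u} ≤ #(Polynomial.nthRoots n u).toFinset := by
        refine card_le_card fun x hx => ?_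
        simpa [Polynomial.mem_nthRoots hn] using hx
    _ ≤ n := (Multiset.toFinset_card_le _).trans (Polynomial.card_nthRoots n u)

theorem sum_pow_fibers {n m : ℕ} (hn : 0 < n) (hm : 0 < m)
    (hnm : n * m = Fintype.card F - 1) (G : F → ℕ) :
    ∑ x ∈ univ.erase (0 : F), G (x ^ n)
      = ∑ u : F with u ^ m = 1, #{x : F | x ^ n = u} * G u := by
  rw [← sum_fiberwise_of_maps_to (t := ({u : F | u ^ m = 1} : Finset F)) (g := fun x => x ^ n)]
  · refine sum_congr rfl fun u hu => ?_
    have hu0 : u ≠ 0 := by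
      rintro rfl
      simp [hm.ne'] at hu
    have hfib : {x ∈ univ.erase (0 : F) | x ^ n = u} = ({x : F | x ^ n = u} : Finset F) := by
      ext x
      simp only [mem_filter, mem_erase, mem_univ, and_true, true_and, and_iff_right_iff_imp]
      rintro rfl rfl
      simp [hn.ne'] at hu0
    rw [hfib, sum_congr rfl (g := fun _ => G u) fun x hx => by rw [(mem_filter.mp hx).2]]
    simp
  · intro x hx
    simpa using pow_pow_eq_one_of_mul_eq hnm (ne_of_mem_erase hx)

theorem card_filter_pow_eq {n m : ℕ} (hn : 0 < n) (hm : 0 < m)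
    (hnm : n * m = Fintype.card F - 1) {u : F} (hu : u ^ m = 1) :
    #{x : F | x ^ n = u} = n := by
  have htotal := sum_pow_fibers hn hm hnm fun _ => 1
  simp only [sum_const, smul_eq_mul, mul_one, card_erase_of_mem (mem_univ (0 : F)),
    card_univ, ← hnm] at htotal
  refine (card_filter_pow_eq_le hn u).antisymm (not_lt.mp fun hlt => ?_)
  have hsum : ∑ v : F with v ^ m = 1, #{x : F | x ^ n = v} < ∑ v : F with v ^ m = 1, n :=
    sum_lt_sum (fun v _ => card_filter_pow_eq_le hn v) ⟨u, by simpa using hu, hlt⟩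
  rw [← htotal, sum_const, smul_eq_mul, mul_comm n] at hsum
  exact absurd (Nat.mul_le_mul_right n (card_filter_pow_eq_le hm (1 : F))) hsum.not_ge

theorem card_filter_mul_pow_eq {n m : ℕ} (hn : 0 < n) (hm : 0 < m)
    (hnm : n * m = Fintype.card F - 1) {d e : F} (hd : d ≠ 0) (he : (e / d) ^ m = 1) :
    #{x : F | d * x ^ n = e} = n := by
  simpa only [eq_div_iff hd, mul_comm d] using card_filter_pow_eq hn hm hnm he

end PowerFibers


theorem count_points_generalized_fermat
    (p h q : ℕ) (hp : p.Prime) (hp5 : 5 < p) (hh : 0 < h) (hq : q = p ^ h)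
    (F : Type*) [Field F] [Fintype F] [DecidableEq F] (hcard : Fintype.card F = q)
    (r : ℕ) (hr0 : 0 < r) (hrh : r < h) (hrdvd : r ∣ h)
    (n : ℕ) (hnq : n * (p ^ r - 1) = q - 1)
    (a b c : F) (ha0 : a ≠ 0) (hb0 : b ≠ 0) (hc0 : c ≠ 0)
    (ha : a ^ p ^ r = a) (hb : b ^ p ^ r = b) (hc : c ^ p ^ r = c)
    (hbc : b * c ≠ -a) :
    (Finset.univ.filter
      (fun xy : F × F =>
        a * xy.1 ^ n * xy.2 ^ n + b * xy.1 ^ n + c * xy.2 ^ n = 1)).card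
      = n ^ 2 * (p ^ r - 3) + 2 * n := by
  subst hq
  have : Fact p.Prime := ⟨hp⟩
  have : CharP F p := charP_of_card_eq_prime_pow hcard
  have hQ : 5 < p ^ r := hp5.trans_le (Nat.le_self_pow hr0.ne' p)
  have hq1 : 1 < p ^ h := Nat.one_lt_pow hh.ne' hp.one_lt
  set m := p ^ r - 1 with hm_def
  have hm : 0 < m := by omega
  have hn : 0 < n := by
    rcases Nat.eq_zero_or_pos n with rfl | hn
    · omega
    · exact hn
  have hnm : n * m = Fintype.card F - 1 := by rw [hcard, hnq]
  have hpow : ∀ {z : F}, z ≠ 0 → (z ^ m = 1 ↔ z ^ p ^ r = z) := by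
    intro z hz
    rw [show p ^ r = m + 1 by omega, pow_succ, mul_eq_right₀ hz]
  set G : F → ℕ := fun u => #{y : F | (a * u + c) * y ^ n = 1 - b * u} with hG
  have hcount : #{xy : F × F | a * xy.1 ^ n * xy.2 ^ n + b * xy.1 ^ n + c * xy.2 ^ n = 1}
      = ∑ x : F, G (x ^ n) := by
    simp only [hG, card_filter, Fintype.sum_prod_type]
    refine sum_congr rfl fun x _ => sum_congr rfl fun y _ => if_congr ?_ rfl rfl
    constructor <;> intro hxy <;> linear_combination hxy
  have hG_generic : ∀ u : F, u ^ p ^ r = u → a * u + c ≠ 0 → 1 - b * u ≠ 0 → G u = n := by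
    intro u hu hd he
    refine card_filter_mul_pow_eq hn hm hnm hd ((hpow (div_ne_zero he hd)).2 ?_)
    rw [div_pow, sub_pow_char_pow, add_pow_char_pow, mul_pow, mul_pow, ha, hb, hc, hu, one_pow]
  have hpole : ∀ u : F, a * u + c = 0 ↔ u = -c / a := by
    intro u
    rw [eq_div_iff ha0, mul_comm u, eq_neg_iff_add_eq_zero]
  have hzero : ∀ u : F, 1 - b * u = 0 ↔ u = b⁻¹ := by
    intro u
    rw [sub_eq_zero, eq_comm, mul_comm, mul_eq_one_iff_eq_inv₀ hb0]
  have hne : -c / a ≠ b⁻¹ := by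
    rw [Ne, div_eq_iff ha0, inv_mul_eq_div, eq_div_iff hb0]
    intro heq
    exact hbc (by linear_combination -heq)
  have hG_pole : G (-c / a) = 0 := by
    have he : 1 - b * (-c / a) ≠ 0 := fun heq => hne ((hzero _).1 heq)
    simp [hG, (hpole _).2 rfl, he.symm]
  have hG_zero : G b⁻¹ = 1 := by
    have hd : a * b⁻¹ + c ≠ 0 := fun heq => hne ((hpole _).1 heq).symm
    simp [hG, (hzero _).2 rfl, hd, hn.ne', Finset.filter_eq']
  have hpole_mem : (-c / a) ^ m = 1 := by
    rw [hpow (div_ne_zero (neg_ne_zero.2 hc0) ha0), div_pow, ha, ← zero_sub, sub_pow_char_pow, hc,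
      zero_pow (by omega)]
  have hzero_mem : (b⁻¹) ^ m = 1 := by
    rw [hpow (inv_ne_zero hb0), inv_pow, hb]
  have hcard_roots : #{u : F | u ^ m = 1} = m :=
    card_filter_pow_eq hm hn (by rw [mul_comm, hnm]) (one_pow n)
  have hsum : ∑ u : F with u ^ m = 1, G u = 1 + (p ^ r - 3) * n := by
    have hmem : (-c / a) ∈ ({u : F | u ^ m = 1} : Finset F) := by simpa using hpole_mem
    have hmem' : b⁻¹ ∈ ({u : F | u ^ m = 1} : Finset F).erase (-c / a) :=
      mem_erase.2 ⟨hne.symm, by simpa using hzero_mem⟩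
    rw [← add_sum_erase _ _ hmem, ← add_sum_erase _ _ hmem', hG_pole, hG_zero, zero_add,
      sum_congr rfl (g := fun _ => n), sum_const, card_erase_of_mem hmem',
      card_erase_of_mem hmem, hcard_roots, smul_eq_mul, show m - 1 - 1 = p ^ r - 3 by omega]
    intro u hu
    simp only [mem_erase, mem_filter, mem_univ, true_and] at hu
    have hu0 : u ≠ 0 := by
      rintro rfl
      simp [hm.ne'] at hu
    exact hG_generic u ((hpow hu0).1 hu.2.2) (mt (hpole u).1 hu.2.1) (mt (hzero u).1 hu.1)
  have hG0 : G 0 = n := hG_generic 0 (zero_pow (by omega)) (by simpa using hc0) (by simp)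
  rw [hcount, ← add_sum_erase _ _ (mem_univ (0 : F)), sum_pow_fibers hn hm hnm,
    zero_pow hn.ne', hG0,
    sum_congr rfl fun u hu => by rw [card_filter_pow_eq hn hm hnm (mem_filter.1 hu).2],
    ← mul_sum, hsum]
  ring
end

section
/- Let p > 5 be a prime, h a positive integer, q = p^h, and let F be a finite field with q elements. Let r be a positive integer with 2r dividing h, let n be the integer with n·(p^r + 1) = q − 1, and let e be the integer with e·(p^(2r) − 1) = q − 1. Let a, b, c ∈ F be nonzero with b·c ≠ −a, a·c^(p^r) = −b, a^(p^r + 1) = 1, and a·b^(p^r) = −c. Let N′ be the number of pairs (u, v) ∈ F × F with u ≠ 0, v ≠ 0, u^(p^(2r)) = u, v^(p^(2r)) = v, and a·u^(p^r−1)·v^(p^r−1) + b·u^(p^r−1) + c·v^(p^r−1) = 1. Then the number of pairs (x, y) ∈ F × F satisfying a·x^n·y^n + b·x^n + c·y^n = 1 equals e²·N′ + (δ(b) + δ(c))·n, where for nonzero d ∈ F, δ(d) = 1 if d^(p^r + 1) = 1 and δ(d) = 0 otherwise. -/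
/-- In a finite field with `k * m + 1` elements, a nonzero `d` has exactly `k` distinct `k`-th roots
if `d ^ m = 1`, and none otherwise. -/
theorem FiniteField.card_filter_pow_eq_s4 {F : Type*} [Field F] [Fintype F] [DecidableEq F]
    {k m : ℕ} (hkm : k * m = Fintype.card F - 1) {d : F} (hd : d ≠ 0) :
    (Finset.univ.filter (fun x : F => x ^ k = d)).card = if d ^ m = 1 then k else 0 := by
  have hpos : 0 < k * m := by
    have := Fintype.one_lt_card (α := F)
    omega
  have hk : 0 < k := Nat.pos_of_mul_pos_right hpos
  have hm : 0 < m := Nat.pos_of_mul_pos_left hpos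
  obtain ⟨g, hg⟩ := IsCyclic.exists_generator (α := Fˣ)
  have hord : orderOf g = k * m := by
    rw [orderOf_eq_card_of_forall_mem_zpowers hg, Nat.card_eq_fintype_card, Fintype.card_units, hkm]
  have hprim : IsPrimitiveRoot (g : F) (k * m) := by
    rw [IsPrimitiveRoot.coe_units_iff, ← hord]
    exact IsPrimitiveRoot.orderOf g
  have hζ : IsPrimitiveRoot ((g : F) ^ m) k := hprim.pow hpos (mul_comm k m)
  have hset : Finset.univ.filter (fun x : F => x ^ k = d) = (Polynomial.nthRoots k d).toFinset := by
    ext x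
    simp [Polynomial.mem_nthRoots hk]
  have hex : (∃ α : F, α ^ k = d) ↔ d ^ m = 1 := by
    constructor
    · rintro ⟨α, rfl⟩
      rw [← pow_mul, hkm]
      exact FiniteField.pow_card_sub_one_eq_one α (by rintro rfl; exact hd (zero_pow hk.ne'))
    · intro h
      have : NeZero (k * m) := ⟨hpos.ne'⟩
      obtain ⟨i, -, hi⟩ := hprim.eq_pow_of_pow_eq_one (ξ := d)
        (by rw [mul_comm, pow_mul, h, one_pow])
      rw [← hi, ← pow_mul, hprim.pow_eq_one_iff_dvd] at h
      obtain ⟨j, rfl⟩ := Nat.dvd_of_mul_dvd_mul_right hm h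
      exact ⟨(g : F) ^ j, by rw [← pow_mul, mul_comm, hi]⟩
  rw [hset, Multiset.toFinset_card_of_nodup (hζ.nthRoots_nodup hd), hζ.card_nthRoots]
  simp only [hex]

/-- In a finite field with `k * m + 1` elements, the pairs of nonzero elements whose `k`-th powers
satisfy `R` number `k ^ 2` times the pairs of `m`-th roots of unity satisfying `R`. -/
theorem FiniteField.card_filter_pow_pow {F : Type*} [Field F] [Fintype F] [DecidableEq F]
    {k m : ℕ} (hkm : k * m = Fintype.card F - 1) (R : F → F → Prop) [DecidableRel R] :
    (Finset.univ.filter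
      (fun xy : F × F => xy.1 ≠ 0 ∧ xy.2 ≠ 0 ∧ R (xy.1 ^ k) (xy.2 ^ k))).card
      = k ^ 2 * (Finset.univ.filter
        (fun uv : F × F => uv.1 ^ m = 1 ∧ uv.2 ^ m = 1 ∧ R uv.1 uv.2)).card := by
  have hpos : 0 < k * m := by
    have := Fintype.one_lt_card (α := F)
    omega
  have hk : 0 < k := Nat.pos_of_mul_pos_right hpos
  have hm : 0 < m := Nat.pos_of_mul_pos_left hpos
  have hroot {x : F} (hx : x ≠ 0) : (x ^ k) ^ m = 1 := by
    rw [← pow_mul, hkm, FiniteField.pow_card_sub_one_eq_one x hx]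
  rw [Finset.card_eq_sum_card_fiberwise (f := fun xy : F × F => (xy.1 ^ k, xy.2 ^ k))
    (t := Finset.univ.filter (fun uv : F × F => uv.1 ^ m = 1 ∧ uv.2 ^ m = 1 ∧ R uv.1 uv.2)),
    Finset.sum_const_nat (m := k ^ 2), mul_comm]
  · rintro ⟨u, v⟩ huv
    obtain ⟨hu, hv, hR⟩ := (Finset.mem_filter.mp huv).2
    have hne {w : F} (hw : w ^ m = 1) : w ≠ 0 := by
      rintro rfl
      simp [zero_pow hm.ne'] at hw
    have hfib : (Finset.univ.filter
        (fun xy : F × F => xy.1 ≠ 0 ∧ xy.2 ≠ 0 ∧ R (xy.1 ^ k) (xy.2 ^ k))).filter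
          (fun xy => (xy.1 ^ k, xy.2 ^ k) = (u, v))
        = Finset.univ.filter (fun x : F => x ^ k = u) ×ˢ
          Finset.univ.filter (fun y : F => y ^ k = v) := by
      ext ⟨x, y⟩
      simp only [Finset.mem_filter, Finset.mem_univ, true_and, Finset.mem_product, Prod.mk.injEq]
      refine ⟨fun h => h.2, fun h => ⟨⟨?_, ?_, ?_⟩, h⟩⟩
      · rintro rfl
        exact hne hu (h.1 ▸ zero_pow hk.ne')
      · rintro rfl
        exact hne hv (h.2 ▸ zero_pow hk.ne')
      · rw [h.1, h.2]
        exact hR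
    rw [hfib, Finset.card_product, card_filter_pow_eq_s4 hkm (hne hu), card_filter_pow_eq_s4 hkm (hne hv),
      if_pos hu, if_pos hv, sq]
  · rintro ⟨x, y⟩ hxy
    obtain ⟨hx, hy, hR⟩ := (Finset.mem_filter.mp (Finset.mem_coe.mp hxy)).2
    exact Finset.mem_coe.mpr
      (Finset.mem_filter.mpr ⟨Finset.mem_univ _, hroot hx, hroot hy, hR⟩)

/-- In a finite field with `k * m + 1` elements, `d * x ^ k = 1` has `k` solutions if `d ^ m = 1`,
and none otherwise. -/
theorem FiniteField.card_filter_mul_pow_eq_one {F : Type*} [Field F] [Fintype F] [DecidableEq F]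
    {k m : ℕ} (hkm : k * m = Fintype.card F - 1) {d : F} (hd : d ≠ 0) :
    (Finset.univ.filter (fun x : F => d * x ^ k = 1)).card = if d ^ m = 1 then k else 0 := by
  have h := card_filter_pow_eq_s4 hkm (inv_ne_zero hd)
  simp only [inv_pow, inv_eq_one] at h
  rw [← h]
  refine congrArg Finset.card (Finset.filter_congr fun x _ => ?_)
  rw [mul_comm, ← mul_eq_one_iff_eq_inv₀ hd]

theorem count_points_subfield_reduction
    (p h q : ℕ) (hp : p.Prime) (hp5 : 5 < p) (hh : 0 < h) (hq : q = p ^ h)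
    (F : Type*) [Field F] [Fintype F] [DecidableEq F] (hcard : Fintype.card F = q)
    (r : ℕ) (hr0 : 0 < r) (h2r : 2 * r ∣ h)
    (n : ℕ) (hnq : n * (p ^ r + 1) = q - 1)
    (e : ℕ) (heq : e * (p ^ (2 * r) - 1) = q - 1)
    (a b c : F) (ha0 : a ≠ 0) (hb0 : b ≠ 0) (hc0 : c ≠ 0)
    (hbc : b * c ≠ -a)
    (hac : a * c ^ p ^ r = -b) (ha1 : a ^ (p ^ r + 1) = 1)
    (hab : a * b ^ p ^ r = -c) :
    (Finset.univ.filter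
      (fun xy : F × F =>
        a * xy.1 ^ n * xy.2 ^ n + b * xy.1 ^ n + c * xy.2 ^ n = 1)).card
      = e ^ 2 *
          (Finset.univ.filter
            (fun uv : F × F =>
              uv.1 ≠ 0 ∧ uv.2 ≠ 0 ∧
              uv.1 ^ p ^ (2 * r) = uv.1 ∧ uv.2 ^ p ^ (2 * r) = uv.2 ∧
              a * uv.1 ^ (p ^ r - 1) * uv.2 ^ (p ^ r - 1)
                + b * uv.1 ^ (p ^ r - 1) + c * uv.2 ^ (p ^ r - 1) = 1)).card
        + ((if b ^ (p ^ r + 1) = 1 then 1 else 0)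
            + (if c ^ (p ^ r + 1) = 1 then 1 else 0)) * n := by
  subst hq
  have hQ1 : 1 < p ^ (2 * r) := Nat.one_lt_pow (by omega) hp.one_lt
  have hF : 1 < Fintype.card F := Fintype.one_lt_card
  rw [← hcard] at hnq heq
  have hn : 0 < n := Nat.pos_of_mul_pos_right (by omega : 0 < n * (p ^ r + 1))
  have hne : n = e * (p ^ r - 1) := by
    refine Nat.eq_of_mul_eq_mul_right (Nat.succ_pos (p ^ r)) ?_
    rw [Nat.succ_eq_add_one, hnq, ← heq, mul_assoc, mul_comm (p ^ r - 1), ← Nat.sq_sub_sq, one_pow,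
      ← pow_mul, mul_comm r]
  have hfixed (u : F) : u ≠ 0 ∧ u ^ p ^ (2 * r) = u ↔ u ^ (p ^ (2 * r) - 1) = 1 := by
    have hsucc : u ^ p ^ (2 * r) = u ^ (p ^ (2 * r) - 1) * u := by
      rw [← pow_succ, Nat.sub_add_cancel hQ1.le]
    constructor
    · rintro ⟨hu, h⟩
      exact mul_right_cancel₀ hu (by rw [← hsucc, h, one_mul])
    · intro h
      refine ⟨?_, by rw [hsucc, h, one_mul]⟩
      rintro rfl
      simp [zero_pow (by omega : p ^ (2 * r) - 1 ≠ 0)] at h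
  have htorus := FiniteField.card_filter_pow_pow heq (fun u v : F =>
    a * u ^ (p ^ r - 1) * v ^ (p ^ r - 1) + b * u ^ (p ^ r - 1) + c * v ^ (p ^ r - 1) = 1)
  simp only [← pow_mul, ← hne] at htorus
  have hsub : (Finset.univ.filter (fun uv : F × F =>
      uv.1 ≠ 0 ∧ uv.2 ≠ 0 ∧ uv.1 ^ p ^ (2 * r) = uv.1 ∧ uv.2 ^ p ^ (2 * r) = uv.2 ∧
        a * uv.1 ^ (p ^ r - 1) * uv.2 ^ (p ^ r - 1)
          + b * uv.1 ^ (p ^ r - 1) + c * uv.2 ^ (p ^ r - 1) = 1))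
      = Finset.univ.filter (fun uv : F × F =>
        uv.1 ^ (p ^ (2 * r) - 1) = 1 ∧ uv.2 ^ (p ^ (2 * r) - 1) = 1 ∧
          a * uv.1 ^ (p ^ r - 1) * uv.2 ^ (p ^ r - 1)
            + b * uv.1 ^ (p ^ r - 1) + c * uv.2 ^ (p ^ r - 1) = 1) := by
    refine Finset.filter_congr fun uv _ => ?_
    rw [← hfixed, ← hfixed]
    tauto
  have hsplit : Finset.univ.filter
      (fun xy : F × F => a * xy.1 ^ n * xy.2 ^ n + b * xy.1 ^ n + c * xy.2 ^ n = 1)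
      = Finset.univ.filter (fun xy : F × F => xy.1 ≠ 0 ∧ xy.2 ≠ 0 ∧
          a * xy.1 ^ n * xy.2 ^ n + b * xy.1 ^ n + c * xy.2 ^ n = 1)
        ∪ (Finset.univ.filter (fun x : F => b * x ^ n = 1) ×ˢ {0}
          ∪ {0} ×ˢ Finset.univ.filter (fun y : F => c * y ^ n = 1)) := by
    ext ⟨x, y⟩
    by_cases hx : x = 0 <;> by_cases hy : y = 0 <;> simp [hx, hy, hn.ne', @eq_comm F 0]
  have hdisj_axes : Disjoint (Finset.univ.filter (fun x : F => b * x ^ n = 1) ×ˢ {(0 : F)})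
      ({(0 : F)} ×ˢ Finset.univ.filter (fun y : F => c * y ^ n = 1)) := by
    rw [Finset.disjoint_left]
    rintro ⟨x, y⟩ h₁ h₂
    simp only [Finset.mem_product, Finset.mem_filter, Finset.mem_univ, true_and,
      Finset.mem_singleton] at h₁ h₂
    simp [h₂.1, hn.ne'] at h₁
  have hdisj_torus : Disjoint
      (Finset.univ.filter (fun xy : F × F => xy.1 ≠ 0 ∧ xy.2 ≠ 0 ∧
        a * xy.1 ^ n * xy.2 ^ n + b * xy.1 ^ n + c * xy.2 ^ n = 1))
      (Finset.univ.filter (fun x : F => b * x ^ n = 1) ×ˢ {(0 : F)}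
        ∪ {(0 : F)} ×ˢ Finset.univ.filter (fun y : F => c * y ^ n = 1)) := by
    rw [Finset.disjoint_left]
    rintro ⟨x, y⟩ h₁ h₂
    simp only [Finset.mem_union, Finset.mem_product, Finset.mem_filter, Finset.mem_univ, true_and,
      Finset.mem_singleton] at h₁ h₂
    tauto
  rw [hsplit, Finset.card_union_of_disjoint hdisj_torus, Finset.card_union_of_disjoint hdisj_axes,
    Finset.card_product, Finset.card_product, Finset.card_singleton,
    FiniteField.card_filter_mul_pow_eq_one hnq hb0, FiniteField.card_filter_mul_pow_eq_one hnq hc0,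
    htorus, hsub, add_mul]
  simp only [ite_mul, one_mul, mul_one, zero_mul]
end

section
/- Let p > 5 be a prime, h a positive integer, q = p^h, and let F be a finite field with q elements. Let r be a positive integer with 2r dividing h, let n be the integer with n·(p^r − 1) = q − 1, let m be the integer with m·(p^r + 1) = q − 1, and let e be the integer with e·(p^(2r) − 1) = q − 1. Let a, b, c ∈ F be nonzero with b·c ≠ −a, c·a^(p^r) = −b, c·b^(p^r) = −a, and c^(p^r + 1) = 1. Let N″ be the number of pairs (u, v) ∈ F × F with u ≠ 0, v ≠ 0, u^(p^(2r)) = u, v^(p^(2r)) = v, and a·u^(p^r+1)·v^(p^r−1) + b·u^(p^r+1) + c·v^(p^r−1) = 1. Then the number of pairs (x, y) ∈ F × F satisfying a·x^n·y^m + b·x^n + c·y^m = 1 equals e²·N″ + δ(c)·m + γ(b)·n, where δ(c) = 1 if c^(p^r+1) = 1 and δ(c) = 0 otherwise, and γ(b) = 1 if b^(p^r) = b and γ(b) = 0 otherwise. -/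
open Finset

/-- In a finite field with `d * k + 1` elements, a nonzero `z` has exactly `d` roots of degree `d`
if `z ^ k = 1`, and none otherwise. -/
theorem card_filter_pow_eq_of_mul_eq {F : Type*} [Field F] [Fintype F] [DecidableEq F] {d k : ℕ}
    (hdk : d * k = Fintype.card F - 1) {z : F} (hz : z ≠ 0) :
    #{x : F | x ^ d = z} = if z ^ k = 1 then d else 0 := by
  have hpos : 0 < d * k := by
    rw [hdk]
    exact Nat.sub_pos_of_lt Fintype.one_lt_card
  have hd : 0 < d := Nat.pos_of_mul_pos_right hpos
  have hk : 0 < k := Nat.pos_of_mul_pos_left hpos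
  obtain ⟨g, hg⟩ := IsCyclic.exists_generator (α := Fˣ)
  have hord : orderOf g = d * k := by
    rw [orderOf_eq_card_of_forall_mem_zpowers hg, Nat.card_eq_fintype_card, Fintype.card_units, hdk]
  have hprim : IsPrimitiveRoot ((g : F) ^ k) d := by
    have h : IsPrimitiveRoot (g : F) (d * k) :=
      IsPrimitiveRoot.coe_units_iff.mpr (hord ▸ IsPrimitiveRoot.orderOf g)
    exact h.pow hpos (mul_comm d k)
  have hex : (∃ x : F, x ^ d = z) ↔ z ^ k = 1 := by
    constructor
    · rintro ⟨x, rfl⟩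
      have hx : x ≠ 0 := fun h ↦ hz (by rw [h, zero_pow hd.ne'])
      rw [← pow_mul, hdk, FiniteField.pow_card_sub_one_eq_one x hx]
    · intro h
      obtain ⟨i, hi⟩ := (mem_powers_iff_mem_zpowers.mpr (hg (Units.mk0 z hz)))
      have hi' : g ^ i = Units.mk0 z hz := hi
      have h1 : g ^ (i * k) = 1 := by
        rw [pow_mul, hi']
        ext
        simpa using h
      have h2 : d * k ∣ i * k := hord ▸ orderOf_dvd_of_pow_eq_one h1
      obtain ⟨j, rfl⟩ := Nat.dvd_of_mul_dvd_mul_right hk h2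
      refine ⟨((g ^ j : Fˣ) : F), ?_⟩
      rw [← Units.val_pow_eq_pow_val, ← pow_mul, mul_comm j d, hi', Units.val_mk0]
  have hset : ({x : F | x ^ d = z} : Finset F) = (Polynomial.nthRoots d z).toFinset := by
    ext x
    simp [Polynomial.mem_nthRoots hd]
  rw [hset, Multiset.toFinset_card_of_nodup (hprim.nthRoots_nodup hz), hprim.card_nthRoots]
  simp only [hex]

theorem count_points_subfield_reduction_mixed
    (p h q : ℕ) (hp : p.Prime) (hp5 : 5 < p) (hh : 0 < h) (hq : q = p ^ h)
    (F : Type*) [Field F] [Fintype F] [DecidableEq F] (hcard : Fintype.card F = q)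
    (r : ℕ) (hr0 : 0 < r) (h2r : 2 * r ∣ h)
    (n : ℕ) (hnq : n * (p ^ r - 1) = q - 1)
    (m : ℕ) (hmq : m * (p ^ r + 1) = q - 1)
    (e : ℕ) (heq : e * (p ^ (2 * r) - 1) = q - 1)
    (a b c : F) (ha0 : a ≠ 0) (hb0 : b ≠ 0) (hc0 : c ≠ 0)
    (hbc : b * c ≠ -a)
    (hca : c * a ^ p ^ r = -b) (hcb : c * b ^ p ^ r = -a)
    (hc1 : c ^ (p ^ r + 1) = 1) :
    (Finset.univ.filter
      (fun xy : F × F =>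
        a * xy.1 ^ n * xy.2 ^ m + b * xy.1 ^ n + c * xy.2 ^ m = 1)).card
      = e ^ 2 *
          (Finset.univ.filter
            (fun uv : F × F =>
              uv.1 ≠ 0 ∧ uv.2 ≠ 0 ∧
              uv.1 ^ p ^ (2 * r) = uv.1 ∧ uv.2 ^ p ^ (2 * r) = uv.2 ∧
              a * uv.1 ^ (p ^ r + 1) * uv.2 ^ (p ^ r - 1)
                + b * uv.1 ^ (p ^ r + 1) + c * uv.2 ^ (p ^ r - 1) = 1)).card
        + (if c ^ (p ^ r + 1) = 1 then 1 else 0) * m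
        + (if b ^ p ^ r = b then 1 else 0) * n := by
  have hF : 1 < Fintype.card F := Fintype.one_lt_card
  subst hcard
  have hQ : 1 < p ^ r := Nat.one_lt_pow hr0.ne' hp.one_lt
  have hQ2 : p ^ (2 * r) - 1 = (p ^ r + 1) * (p ^ r - 1) := by
    rw [mul_comm 2 r, pow_mul, ← Nat.sq_sub_sq, one_pow]
  have hn : n = e * (p ^ r + 1) := by
    apply Nat.eq_of_mul_eq_mul_right (Nat.sub_pos_of_lt hQ)
    rw [hnq, ← heq, hQ2, mul_assoc]
  have hm : m = e * (p ^ r - 1) := by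
    apply Nat.eq_of_mul_eq_mul_right (Nat.succ_pos (p ^ r))
    rw [Nat.succ_eq_add_one, hmq, ← heq, hQ2, mul_assoc, mul_comm (p ^ r - 1)]
  have he : e ≠ 0 := by
    rintro rfl
    omega
  have hn0 : n ≠ 0 := by
    rintro rfl
    omega
  have hm0 : m ≠ 0 := by
    rintro rfl
    omega
  have hfix (k : ℕ) (hk : 0 < k) (u : F) (hu : u ≠ 0) : u ^ k = u ↔ u ^ (k - 1) = 1 := by
    obtain ⟨k, rfl⟩ := Nat.exists_eq_succ_of_ne_zero hk.ne'
    simp [pow_succ, hu]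
  have hx0 : #{xy : F × F | xy.1 = 0 ∧ c * xy.2 ^ m = 1}
      = (if c ^ (p ^ r + 1) = 1 then 1 else 0) * m := by
    have : ({xy : F × F | xy.1 = 0 ∧ c * xy.2 ^ m = 1} : Finset (F × F))
        = {0} ×ˢ ({y : F | y ^ m = c⁻¹} : Finset F) := by
      ext ⟨x, y⟩
      simp [mul_comm c, mul_eq_one_iff_eq_inv₀ hc0, and_comm]
      exact fun _ ↦ eq_comm
    rw [this, card_product, card_singleton, one_mul,
      card_filter_pow_eq_of_mul_eq hmq (inv_ne_zero hc0)]
    simp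
  have hy0 : #{xy : F × F | xy.2 = 0 ∧ b * xy.1 ^ n = 1}
      = (if b ^ p ^ r = b then 1 else 0) * n := by
    have : ({xy : F × F | xy.2 = 0 ∧ b * xy.1 ^ n = 1} : Finset (F × F))
        = ({x : F | x ^ n = b⁻¹} : Finset F) ×ˢ {0} := by
      ext ⟨x, y⟩
      simp [mul_comm b, mul_eq_one_iff_eq_inv₀ hb0, and_comm]
      exact fun _ ↦ eq_comm
    rw [this, card_product, card_singleton, mul_one,
      card_filter_pow_eq_of_mul_eq hnq (inv_ne_zero hb0)]
    simp [hfix _ (zero_lt_one.trans hQ) b hb0]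
  have hne : #{xy : F × F | xy.1 ≠ 0 ∧ xy.2 ≠ 0 ∧
        a * xy.1 ^ n * xy.2 ^ m + b * xy.1 ^ n + c * xy.2 ^ m = 1}
      = e ^ 2 * #{uv : F × F | uv.1 ≠ 0 ∧ uv.2 ≠ 0 ∧
          uv.1 ^ p ^ (2 * r) = uv.1 ∧ uv.2 ^ p ^ (2 * r) = uv.2 ∧
          a * uv.1 ^ (p ^ r + 1) * uv.2 ^ (p ^ r - 1)
            + b * uv.1 ^ (p ^ r + 1) + c * uv.2 ^ (p ^ r - 1) = 1} := by
    have hpow (x : F) (hx : x ≠ 0) : (x ^ e) ^ p ^ (2 * r) = x ^ e := by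
      rw [hfix _ (pow_pos hp.pos _) _ (pow_ne_zero _ hx), ← pow_mul, heq,
        FiniteField.pow_card_sub_one_eq_one x hx]
    rw [card_eq_sum_card_fiberwise (f := fun xy : F × F ↦ (xy.1 ^ e, xy.2 ^ e)), mul_comm]
    · apply sum_const_nat
      rintro ⟨u, v⟩ huv
      simp only [mem_filter, mem_univ, true_and] at huv
      obtain ⟨hu, hv, hu2, hv2, huv⟩ := huv
      have : ({xy ∈ ({xy : F × F | xy.1 ≠ 0 ∧ xy.2 ≠ 0 ∧
            a * xy.1 ^ n * xy.2 ^ m + b * xy.1 ^ n + c * xy.2 ^ m = 1} : Finset (F × F)) |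
            (xy.1 ^ e, xy.2 ^ e) = (u, v)} : Finset (F × F))
          = ({x : F | x ^ e = u} : Finset F) ×ˢ ({y : F | y ^ e = v} : Finset F) := by
        ext ⟨x, y⟩
        simp only [mem_filter, mem_univ, true_and, mem_product, Prod.mk.injEq]
        refine ⟨And.right, fun h ↦ ⟨⟨?_, ?_, ?_⟩, h⟩⟩
        · rintro rfl
          exact hu (by rw [← h.1, zero_pow he])
        · rintro rfl
          exact hv (by rw [← h.2, zero_pow he])
        · rw [hn, hm, pow_mul, pow_mul, h.1, h.2, huv]
      rw [this, card_product, card_filter_pow_eq_of_mul_eq heq hu,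
        card_filter_pow_eq_of_mul_eq heq hv, if_pos ((hfix _ (pow_pos hp.pos _) u hu).mp hu2),
        if_pos ((hfix _ (pow_pos hp.pos _) v hv).mp hv2), sq]
    · rintro ⟨x, y⟩ hxy
      simp only [coe_filter, mem_univ, true_and, Set.mem_ofPred_eq] at hxy ⊢
      obtain ⟨hx, hy, hxy⟩ := hxy
      refine ⟨pow_ne_zero _ hx, pow_ne_zero _ hy, hpow x hx, hpow y hy, ?_⟩
      rw [← pow_mul, ← pow_mul, ← hn, ← hm, hxy]
  rw [← hne, ← hx0, ← hy0, ← card_union_of_disjoint, ← card_union_of_disjoint]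
  · congr 1
    ext ⟨x, y⟩
    by_cases hx : x = 0 <;> by_cases hy : y = 0 <;> simp [hx, hy, hn0, hm0]
  · rw [disjoint_left]
    rintro ⟨x, y⟩ hxy
    simp only [mem_union, mem_filter, mem_univ, true_and] at hxy ⊢
    rintro ⟨rfl, -⟩
    rcases hxy with h | h
    · exact h.2.1 rfl
    · simp [hm0] at h
  · rw [disjoint_left]
    rintro ⟨x, y⟩ hxy
    simp only [mem_filter, mem_univ, true_and] at hxy ⊢
    exact fun h ↦ hxy.1 h.1
end

section
/- Let K be an algebraically closed field of characteristic p > 5, and let m, n be integers with n ≥ m > 2 and p not dividing m·n. Let a, b, c ∈ K be nonzero with b·c ≠ −a. Then the homogeneous polynomial a·X^n·Y^m + b·X^n·Z^m + c·Y^m·Z^n − Z^(m+n) is irreducible in the polynomial ring K[X, Y, Z]. -/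
theorem Derivation.apply_mem_of_mem_sq {R A : Type*} [CommRing R] [CommRing A] [Algebra R A]
    (D : Derivation R A A) (I : Ideal A) {f : A} (hf : f ∈ I ^ 2) : D f ∈ I := by
  rw [pow_two] at hf
  induction hf using Submodule.mul_induction_on' with
  | mem_mul_mem x hx y hy =>
    rw [D.leibniz]
    exact I.add_mem (I.mul_mem_right _ hx) (I.mul_mem_right _ hy)
  | add x _ y _ hx hy =>
    rw [map_add]
    exact I.add_mem hx hy

open MvPolynomial

theorem isUnit_of_dvd_fermat_coeffs {K : Type*} [Field K] {m n : ℕ} (hm : m ≠ 0) {a b c : K}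
    (ha : a ≠ 0) (hbc : b * c ≠ -a) {r : MvPolynomial (Fin 2) K}
    (hA : r ∣ C a * X 0 ^ m + C b * X 1 ^ m)
    (hB : r ∣ X 1 ^ n * (C c * X 0 ^ m - X 1 ^ m)) : IsUnit r := by
  have hX : Prime (X 1 : MvPolynomial (Fin 2) K) := X_prime
  have hu : b * c + a ≠ 0 := fun h => hbc (eq_neg_of_add_eq_zero_left h)
  have hdvd : r ∣ C (b * c + a) * X 1 ^ (n + m) := by
    have h := dvd_sub (hA.mul_left (C c * X 1 ^ n)) (hB.mul_left (C a))
    convert h using 1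
    simp only [map_add, map_mul]
    ring
  have hr : r ∣ X 1 ^ (n + m) := ((hu.isUnit.map C).dvd_mul_left).1 hdvd
  obtain ⟨i, -, hi⟩ := (dvd_prime_pow hX _).1 hr
  rcases Nat.eq_zero_or_pos i with rfl | hpos
  · exact associated_one_iff_isUnit.1 (by simpa using hi)
  · have hXA := ((dvd_pow_self (X 1) hpos.ne').trans hi.dvd').trans hA
    have h := map_dvd (eval ![(1 : K), 0]) hXA
    simp [hm, ha] at h

theorem generalized_fermat_homogeneous_irreducible
    (K : Type*) [Field K] [IsAlgClosed K]
    (p : ℕ) (hp : p.Prime) (hp5 : 5 < p) [CharP K p]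
    (m n : ℕ) (hm : 2 < m) (hmn : m ≤ n) (hpmn : ¬ p ∣ m * n)
    (a b c : K) (ha : a ≠ 0) (hb : b ≠ 0) (hc : c ≠ 0) (hbc : b * c ≠ -a) :
    Irreducible
      (C a * X 0 ^ n * X 1 ^ m + C b * X 0 ^ n * X 2 ^ m
        + C c * X 1 ^ m * X 2 ^ n - X 2 ^ (m + n) : MvPolynomial (Fin 3) K) := by
  have hm0 : m ≠ 0 := by lia
  have hn0 : n ≠ 0 := by lia
  have hmK : (m : K) ≠ 0 := fun h =>
    hpmn (((CharP.cast_eq_zero_iff K p m).1 h).mul_right n)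
  obtain ⟨d, hd⟩ := IsAlgClosed.exists_pow_nat_eq c⁻¹ (Nat.pos_of_ne_zero hm0)
  have hcd : c * d ^ m = 1 := by rw [hd, mul_inv_cancel₀ hc]
  have hd0 : d ≠ 0 := by
    rintro rfl
    simp [hm0] at hcd
  let A : MvPolynomial (Fin 2) K := C a * X 0 ^ m + C b * X 1 ^ m
  let B : MvPolynomial (Fin 2) K := X 1 ^ n * (C c * X 0 ^ m - X 1 ^ m)
  let P : Ideal (MvPolynomial (Fin 2) K) := RingHom.ker (eval ![d, 1])
  have hAP : A ∉ P := by
    intro h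
    have h' : a * d ^ m + b = 0 := by simpa [P, A, RingHom.mem_ker] using h
    exact hbc (by linear_combination c * h' - a * hcd)
  have hBP : B ∈ P := by simp [P, B, RingHom.mem_ker, hcd]
  have hBP2 : B ∉ P ^ 2 := by
    intro h
    have h' := Derivation.apply_mem_of_mem_sq (pderiv (R := K) (0 : Fin 2)) P h
    simp [P, B, RingHom.mem_ker, Derivation.leibniz_pow, pderiv_X, hmK, hc, hd0] at h'
  have hA0 : A ≠ 0 := fun h => hAP (h ▸ P.zero_mem)
  rw [← MulEquiv.irreducible_iff (finSuccEquiv K 2)]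
  have hf : finSuccEquiv K 2 (C a * X 0 ^ n * X 1 ^ m + C b * X 0 ^ n * X 2 ^ m
      + C c * X 1 ^ m * X 2 ^ n - X 2 ^ (m + n)) =
      Polynomial.C A * Polynomial.X ^ n + Polynomial.C B := by
    have h1 : finSuccEquiv K 2 (X 1) = Polynomial.C (X 0) := finSuccEquiv_X_succ (j := 0)
    have h2 : finSuccEquiv K 2 (X 2) = Polynomial.C (X 1) := finSuccEquiv_X_succ (j := 1)
    have hC (k : K) : finSuccEquiv K 2 (C k) = Polynomial.C (C k) := by
      simp [finSuccEquiv_apply]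
    simp only [map_add, map_sub, map_mul, map_pow, h1, h2, hC, finSuccEquiv_X_zero, A, B]
    ring
  rw [hf]
  have hdeg : (Polynomial.C A * Polynomial.X ^ n + Polynomial.C B).degree = (n : WithBot ℕ) := by
    rw [Polynomial.degree_add_C, Polynomial.degree_C_mul_X_pow n hA0]
    rw [Polynomial.degree_C_mul_X_pow n hA0]
    exact_mod_cast Nat.pos_of_ne_zero hn0
  have hnat := Polynomial.natDegree_eq_of_degree_eq_some hdeg
  have hcn : (Polynomial.C A * Polynomial.X ^ n + Polynomial.C B).coeff n = A := by
    simp [Polynomial.coeff_C, hn0]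
  have hc0 : (Polynomial.C A * Polynomial.X ^ n + Polynomial.C B).coeff 0 = B := by
    simp [hn0.symm]
  refine Polynomial.irreducible_of_eisenstein_criterion (P := P) (RingHom.ker_isPrime _)
    ?_ ?_ ?_ ?_ ?_
  · rwa [Polynomial.leadingCoeff, hnat, hcn]
  · intro k hk
    rw [hdeg] at hk
    have hkn : k ≠ n := by
      rintro rfl
      exact lt_irrefl _ hk
    by_cases hk0 : k = 0
    · rwa [hk0, hc0]
    · simp [Polynomial.coeff_C, Polynomial.coeff_X_pow, hkn, hk0]
  · rw [hdeg]
    exact_mod_cast Nat.pos_of_ne_zero hn0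
  · rwa [hc0]
  · intro r hr
    rw [Polynomial.C_dvd_iff_dvd_coeff] at hr
    exact isUnit_of_dvd_fermat_coeffs hm0 ha hbc ((hr n).trans hcn.dvd) ((hr 0).trans hc0.dvd)
end

section
/- Let K be an algebraically closed field of characteristic p > 5, and let m, n be integers with n ≥ m > 2 and p not dividing m·n. Let a, b, c ∈ K be nonzero with b·c ≠ −a, and let G = a·X^n·Y^m + b·X^n·Z^m + c·Y^m·Z^n − Z^(m+n) ∈ K[X, Y, Z]. Then for every (x, y, z) ∈ K³ with (x, y, z) ≠ (0, 0, 0) and G(x, y, z) = 0, the three partial derivatives ∂G/∂X, ∂G/∂Y, ∂G/∂Z all vanish at (x, y, z) if and only if either (y = 0 and z = 0) or (x = 0 and z = 0). In other words, the only singular points of the projective plane curve G = 0 are (1 : 0 : 0) and (0 : 1 : 0). -/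
open MvPolynomial

theorem generalized_fermat_singular_points
    (K : Type*) [Field K] [IsAlgClosed K]
    (p : ℕ) (hp : p.Prime) (hp5 : 5 < p) [CharP K p]
    (m n : ℕ) (hm : 2 < m) (hmn : m ≤ n) (hpmn : ¬ p ∣ m * n)
    (a b c : K) (ha : a ≠ 0) (hb : b ≠ 0) (hc : c ≠ 0) (hbc : b * c ≠ -a)
    (G : MvPolynomial (Fin 3) K)
    (hG : G = C a * X 0 ^ n * X 1 ^ m + C b * X 0 ^ n * X 2 ^ m
        + C c * X 1 ^ m * X 2 ^ n - X 2 ^ (m + n)) :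
    ∀ x y z : K, ¬ (x = 0 ∧ y = 0 ∧ z = 0) →
      eval ![x, y, z] G = 0 →
      ((∀ i : Fin 3, eval ![x, y, z] (pderiv i G) = 0) ↔
        ((y = 0 ∧ z = 0) ∨ (x = 0 ∧ z = 0))) := by
  intro x y z hne hG0
  have hm0 : (m : K) ≠ 0 := fun h =>
    hpmn (((CharP.cast_eq_zero_iff K p m).mp h).mul_right n)
  have hn0 : (n : K) ≠ 0 := fun h =>
    hpmn (((CharP.cast_eq_zero_iff K p n).mp h).mul_left m)
  have hm' : m ≠ 0 := by lia
  have hn' : n ≠ 0 := by lia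
  have hm1 : m - 1 ≠ 0 := by lia
  have hn1 : n - 1 ≠ 0 := by lia
  have hmn1 : m + n - 1 ≠ 0 := by lia
  have hX : eval ![x, y, z] (pderiv 0 G) = n * x ^ (n - 1) * (a * y ^ m + b * z ^ m) := by
    simp [hG, pderiv_X, Derivation.leibniz, Derivation.leibniz_pow]
    ring
  have hY : eval ![x, y, z] (pderiv 1 G) = m * y ^ (m - 1) * (a * x ^ n + c * z ^ n) := by
    simp [hG, pderiv_X, Derivation.leibniz, Derivation.leibniz_pow]
    ring
  have hZ : eval ![x, y, z] (pderiv 2 G) = m * b * x ^ n * z ^ (m - 1)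
      + n * c * y ^ m * z ^ (n - 1) - (m + n) * z ^ (m + n - 1) := by
    simp [hG, pderiv_X, Derivation.leibniz, Derivation.leibniz_pow]
    ring
  have hG0 : a * x ^ n * y ^ m + b * x ^ n * z ^ m + c * y ^ m * z ^ n - z ^ (m + n) = 0 := by
    simpa [hG] using hG0
  simp only [Fin.forall_fin_succ, IsEmpty.forall_iff, and_true]
  change eval ![x, y, z] (pderiv 0 G) = 0 ∧ eval ![x, y, z] (pderiv 1 G) = 0 ∧
    eval ![x, y, z] (pderiv 2 G) = 0 ↔ _
  rw [hX, hY, hZ]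
  constructor
  · rintro ⟨h0, h1, -⟩
    by_cases hx : x = 0
    · subst hx
      by_cases hy : y = 0
      · subst hy
        simp_all
      · simp_all
    · by_cases hy : y = 0
      · subst hy
        simp_all
      · have e0 : a * y ^ m + b * z ^ m = 0 := by simpa [hx, hn0] using h0
        have e1 : a * x ^ n + c * z ^ n = 0 := by simpa [hy, hm0] using h1
        have hz : z ≠ 0 := by
          rintro rfl
          simp_all
        have e2 : z ^ n * (c * y ^ m - z ^ m) = 0 := by
          linear_combination hG0 - x ^ n * e0
        have e3 : c * y ^ m - z ^ m = 0 := by simpa [hz] using e2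
        have e4 : y ^ m * (a + b * c) = 0 := by linear_combination e0 + b * e3
        have e5 : a + b * c = 0 := by simpa [hy] using e4
        exact absurd (by linear_combination e5) hbc
  · rintro (⟨rfl, rfl⟩ | ⟨rfl, rfl⟩) <;> simp [hm', hn', hm1, hn1, hmn1]
end

section
/- Let K be an algebraically closed field of characteristic different from 2, and let a ∈ K with a ≠ 0 and a ≠ −1. Then each of the four quadratic polynomials a·X·Y + X·Z + Y·Z − Z², a·X·Z + X·Y + Z² − Y·Z, a·Y·Z + X·Y + Z² − X·Z, and a·Z² + Y·Z + X·Z − X·Y is irreducible in the polynomial ring K[X, Y, Z]. -/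
open MvPolynomial

/-- A linear form `u Y + v Z` with `u ≠ 0` is irreducible. -/
lemma irreducible_C_mul_X_one_add_C_mul_X_two {K : Type*} [Field K] {u : K} (hu : u ≠ 0) (v : K) :
    Irreducible (C u * X 1 + C v * X 2 : MvPolynomial (Fin 3) K) := by
  classical
  refine irreducible_mul_X_add _ _ _ (by simpa using hu) (by simp) (fun h ↦ ?_) ?_
  · simpa using vars_mul _ _ h
  · exact ((isUnit_iff_ne_zero.mpr hu).map C).isRelPrime_left

/-- The conic `(u Y + v Z) X + Z (s Y + t Z)` is irreducible if `u ≠ 0` and the linear forms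
`u Y + v Z` and `s Y + t Z` are not proportional. -/
lemma irreducible_linear_mul_X_zero_add {K : Type*} [Field K] {u v s t : K} (hu : u ≠ 0)
    (hdet : u * t - v * s ≠ 0) :
    Irreducible ((C u * X 1 + C v * X 2) * X 0 + X 2 * (C s * X 1 + C t * X 2) :
      MvPolynomial (Fin 3) K) := by
  classical
  have hlin := irreducible_C_mul_X_one_add_C_mul_X_two hu v
  have hvars (p q : K) : (0 : Fin 3) ∉ (C p * X 1 + C q * X 2 : MvPolynomial (Fin 3) K).vars := by
    intro h
    rcases Finset.mem_union.mp (vars_add_subset _ _ h) with h | h <;> simpa using vars_mul _ _ h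
  refine irreducible_mul_X_add _ _ _ hlin.ne_zero (hvars u v) (fun h ↦ ?_) ?_
  · rcases Finset.mem_union.mp (vars_mul _ _ h) with h | h
    · simp at h
    · exact hvars s t h
  · refine hlin.isRelPrime_iff_not_dvd.mpr fun h ↦ mul_ne_zero hu hdet ?_
    have := map_dvd (eval ![0, -v, u]) h
    simp only [map_add, map_mul, eval_C, eval_X, Matrix.cons_val] at this
    rw [show u * -v + v * u = 0 by ring, zero_dvd_iff] at this
    linear_combination this

theorem four_conics_irreducible
    (K : Type*) [Field K] [IsAlgClosed K] (hchar : ringChar K ≠ 2)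
    (a : K) (ha0 : a ≠ 0) (ha1 : a ≠ -1) :
    Irreducible
        (C a * X 0 * X 1 + X 0 * X 2 + X 1 * X 2 - X 2 ^ 2 :
          MvPolynomial (Fin 3) K) ∧
    Irreducible
        (C a * X 0 * X 2 + X 0 * X 1 + X 2 ^ 2 - X 1 * X 2 :
          MvPolynomial (Fin 3) K) ∧
    Irreducible
        (C a * X 1 * X 2 + X 0 * X 1 + X 2 ^ 2 - X 0 * X 2 :
          MvPolynomial (Fin 3) K) ∧
    Irreducible
        (C a * X 2 ^ 2 + X 1 * X 2 + X 0 * X 2 - X 0 * X 1 :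
          MvPolynomial (Fin 3) K) := by
  have ha : a + 1 ≠ 0 := fun h ↦ ha1 (eq_neg_of_add_eq_zero_left h)
  have ha' : -(a + 1) ≠ 0 := neg_ne_zero.mpr ha
  refine ⟨?_, ?_, ?_, ?_⟩
  · convert irreducible_linear_mul_X_zero_add (u := a) (v := 1) (s := 1) (t := -1) ha0
      (by convert ha' using 1; ring) using 1
    simp only [map_neg, map_one]
    ring
  · convert irreducible_linear_mul_X_zero_add (u := 1) (v := a) (s := -1) (t := 1) one_ne_zero
      (by convert ha using 1; ring) using 1
    simp only [map_neg, map_one]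
    ring
  · convert irreducible_linear_mul_X_zero_add (u := 1) (v := -1) (s := a) (t := 1) one_ne_zero
      (by convert ha using 1; ring) using 1
    simp only [map_neg, map_one]
    ring
  · convert irreducible_linear_mul_X_zero_add (u := -1) (v := 1) (s := 1) (t := a)
      (neg_ne_zero.mpr one_ne_zero) (by convert ha' using 1; ring) using 1
    simp only [map_neg, map_one]
    ring
end

section
/- Let p > 5 be a prime, h a positive integer, q = p^h, and let F be a finite field with q elements. Let m, n be integers with n ≥ m > 2, p not dividing m·n, p dividing n − 2 and p dividing m − 2, and let a, b ∈ F be nonzero. Then, in the polynomial ring F[X, Y], the polynomial a·X^n + b·Y^m − 1 divides the polynomial a·X^(n−2+2q) + b·Y^(m−2+2q) − 1 if and only if there exists a positive integer r < h with r dividing h such that m = n, n·(p^r − 1) = 2(q − 1), a^(p^r) = a, and b^(p^r) = b. -/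
open MvPolynomial

/-- If `p ^ r - 1` divides `2 * (p ^ h - 1)` with `3 ≤ p`, then `r ∣ h`. -/
theorem Nat.dvd_of_pow_sub_one_dvd_two_mul {p r h : ℕ} (hp : 3 ≤ p) (hr : 0 < r)
    (hdvd : p ^ r - 1 ∣ 2 * (p ^ h - 1)) : r ∣ h := by
  have h1 : p ^ r - 1 ∣ 2 * (p ^ Nat.gcd r h - 1) := by
    rw [← Nat.pow_sub_one_gcd_pow_sub_one, ← Nat.gcd_mul_left]
    exact Nat.dvd_gcd (Dvd.intro_left 2 rfl) hdvd
  have hg : 0 < Nat.gcd r h := Nat.gcd_pos_of_pos_left h hr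
  obtain ⟨t, ht⟩ := Nat.gcd_dvd_left r h
  set g := Nat.gcd r h with hgdef
  have hpg : 3 ≤ p ^ g := hp.trans (Nat.le_self_pow hg.ne' p)
  have ht1 : t = 1 := by
    by_contra hne
    have ht2 : 2 ≤ t := by
      rcases t with _ | _ | t
      · omega
      · omega
      · omega
    have hle : p ^ g * p ^ g ≤ p ^ r := by
      rw [← pow_add]
      exact Nat.pow_le_pow_right (by omega) (by nlinarith)
    have := Nat.le_of_dvd (by omega) h1
    have h3 : 3 * p ^ g ≤ p ^ g * p ^ g := Nat.mul_le_mul_right _ hpg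
    omega
  rw [ht1, mul_one] at ht
  rw [ht, hgdef]
  exact Nat.gcd_dvd_right r h

namespace Polynomial

theorem coeff_one_sub_C_mul_X_pow_pow {R : Type*} [CommRing R] (d : R) {j : ℕ} (hj : 0 < j)
    (u : ℕ) : ((1 - C d * X ^ j) ^ u : R[X]).coeff j = -(u * d) := by
  obtain ⟨k, hk⟩ := powAddExpansion (1 : R[X]) (-(C d * X ^ j)) u
  have hexp : ((1 - C d * X ^ j) ^ u : R[X]) =
      1 - C (u * d) * X ^ j + k * C (d ^ 2) * X ^ (2 * j) := by
    rw [sub_eq_add_neg, hk]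
    simp only [one_pow, map_mul, map_natCast, map_pow]
    ring
  rw [hexp, coeff_add, coeff_sub, coeff_C_mul, coeff_X_pow_self, coeff_mul_X_pow',
    coeff_one, if_neg hj.ne', if_neg (by omega)]
  ring

/-- Over a field of characteristic `p`, a power of `1 - a X ^ n` is proportional to a binomial
`1 - a X ^ N` only when the exponent is a power of `p`. -/
theorem exists_pow_eq_of_one_sub_C_mul_X_pow_pow {K : Type*} [Field K] {p : ℕ}
    (hp : p.Prime) [CharP K p] {a β : K} (ha : a ≠ 0) {n N k : ℕ} (hn : 0 < n) (hN : 0 < N)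
    (h : C β * (1 - C a * X ^ n) ^ k = (1 - C a * X ^ N : K[X])) :
    β = 1 ∧ N = n * k ∧ ∃ e, k = p ^ e ∧ a ^ p ^ e = a := by
  have := Fact.mk hp
  have hβ : β = 1 := by
    have := congrArg (eval 0) h
    simpa [hn.ne', hN.ne'] using this
  subst hβ
  rw [C_1, one_mul] at h
  have hdeg : ∀ c : K, c ≠ 0 → ∀ i : ℕ, (1 - C c * X ^ i : K[X]).natDegree = i := by
    intro c hc i
    rcases Nat.eq_zero_or_pos i with rfl | hi
    · have : (1 - C c * X ^ 0 : K[X]) = C (1 - c) := by simp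
      rw [this, natDegree_C]
    · rw [natDegree_sub_eq_right_of_natDegree_lt, natDegree_C_mul_X_pow i c hc]
      rwa [natDegree_one, natDegree_C_mul_X_pow i c hc]
  have hNk : N = n * k := by
    have := congrArg natDegree h
    rw [natDegree_pow, hdeg a ha, hdeg a ha] at this
    rw [← this, mul_comm]
  have hk : k ≠ 0 := by
    rintro rfl
    omega
  obtain ⟨e, u, hu, hku⟩ := Nat.exists_eq_pow_mul_and_not_dvd hk p hp.ne_one
  have hpe : 0 < p ^ e := pow_pos hp.pos e
  have hj : 0 < n * p ^ e := Nat.mul_pos hn hpe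
  have h' : (1 - C (a ^ p ^ e) * X ^ (n * p ^ e)) ^ u = (1 - C a * X ^ N : K[X]) := by
    rw [← h, hku, pow_mul _ (p ^ e) u, sub_pow_char_pow, one_pow, mul_pow, ← pow_mul, C_pow]
  have hcoeff := congrArg (fun f : K[X] => f.coeff (n * p ^ e)) h'
  simp only [coeff_one_sub_C_mul_X_pow_pow _ hj, coeff_sub, coeff_one, if_neg hj.ne',
    coeff_C_mul, coeff_X_pow, zero_sub, neg_inj] at hcoeff
  have hu0 : (u : K) ≠ 0 := fun h0 => hu ((CharP.cast_eq_zero_iff K p u).1 h0)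
  have hne : (u : K) * a ^ p ^ e ≠ 0 := mul_ne_zero hu0 (pow_ne_zero _ ha)
  have hNe : n * p ^ e = N := by
    by_contra hcon
    rw [if_neg hcon, mul_zero] at hcoeff
    exact hne hcoeff
  have hkpe : k = p ^ e := Nat.eq_of_mul_eq_mul_left hn (by rw [hNe, hNk])
  have hu1 : u = 1 := Nat.eq_of_mul_eq_mul_left hpe (by rw [← hku, hkpe, mul_one])
  refine ⟨rfl, hNk, e, hkpe, ?_⟩
  simpa [hu1, hNe] using hcoeff

/-- If `Y ^ m - c` divides `g + d Y ^ M` with `c, d ≠ 0`, then `m ∣ M` and the remainder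
`g + d c ^ (M / m)` vanishes. -/
theorem dvd_and_eq_zero_of_X_pow_sub_C_dvd {R : Type*} [CommRing R] [IsDomain R] {c d g : R}
    (hc : c ≠ 0) (hd : d ≠ 0) {m M : ℕ} (hm : 0 < m)
    (h : (X ^ m - C c : R[X]) ∣ C g + C d * X ^ M) :
    m ∣ M ∧ g + d * c ^ (M / m) = 0 := by
  have hs : M % m < m := Nat.mod_lt M hm
  have hpow : (X ^ m - C c : R[X]) ∣ (X ^ m) ^ (M / m) - (C c) ^ (M / m) :=
    sub_dvd_pow_sub_pow _ _ _
  have hrem : (X ^ m - C c : R[X]) ∣ C g + C (d * c ^ (M / m)) * X ^ (M % m) := by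
    have h2 := dvd_sub h (hpow.mul_left (C d * X ^ (M % m)))
    convert h2 using 1
    have hX : (X ^ M : R[X]) = X ^ (M % m) * (X ^ m) ^ (M / m) := by
      rw [← pow_mul, ← pow_add, Nat.mod_add_div]
    rw [hX, C_mul, C_pow]
    ring
  have hzero : C g + C (d * c ^ (M / m)) * X ^ (M % m) = 0 := by
    by_contra hne
    refine (monic_X_pow_sub_C c hm.ne').not_dvd_of_degree_lt hne ?_ hrem
    rw [degree_X_pow_sub_C hm]
    refine (degree_add_le _ _).trans_lt (max_lt ?_ ?_)
    · exact degree_C_le.trans_lt (by exact_mod_cast hm)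
    · exact (degree_C_mul_X_pow_le _ _).trans_lt (by exact_mod_cast hs)
  have hs0 : M % m = 0 := by
    by_contra hne
    have := congrArg (fun f : R[X] => f.coeff (M % m)) hzero
    simp only [coeff_add, coeff_C, if_neg hne, coeff_C_mul, coeff_X_pow_self, zero_add, mul_one,
      coeff_zero] at this
    exact mul_ne_zero hd (pow_ne_zero _ hc) this
  refine ⟨Nat.dvd_of_mod_eq_zero hs0, ?_⟩
  rw [hs0, pow_zero, mul_one, ← C_add] at hzero
  exact C_eq_zero.1 hzero

end Polynomial

/-- Divisibility between generalized Fermat polynomials with the same coefficients forces the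
exponents to be scaled by a common power of the characteristic that fixes the coefficients. -/
theorem MvPolynomial.exists_pow_of_fermat_dvd {K : Type*} [Field K] {p : ℕ} (hp : p.Prime)
    [CharP K p] {a b : K} (ha : a ≠ 0) (hb : b ≠ 0) {n m N M : ℕ} (hn : 0 < n) (hm : 0 < m)
    (hN : 0 < N)
    (h : (C a * X 0 ^ n + C b * X 1 ^ m - 1 : MvPolynomial (Fin 2) K) ∣
      C a * X 0 ^ N + C b * X 1 ^ M - 1) :
    ∃ e, N = n * p ^ e ∧ M = m * p ^ e ∧ a ^ p ^ e = a ∧ b ^ p ^ e = b := by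
  let c : Polynomial K := Polynomial.C b⁻¹ * (1 - Polynomial.C a * Polynomial.X ^ n)
  have hbb : (Polynomial.C b * Polynomial.C b⁻¹ : Polynomial K) = 1 := by
    rw [← Polynomial.C_mul, mul_inv_cancel₀ hb, Polynomial.C_1]
  have hc : c ≠ 0 := by
    intro h0
    have := congrArg (Polynomial.eval 0) h0
    simp [c, hn.ne', hb] at this
  let φ := MvPolynomial.eval₂Hom (Polynomial.C.comp (Polynomial.C : K →+* Polynomial K))
    (![Polynomial.C Polynomial.X, Polynomial.X] : Fin 2 → Polynomial (Polynomial K))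
  have hφ : ∀ i j : ℕ, φ (C a * X 0 ^ i + C b * X 1 ^ j - 1) =
      Polynomial.C (Polynomial.C a * Polynomial.X ^ i - 1) +
        Polynomial.C (Polynomial.C b) * Polynomial.X ^ j := by
    intro i j
    simp only [φ, map_sub, map_add, map_mul, map_pow, map_one, MvPolynomial.coe_eval₂Hom,
      MvPolynomial.eval₂_C, MvPolynomial.eval₂_X, RingHom.comp_apply, Matrix.cons_val_zero,
      Matrix.cons_val_one]
    ring
  have hdvd := map_dvd φ h
  rw [hφ, hφ] at hdvd
  have hdvd' : Polynomial.X ^ m - Polynomial.C c ∣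
      Polynomial.C (Polynomial.C a * Polynomial.X ^ N - 1) +
        Polynomial.C (Polynomial.C b) * Polynomial.X ^ M := by
    refine Dvd.dvd.trans ⟨Polynomial.C (Polynomial.C b), ?_⟩ hdvd
    have hbb' := congrArg (Polynomial.C : Polynomial K → _) hbb
    simp only [c, map_mul, map_sub, map_one] at hbb' ⊢
    linear_combination
      (1 - Polynomial.C (Polynomial.C a) * Polynomial.C (Polynomial.X ^ n)) * hbb'
  obtain ⟨⟨k, hk⟩, hzero⟩ := Polynomial.dvd_and_eq_zero_of_X_pow_sub_C_dvd hc
    (Polynomial.C_ne_zero.2 hb) hm hdvd'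
  rw [hk, Nat.mul_div_cancel_left k hm] at hzero
  have hid : Polynomial.C (b * b⁻¹ ^ k) * (1 - Polynomial.C a * Polynomial.X ^ n) ^ k =
      1 - Polynomial.C a * Polynomial.X ^ N := by
    simp only [c, mul_pow] at hzero
    rw [Polynomial.C_mul, Polynomial.C_pow]
    linear_combination hzero
  obtain ⟨hβ, hNk, e, rfl, hae⟩ :=
    Polynomial.exists_pow_eq_of_one_sub_C_mul_X_pow_pow hp ha hn hN hid
  refine ⟨e, hNk, hk, hae, ?_⟩
  rw [inv_pow, mul_inv_eq_one₀ (pow_ne_zero _ hb)] at hβ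
  exact hβ.symm

theorem frobenius_nonclassical_conics_n2_m2
    (p h q : ℕ) (hp : p.Prime) (hp5 : 5 < p) (hh : 0 < h) (hq : q = p ^ h)
    (F : Type*) [Field F] [Fintype F] (hcard : Fintype.card F = q)
    (m n : ℕ) (hm : 2 < m) (hmn : m ≤ n) (hpmn : ¬ p ∣ m * n)
    (hpn : p ∣ n - 2) (hpm : p ∣ m - 2)
    (a b : F) (ha : a ≠ 0) (hb : b ≠ 0) :
    ((C a * X 0 ^ n + C b * X 1 ^ m - 1 : MvPolynomial (Fin 2) F) ∣
        (C a * X 0 ^ (n - 2 + 2 * q) + C b * X 1 ^ (m - 2 + 2 * q) - 1)) ↔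
      ∃ r : ℕ, 0 < r ∧ r < h ∧ r ∣ h ∧ m = n ∧ n * (p ^ r - 1) = 2 * (q - 1) ∧
        a ^ p ^ r = a ∧ b ^ p ^ r = b := by
  have := Fact.mk hp
  have hchar : CharP F p := charP_of_card_eq_prime_pow (f := h) (by rw [hcard, hq])
  have hq1 : 1 < q := hq ▸ Nat.one_lt_pow hh.ne' hp.one_lt
  constructor
  · intro hdvd
    obtain ⟨r, hN, hM, har, hbr⟩ := MvPolynomial.exists_pow_of_fermat_dvd hp ha hb
      (by omega) (by omega) (by omega) hdvd
    have hpr : 0 < p ^ r := pow_pos hp.pos r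
    have hn' : n * (p ^ r - 1) = 2 * (q - 1) := by
      rw [Nat.mul_sub, ← hN]
      omega
    have hm' : m * (p ^ r - 1) = 2 * (q - 1) := by
      rw [Nat.mul_sub, ← hM]
      omega
    have hpos : 0 < p ^ r - 1 := by
      refine Nat.pos_of_ne_zero fun h0 => ?_
      rw [h0] at hn'
      omega
    have hr : 0 < r := by
      refine Nat.pos_of_ne_zero fun h0 => ?_
      simp [h0] at hpos
    have hlt : p ^ r < p ^ h := by
      rw [← hq]
      have : 2 * (p ^ r - 1) < m * (p ^ r - 1) := Nat.mul_lt_mul_of_pos_right hm hpos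
      omega
    refine ⟨r, hr, (Nat.pow_lt_pow_iff_right hp.one_lt).1 hlt, ?_,
      Nat.eq_of_mul_eq_mul_right hpos (hm'.trans hn'.symm), hn', har, hbr⟩
    refine Nat.dvd_of_pow_sub_one_dvd_two_mul (p := p) (by omega) hr ?_
    rw [← hq, ← hn']
    exact Dvd.intro_left n rfl
  · rintro ⟨r, hr, -, -, rfl, hn', har, hbr⟩
    have hN : m - 2 + 2 * q = m * p ^ r := by
      have hpr : 0 < p ^ r := pow_pos hp.pos r
      have hle : m ≤ m * p ^ r := Nat.le_mul_of_pos_right m hpr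
      rw [Nat.mul_sub] at hn'
      omega
    have hpow : (C a * X 0 ^ (m * p ^ r) + C b * X 1 ^ (m * p ^ r) - 1 :
        MvPolynomial (Fin 2) F) = (C a * X 0 ^ m + C b * X 1 ^ m - 1) ^ p ^ r := by
      rw [sub_pow_char_pow, add_pow_char_pow, mul_pow, mul_pow, ← C_pow, ← C_pow, har, hbr,
        one_pow, pow_mul, pow_mul]
    rw [hN, hpow]
    exact dvd_pow_self _ (pow_pos hp.pos r).ne'
end

section
/- Let p > 5 be a prime, h a positive integer, q = p^h, and let F be a finite field with q elements. Let m, n be integers with n ≥ m > 2, p not dividing m·n, p dividing n + 1 and p dividing m + 1, and let a, b ∈ F be nonzero. Then, in the polynomial ring F[X, Y], the polynomial a·X^n + b·Y^m − 1 divides the polynomial a·X^(n+1)·Y^q + b·X^q·Y^(m+1) − X^q·Y^q if and only if m = n, q = n + 1, and a + b = 1. -/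
open MvPolynomial

theorem aeval_dvd_aeval_of_dvd_X_pow_mul {F σ R : Type*} [Field F] [CommRing R] [Algebra F R]
    (x : σ → R) {i : σ} (hx : x i = 0) {f g : MvPolynomial σ F} (hf : aeval x f ≠ 0) (k : ℕ)
    (h : f ∣ X i ^ k * g) : aeval x f ∣ aeval x g := by
  obtain ⟨c, hc⟩ := h
  have hX : ¬ (X i : MvPolynomial σ F) ∣ f := by
    rintro ⟨d, rfl⟩
    simp [hx] at hf
  obtain ⟨d, rfl⟩ := (X_prime (i := i)).pow_dvd_of_dvd_mul_left k hX ⟨g, hc.symm⟩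
  have hg : g = f * d := by
    refine mul_left_cancel₀ (pow_ne_zero k (X_ne_zero i)) (hc.trans ?_)
    ring
  exact ⟨aeval x d, by rw [hg, map_mul]⟩

theorem Polynomial.eq_zero_of_C_mul_X_pow_sub_one_dvd_X_pow_mul {F : Type*} [Field F] {c : F}
    (hc : c ≠ 0) {m : ℕ} {r : Polynomial F} (hr : r.natDegree < m) (k : ℕ)
    (h : Polynomial.C c * Polynomial.X ^ m - 1 ∣ Polynomial.X ^ k * r) : r = 0 := by
  have hm : m ≠ 0 := by omega
  have hcop : IsCoprime (Polynomial.C c * Polynomial.X ^ m - 1 : Polynomial F)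
      (Polynomial.X ^ k) := by
    refine IsCoprime.pow_right ⟨-1, Polynomial.C c * Polynomial.X ^ (m - 1), ?_⟩
    rw [mul_assoc, ← pow_succ, Nat.sub_add_cancel (by omega)]
    ring
  refine Polynomial.eq_zero_of_dvd_of_natDegree_lt (hcop.dvd_of_dvd_mul_left h) ?_
  rwa [← Polynomial.C_1, Polynomial.natDegree_sub_C, Polynomial.natDegree_C_mul_X_pow m c hc]

/-- If the curve `a x ^ n + b y ^ m = 1` lies on `x ^ k * g = 0`, and `g` restricts to
`y ^ l * r` on the line `x = 0` with `r` of degree less than `m`, then `r = 0`. -/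
theorem eq_zero_of_fermat_dvd_X_pow_mul {F : Type*} [Field F] {i j : Fin 2} (hij : i ≠ j)
    {a b : F} (hb : b ≠ 0) {m n : ℕ} (hn : n ≠ 0) (k l : ℕ)
    {g : MvPolynomial (Fin 2) F} {r : Polynomial F} (hr : r.natDegree < m)
    (hg : aeval (Function.update (fun _ => Polynomial.X) i 0 : Fin 2 → Polynomial F) g
      = Polynomial.X ^ l * r)
    (h : C a * X i ^ n + C b * X j ^ m - 1 ∣ X i ^ k * g) : r = 0 := by
  have hm : m ≠ 0 := by omega
  set x : Fin 2 → Polynomial F := Function.update (fun _ => Polynomial.X) i 0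
  have hi : x i = 0 := by simp [x]
  have hj : x j = Polynomial.X := by simp [x, hij.symm]
  have hf : aeval x (C a * X i ^ n + C b * X j ^ m - 1 : MvPolynomial (Fin 2) F)
      = Polynomial.C b * Polynomial.X ^ m - 1 := by
    simp [hi, hj, hn, Polynomial.algebraMap_eq, algHom_C]
  have hf0 : (Polynomial.C b * Polynomial.X ^ m - 1 : Polynomial F) ≠ 0 := fun h0 => by
    simpa [hm] using congrArg (Polynomial.eval 0) h0
  have key := aeval_dvd_aeval_of_dvd_X_pow_mul x hi (hf ▸ hf0) k h
  rw [hf, hg] at key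
  exact Polynomial.eq_zero_of_C_mul_X_pow_sub_one_dvd_X_pow_mul hb hr l key

/-- With the notation of the curve `a x ^ n + b y ^ m = 1`, divisibility forces `q ≤ n + 1`. -/
theorem le_succ_of_fermat_dvd {F : Type*} [Field F] {i j : Fin 2} (hij : i ≠ j)
    {a b : F} (ha : a ≠ 0) (hb : b ≠ 0) {m n q : ℕ} (hm : m ≠ 0) (hn : n ≠ 0)
    (h : (C a * X i ^ n + C b * X j ^ m - 1 : MvPolynomial (Fin 2) F) ∣
      C a * X i ^ (n + 1) * X j ^ q + C b * X i ^ q * X j ^ (m + 1) - X i ^ q * X j ^ q) :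
    q ≤ n + 1 := by
  by_contra! hlt
  obtain ⟨d, rfl⟩ := Nat.exists_eq_add_of_lt hlt
  refine ha (Polynomial.C_eq_zero.1 (eq_zero_of_fermat_dvd_X_pow_mul hij (a := a) hb hn (n + 1)
    (n + 1 + d + 1) (g := C a * X j ^ (n + 1 + d + 1)
      + X i ^ (d + 1) * (C b * X j ^ (m + 1) - X j ^ (n + 1 + d + 1)))
    (r := Polynomial.C a) (by simpa using Nat.pos_of_ne_zero hm) ?_ ?_))
  · rw [mul_comm (Polynomial.X ^ _)]
    simp [hij.symm, Polynomial.algebraMap_eq, algHom_C]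
  · convert h using 1
    ring

/-- The curve `a x ^ n + b y ^ m = 1` lies on `x ^ q * y ^ q * (a * x ^ s + b * y ^ t - 1) = 0`
with `t < m` only if `s = 0`. -/
theorem eq_zero_of_fermat_dvd_X_pow_mul_X_pow_mul {F : Type*} [Field F] {i j : Fin 2}
    (hij : i ≠ j) {a b : F} (ha : a ≠ 0) (hb : b ≠ 0) {m n q s t : ℕ} (hn : n ≠ 0)
    (ht : t < m)
    (h : (C a * X i ^ n + C b * X j ^ m - 1 : MvPolynomial (Fin 2) F) ∣
      X i ^ q * (X j ^ q * (C a * X i ^ s + C b * X j ^ t - 1))) :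
    s = 0 := by
  by_contra hs
  have h0 : (Polynomial.C b * Polynomial.X ^ t - 1 : Polynomial F) = 0 := by
    refine eq_zero_of_fermat_dvd_X_pow_mul hij (a := a) hb hn q q ?_ ?_ h
    · rwa [← Polynomial.C_1, Polynomial.natDegree_sub_C, Polynomial.natDegree_C_mul_X_pow t b hb]
    · simp [hij.symm, hs, Polynomial.algebraMap_eq, algHom_C]
  have ht0 : t = 0 := by
    by_contra ht0
    simpa [ht0] using congrArg (Polynomial.eval 0) h0
  subst ht0
  have hb1 : b = 1 := by
    simpa [sub_eq_zero] using congrArg (Polynomial.eval 0) h0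
  subst hb1
  refine ha (Polynomial.C_eq_zero.1 (eq_zero_of_fermat_dvd_X_pow_mul hij (a := a) hb hn (q + s)
    q (g := X j ^ q * C a) (r := Polynomial.C a) (by simpa using ht) ?_ ?_))
  · simp [hij.symm, Polynomial.algebraMap_eq, algHom_C]
  · convert h using 1
    simp only [C_1]
    ring

theorem frobenius_nonclassical_conics_n_plus_one_m_plus_one
    (p h q : ℕ) (hp : p.Prime) (hp5 : 5 < p) (hh : 0 < h) (hq : q = p ^ h)
    (F : Type*) [Field F] [Fintype F] (hcard : Fintype.card F = q)
    (m n : ℕ) (hm : 2 < m) (hmn : m ≤ n) (hpmn : ¬ p ∣ m * n)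
    (hpn : p ∣ n + 1) (hpm : p ∣ m + 1)
    (a b : F) (ha : a ≠ 0) (hb : b ≠ 0) :
    ((C a * X 0 ^ n + C b * X 1 ^ m - 1 : MvPolynomial (Fin 2) F) ∣
        (C a * X 0 ^ (n + 1) * X 1 ^ q + C b * X 0 ^ q * X 1 ^ (m + 1)
          - X 0 ^ q * X 1 ^ q)) ↔
      (m = n ∧ q = n + 1 ∧ a + b = 1) := by
  have hq1 : 1 < q := hcard ▸ Fintype.one_lt_card
  have h01 : (0 : Fin 2) ≠ 1 := by decide
  constructor
  · intro hdvd
    have hqn : q ≤ n + 1 := le_succ_of_fermat_dvd h01 ha hb (by omega) (by omega) hdvd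
    have hqm : q ≤ m + 1 := by
      refine le_succ_of_fermat_dvd h01.symm (a := b) (b := a) (m := n) hb ha
        (by omega) (by omega) ?_
      convert hdvd using 1 <;> ring
    obtain ⟨s, hs⟩ := Nat.exists_eq_add_of_le hqn
    obtain ⟨t, ht⟩ := Nat.exists_eq_add_of_le hqm
    have hdvd' : (C a * X 0 ^ n + C b * X 1 ^ m - 1 : MvPolynomial (Fin 2) F) ∣
        X 0 ^ q * (X 1 ^ q * (C a * X 0 ^ s + C b * X 1 ^ t - 1)) := by
      convert hdvd using 1
      rw [hs, ht]
      ring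
    have hs0 : s = 0 :=
      eq_zero_of_fermat_dvd_X_pow_mul_X_pow_mul h01 ha hb (by omega) (by omega) hdvd'
    have ht0 : t = 0 := by
      refine eq_zero_of_fermat_dvd_X_pow_mul_X_pow_mul h01.symm (a := b) (b := a) (m := n)
        (n := m) (q := q) (s := t) (t := s) hb ha (by omega) (by omega) ?_
      convert hdvd' using 1 <;> ring
    subst hs0 ht0
    refine ⟨by omega, by omega, ?_⟩
    have hab : Polynomial.C (a + b - 1) = 0 := by
      refine eq_zero_of_fermat_dvd_X_pow_mul h01 (m := m) (n := n) (a := a) hb (by omega) q q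
        (by rw [Polynomial.natDegree_C]; omega) ?_ hdvd'
      simp [Polynomial.algebraMap_eq, algHom_C]
    exact sub_eq_zero.1 (Polynomial.C_eq_zero.1 hab)
  · rintro ⟨rfl, rfl, hab⟩
    have hC : (C a + C b : MvPolynomial (Fin 2) F) = 1 := by rw [← C_add, hab, C_1]
    refine ⟨0, ?_⟩
    linear_combination (X 0 ^ (m + 1) * X 1 ^ (m + 1) : MvPolynomial (Fin 2) F) * hC
end

section
/- Let p > 5 be a prime, h a positive integer, q = p^h, and let F be a finite field with q elements. Let m, n be integers with n ≥ m > 2, p not dividing m·n, p dividing 2n − 1 and p dividing 2m − 1, and let a, b ∈ F be nonzero. Then, in the polynomial ring F[X, Y], the polynomial a·X^n + b·Y^m − 1 divides the polynomial a⁴·X^(4n−2+2q) + b⁴·Y^(4m−2+2q) + 1 − 2a²b²·X^(2n−1+q)·Y^(2m−1+q) − 2a²·X^(2n−1+q) − 2b²·Y^(2m−1+q) if and only if there exists a positive integer r < h with r dividing h such that m = n, 2n·(p^r − 1) = q − 1, (a²)^(p^r) = a², and (b²)^(p^r) = b². -/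
open MvPolynomial

section Auxiliary

open Polynomial

/-- Reduction modulo `X ^ m - w` of a polynomial that is quadratic in `X ^ K`. -/
theorem Polynomial.dvd_and_eval_eq_zero_of_X_pow_sub_C_dvd {R : Type*} [CommRing R] [IsDomain R]
    {m K : ℕ} (hm : 0 < m) {w A B D : R} (hB : B ≠ 0) (hD : D ≠ 0)
    (hw : w ≠ 0)
    (h : (X ^ m - C w : R[X]) ∣ C A * X ^ (2 * K) + C B * X ^ K + C D) :
    m ∣ K ∧ A * (w ^ (K / m)) ^ 2 + B * w ^ (K / m) + D = 0 := by
  have key (k : ℕ) : (X ^ m - C w : R[X]) ∣ X ^ k - C (w ^ (k / m)) * X ^ (k % m) := by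
    have h1 : (X ^ k : R[X]) = (X ^ m) ^ (k / m) * X ^ (k % m) := by
      rw [← pow_mul, ← pow_add, Nat.div_add_mod]
    rw [h1, C_pow, ← sub_mul]
    exact (sub_dvd_pow_sub_pow _ _ _).mul_right _
  set s := K % m with hs
  set t := 2 * K % m with ht
  have hsm : s < m := Nat.mod_lt _ hm
  have htm : t < m := Nat.mod_lt _ hm
  set E : R[X] := C (A * w ^ (2 * K / m)) * X ^ t + C (B * w ^ (K / m)) * X ^ s + C D with hE
  have hdvd : (X ^ m - C w : R[X]) ∣ E := by
    have h2 := (h.sub ((key (2 * K)).mul_left (C A))).sub ((key K).mul_left (C B))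
    convert h2 using 1
    simp only [hE, C_mul]
    ring
  have hE0 : E = 0 := by
    refine eq_zero_of_dvd_of_degree_lt hdvd ?_
    rw [degree_X_pow_sub_C hm]
    have hlt {k : ℕ} (hk : k < m) (r : R) : (C r * X ^ k).degree < (m : WithBot ℕ) :=
      (degree_C_mul_X_pow_le k r).trans_lt (by exact_mod_cast hk)
    have h0 := hlt hm D
    rw [pow_zero, mul_one] at h0
    exact (degree_add_le _ _).trans_lt
      (max_lt ((degree_add_le _ _).trans_lt (max_lt (hlt htm _) (hlt hsm _))) h0)
  have hcoeff (k : ℕ) : (if k = t then A * w ^ (2 * K / m) else 0) +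
      (if k = s then B * w ^ (K / m) else 0) + (if k = 0 then D else 0) = 0 := by
    have := congrArg (fun P : R[X] => P.coeff k) hE0
    simpa only [hE, coeff_add, coeff_C_mul_X_pow, coeff_C, coeff_zero] using this
  have hBw : B * w ^ (K / m) ≠ 0 := mul_ne_zero hB (pow_ne_zero _ hw)
  have hs0 : s = 0 := by
    by_contra hs0
    have h0 := hcoeff 0
    have h1 := hcoeff s
    by_cases ht0 : t = 0
    · simp [ht0, hs0, hB, hw] at h1
    · simp [Ne.symm ht0, Ne.symm hs0, hD] at h0
  have hmK : m ∣ K := Nat.dvd_of_mod_eq_zero hs0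
  have ht0 : t = 0 := Nat.mod_eq_zero_of_dvd (hmK.mul_left 2)
  refine ⟨hmK, ?_⟩
  have h0 := hcoeff 0
  simp only [hs0, ht0, if_true] at h0
  rw [← pow_mul, mul_comm (K / m), ← Nat.mul_div_assoc _ hmK]
  exact h0

theorem Polynomial.eq_of_X_pow_mul_eq_X_pow_mul {F : Type*} [Field F] {i j : ℕ} {A B : F[X]}
    (hA : A.eval 0 ≠ 0) (hB : B.eval 0 ≠ 0) (h : X ^ i * A = X ^ j * B) : i = j ∧ A = B := by
  have aux {i j : ℕ} {A B : F[X]} (hB : B.eval 0 ≠ 0) (h : X ^ i * A = X ^ j * B) : i ≤ j := by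
    by_contra! hlt
    obtain ⟨k, rfl⟩ := Nat.exists_eq_add_of_lt hlt
    have h' : X ^ (k + 1) * A = B := by
      apply mul_left_cancel₀ (pow_ne_zero j (X_ne_zero (R := F)))
      rw [← h, ← mul_assoc, ← pow_add, add_assoc]
    apply hB
    rw [← h']
    simp
  obtain rfl := le_antisymm (aux hB h) (aux hA h.symm)
  exact ⟨rfl, mul_left_cancel₀ (pow_ne_zero i X_ne_zero) h⟩

theorem Polynomial.natDegree_C_add_C_mul_X_pow {F : Type*} [Field F] (a : F) {c : F} (hc : c ≠ 0)
    {N : ℕ} : (C a + C c * X ^ N : F[X]).natDegree = N := by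
  rw [natDegree_C_add, natDegree_C_mul_X_pow _ _ hc]

/-- If a power of `1 + a X ^ n` is the square of `1 + c X ^ N` in odd characteristic `p`, with
`p ∤ n`, then the exponent is `2 p ^ r`. -/
theorem Polynomial.exists_eq_of_one_add_C_mul_X_pow_pow_eq {F : Type*} [Field F] {p : ℕ}
    [Fact p.Prime] [CharP F p] (hp2 : p ≠ 2) {a c : F} (ha : a ≠ 0) (hc : c ≠ 0) {n N Q : ℕ}
    (hn : ¬ p ∣ n) (hN : 0 < N)
    (h : (1 + C a * X ^ n : F[X]) ^ Q = (1 + C c * X ^ N) ^ 2) :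
    ∃ r, Q = 2 * p ^ r ∧ N = p ^ r * n ∧ c = a ^ p ^ r := by
  have hp := Fact.out (p := p.Prime)
  have hdeg : Q * n = 2 * N := by
    have := congrArg natDegree h
    rwa [natDegree_pow, natDegree_pow, ← C_1, natDegree_C_add_C_mul_X_pow _ ha,
      natDegree_C_add_C_mul_X_pow _ hc] at this
  have hQ : Q ≠ 0 := by
    rintro rfl
    omega
  obtain ⟨r, Q', hQ', rfl⟩ := Nat.exists_eq_pow_mul_and_not_dvd hQ p hp.ne_one
  have hrN : p ^ r ∣ N := by
    refine ((Nat.coprime_primes hp Nat.prime_two).2 hp2).pow_left r |>.dvd_of_dvd_mul_left ?_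
    exact ⟨Q' * n, by rw [← hdeg]; ring⟩
  obtain ⟨N', rfl⟩ := hrN
  have hpr : 0 < p ^ r := pow_pos hp.pos r
  have hdeg' : Q' * n = 2 * N' := Nat.eq_of_mul_eq_mul_left hpr (by rw [← mul_assoc, hdeg]; ring)
  have h' : (1 + C (a ^ p ^ r) * X ^ n : F[X]) ^ Q' = (1 + C c * X ^ N') ^ 2 := by
    apply expand_injective hpr
    rw [pow_mul, add_pow_char_pow] at h
    simp only [map_pow, map_add, map_mul, map_one, expand_C, expand_X]
    rw [mul_pow, one_pow] at h
    rw [← pow_mul, ← pow_mul, ← h, ← pow_mul, mul_comm n]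
  have hnQ : ((n * Q' : ℕ) : F) ≠ 0 := by
    rw [Ne, CharP.cast_eq_zero_iff F p, hp.dvd_mul]
    tauto
  have hn0 : 0 < n := Nat.pos_of_ne_zero (by rintro rfl; simp at hn)
  have hN0 : 0 < N' := Nat.pos_of_mul_pos_left hN
  have hder : X ^ (n - 1) * (C (a ^ p ^ r) * (1 + C (a ^ p ^ r) * X ^ n : F[X]) ^ (Q' - 1)) =
      X ^ (N' - 1) * (C c * (1 + C c * X ^ N')) := by
    have hd := congrArg derivative h'
    simp only [derivative_pow, derivative_add, derivative_one, derivative_mul, derivative_C,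
      derivative_X, zero_mul, zero_add, mul_one] at hd
    have hcast : (2 * N' : F[X]) = ((n * Q' : ℕ) : F[X]) := by
      rw [mul_comm n, hdeg']
      push_cast
      ring
    apply mul_left_cancel₀ (a := C ((n * Q' : ℕ) : F)) (C_ne_zero.2 hnQ)
    have hl : (C ((n * Q' : ℕ) : F) : F[X]) = ((n * Q' : ℕ) : F[X]) := by simp
    conv_rhs => rw [hl, ← hcast]
    rw [hl]
    push_cast at hd ⊢
    simp only [map_natCast, map_ofNat, pow_one] at hd
    linear_combination hd
  obtain ⟨hnN, hAB⟩ := eq_of_X_pow_mul_eq_X_pow_mul (by simp [hn0.ne', ha]) (by simp [hN0.ne', hc])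
    hder
  obtain rfl : n = N' := by omega
  obtain rfl : Q' = 2 := Nat.eq_of_mul_eq_mul_right hn0 hdeg'
  refine ⟨r, by ring, rfl, ?_⟩
  simpa [hn0.ne'] using (congrArg (eval 0) hAB).symm

end Auxiliary

theorem Nat.dvd_of_pow_sub_one_dvd_pow_sub_one {p r h : ℕ} (hp : 1 < p)
    (hd : p ^ r - 1 ∣ p ^ h - 1) : r ∣ h := by
  have h1 := Nat.pow_sub_one_gcd_pow_sub_one p r h
  rw [Nat.gcd_eq_left hd] at h1
  have h2 : p ^ r = p ^ r.gcd h := by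
    have := Nat.one_le_pow r p (by omega)
    have := Nat.one_le_pow (r.gcd h) p (by omega)
    omega
  rw [Nat.pow_right_injective hp h2]
  exact Nat.gcd_dvd_right r h

theorem frobenius_nonclassical_conics_2n1_2m1
    (p h q : ℕ) (hp : p.Prime) (hp5 : 5 < p) (hh : 0 < h) (hq : q = p ^ h)
    (F : Type*) [Field F] [Fintype F] (hcard : Fintype.card F = q)
    (m n : ℕ) (hm : 2 < m) (hmn : m ≤ n) (hpmn : ¬ p ∣ m * n)
    (hpn : p ∣ 2 * n - 1) (hpm : p ∣ 2 * m - 1)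
    (a b : F) (ha : a ≠ 0) (hb : b ≠ 0) :
    ((C a * X 0 ^ n + C b * X 1 ^ m - 1 : MvPolynomial (Fin 2) F) ∣
        (C (a ^ 4) * X 0 ^ (4 * n - 2 + 2 * q) + C (b ^ 4) * X 1 ^ (4 * m - 2 + 2 * q)
          + 1 - C (2 * a ^ 2 * b ^ 2) * X 0 ^ (2 * n - 1 + q) * X 1 ^ (2 * m - 1 + q)
          - C (2 * a ^ 2) * X 0 ^ (2 * n - 1 + q)
          - C (2 * b ^ 2) * X 1 ^ (2 * m - 1 + q))) ↔
      ∃ r : ℕ, 0 < r ∧ r < h ∧ r ∣ h ∧ m = n ∧ 2 * n * (p ^ r - 1) = q - 1 ∧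
        (a ^ 2) ^ p ^ r = a ^ 2 ∧ (b ^ 2) ^ p ^ r = b ^ 2 := by
  have : Fact p.Prime := ⟨hp⟩
  have : CharP F p := by
    subst hq
    exact charP_of_card_eq_prime_pow hcard
  have hpn' : ¬ p ∣ n := fun hd => hpmn (hd.mul_left m)
  have hq0 : 0 < q := hq ▸ pow_pos hp.pos h
  have h2 : (2 : F) ≠ 0 := by
    have : ¬ p ∣ 2 := fun hd => by have := Nat.le_of_dvd two_pos hd; omega
    rw [← CharP.cast_eq_zero_iff F p] at this
    exact_mod_cast this
  constructor
  · intro hdvd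
    obtain ⟨w, hw⟩ : ∃ w : Polynomial F,
        w = .C b⁻¹ * (1 + .C (-a) * .X ^ n) := ⟨_, rfl⟩
    obtain ⟨N, hN⟩ : ∃ N, 2 * n - 1 + q = 2 * N := by
      have : Odd q := hq ▸ (hp.odd_of_ne_two (by omega)).pow
      obtain ⟨k, hk⟩ := this
      exact ⟨n + k, by omega⟩
    have hN0 : N ≠ 0 := by omega
    obtain ⟨hmK, hroot⟩ := Polynomial.dvd_and_eval_eq_zero_of_X_pow_sub_C_dvd (m := m)
      (K := 2 * m - 1 + q) (w := w) (A := .C (b ^ 4))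
      (B := -(.C (2 * a ^ 2 * b ^ 2) * .X ^ (2 * N) + .C (2 * b ^ 2)))
      (D := (1 - .C (a ^ 2) * .X ^ (2 * N)) ^ 2) (by omega)
      (fun h0 => by simpa [hN0, h2, hb] using congrArg (Polynomial.eval 0) h0)
      (fun h0 => by simpa [hN0] using congrArg (Polynomial.eval 0) h0)
      (fun h0 => by
        rw [hw] at h0
        simpa [hb, show n ≠ 0 by omega] using congrArg (Polynomial.eval 0) h0)
      (by
        have hmap := map_dvd (eval₂Hom (Polynomial.C.comp Polynomial.C)
          ![Polynomial.C Polynomial.X, Polynomial.X] :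
            MvPolynomial (Fin 2) F →+* Polynomial (Polynomial F)) hdvd
        refine (Dvd.intro_left (.C (.C b)) ?_).trans (hmap.trans (dvd_of_eq ?_))
        · have hbb : (Polynomial.C b * Polynomial.C b⁻¹ : Polynomial F) = 1 := by
            rw [← Polynomial.C_mul, mul_inv_cancel₀ hb, Polynomial.C_1]
          have hbw : (Polynomial.C b * w : Polynomial F) = 1 - .C a * .X ^ n := by
            rw [hw, ← mul_assoc, hbb, Polynomial.C_neg]
            ring
          rw [mul_sub, ← Polynomial.C_mul, hbw]
          simp
          ring
        · rw [show 4 * n - 2 + 2 * q = 2 * (2 * N) by omega,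
            show 4 * m - 2 + 2 * q = 2 * (2 * m - 1 + q) by omega, hN]
          simp [map_ofNat]
          ring)
    obtain ⟨Q, hQ⟩ := hmK
    rw [hQ, Nat.mul_div_cancel_left _ (by omega : 0 < m)] at hroot
    have hsq : (Polynomial.C (b ^ 2) * w ^ Q - 1 - .C (a ^ 2) * .X ^ (2 * N)) ^ 2 =
        (Polynomial.C (2 * a) * .X ^ N) ^ 2 := by
      simp only [map_mul, map_pow, map_ofNat] at hroot ⊢
      linear_combination hroot
    obtain ⟨c, hca, hc⟩ : ∃ c, c ^ 2 = a ^ 2 ∧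
        Polynomial.C (b ^ 2) * w ^ Q = (1 + Polynomial.C c * .X ^ N) ^ 2 := by
      rcases sq_eq_sq_iff_eq_or_eq_neg.1 hsq with h1 | h1
      · refine ⟨a, rfl, ?_⟩
        simp only [map_mul, map_pow, map_ofNat] at h1 ⊢
        linear_combination h1
      · refine ⟨-a, by ring, ?_⟩
        simp only [map_mul, map_pow, map_ofNat, map_neg] at h1 ⊢
        linear_combination h1
    have hc0 : c ≠ 0 := by
      rintro rfl
      exact ha (by simpa using hca.symm)
    have hbQ : b ^ 2 * b⁻¹ ^ Q = 1 := by
      simpa [hw, hN0, show n ≠ 0 by omega] using congrArg (Polynomial.eval 0) hc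
    rw [hw, mul_pow, ← mul_assoc, ← Polynomial.C_pow, ← Polynomial.C_mul, hbQ, Polynomial.C_1,
      one_mul] at hc
    obtain ⟨r, rfl, rfl, hcr⟩ := Polynomial.exists_eq_of_one_add_C_mul_X_pow_pow_eq (p := p)
      (by omega) (neg_ne_zero.2 ha) hc0 hpn' (by omega) hc
    have hr : 0 < r := by
      rw [Nat.pos_iff_ne_zero]
      rintro rfl
      rw [pow_zero, one_mul] at hN
      have : p ∣ q := hq ▸ dvd_pow_self p hh.ne'
      have h3 := hp.one_lt.trans_le (Nat.le_of_dvd hq0 this)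
      omega
    have hpr : 1 < p ^ r := Nat.one_lt_pow hr.ne' hp.one_lt
    obtain ⟨k, hk⟩ := Nat.exists_eq_add_of_lt hpr
    rw [hk] at hN hQ
    have hmn' : m = n := by
      obtain ⟨d, rfl⟩ := Nat.exists_eq_add_of_le hmn
      have : d * (k + 1) = 0 := by
        zify [show 1 ≤ 2 * m by omega, show 1 ≤ 2 * (m + d) by omega] at hN hQ ⊢
        linarith
      simp at this
      omega
    have hcount : 2 * n * (p ^ r - 1) = q - 1 := by
      rw [hk, show 1 + k + 1 - 1 = k + 1 by omega]
      zify [show 1 ≤ 2 * n by omega, show 1 ≤ q by omega] at hN ⊢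
      linarith
    refine ⟨r, hr, ?_, ?_, hmn', hcount, ?_, ?_⟩
    · rw [← Nat.pow_lt_pow_iff_right hp.one_lt, ← hq]
      have : 1 * (p ^ r - 1) < 2 * n * (p ^ r - 1) :=
        Nat.mul_lt_mul_of_pos_right (by omega) (by omega)
      omega
    · exact Nat.dvd_of_pow_sub_one_dvd_pow_sub_one hp.one_lt (hq ▸ Dvd.intro_left _ hcount)
    · rwa [hcr, ← pow_mul, mul_comm, pow_mul, neg_sq] at hca
    · rw [inv_pow, mul_inv_eq_one₀ (pow_ne_zero _ hb)] at hbQ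
      rw [← pow_mul, ← hbQ]
  · rintro ⟨r, hr, -, -, rfl, hcount, har, hbr⟩
    have hexp : 2 * m - 1 + q = 2 * m * p ^ r := by
      obtain ⟨k, hk⟩ := Nat.exists_eq_add_of_lt (Nat.one_lt_pow hr.ne' hp.one_lt)
      rw [hk, show 1 + k + 1 - 1 = k + 1 by omega] at hcount
      rw [hk]
      zify [show 1 ≤ 2 * m by omega, show 1 ≤ q by omega] at hcount ⊢
      linarith
    have hterm (e : F) (i : Fin 2) (he : (e ^ 2) ^ p ^ r = e ^ 2) :
        (C (e ^ 2) * X i ^ (2 * m - 1 + q) : MvPolynomial (Fin 2) F) =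
          ((C e * X i ^ m) ^ p ^ r) ^ 2 := by
      rw [hexp, ← he]
      simp only [map_pow]
      ring
    have hA := hterm a 0 har
    have hB := hterm b 1 hbr
    have hpow : (C a * X 0 ^ m + C b * X 1 ^ m - 1 : MvPolynomial (Fin 2) F) ∣
        (C a * X 0 ^ m) ^ p ^ r + (C b * X 1 ^ m) ^ p ^ r - 1 := by
      have := dvd_pow_self (C a * X 0 ^ m + C b * X 1 ^ m - 1 : MvPolynomial (Fin 2) F)
        (pow_pos hp.pos r).ne'
      rwa [sub_pow_char_pow, add_pow_char_pow, one_pow] at this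
    generalize (C a * X 0 ^ m : MvPolynomial (Fin 2) F) ^ p ^ r = A at *
    generalize (C b * X 1 ^ m : MvPolynomial (Fin 2) F) ^ p ^ r = B at *
    refine (hpow.mul_right ((A + B + 1) * (A - B - 1) * (A - B + 1))).trans (dvd_of_eq ?_)
    rw [show 4 * m - 2 + 2 * q = (2 * m - 1 + q) * 2 by omega]
    simp only [map_mul, map_pow, map_ofNat, pow_mul] at hA hB ⊢
    generalize (X 0 : MvPolynomial (Fin 2) F) ^ (2 * m - 1 + q) = U at *
    generalize (X 1 : MvPolynomial (Fin 2) F) ^ (2 * m - 1 + q) = V at *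
    linear_combination (-(A ^ 2 + C a ^ 2 * U) + 2 * B ^ 2 + 2) * hA +
      (-(B ^ 2 + C b ^ 2 * V) + 2 * (C a ^ 2 * U) + 2) * hB
end

section
/- Let p > 5 be a prime, h a positive integer, q = p^h, and let F be a finite field with q elements. Let m, n be integers with n ≥ m > 2, p not dividing m·n, p dividing n − 2 and p dividing m − 1, and let a, b ∈ F be nonzero. Then, in the polynomial ring F[X, Y], the polynomial a·X^n + b·Y^m − 1 divides the polynomial a·X^(n−2+2q) + b·Y^(m−1+q) − 1 if and only if there exists a positive integer r < h with r dividing h such that n = 2m, m·(p^r − 1) = q − 1, a^(p^r) = a, and b^(p^r) = b. -/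
open MvPolynomial

lemma pow_sub_one_dvd_pow_sub_one_imp_dvd {p k h : ℕ} (hp : 1 < p)
    (hdvd : p ^ k - 1 ∣ p ^ h - 1) : k ∣ h := by
  have h1 := Nat.pow_sub_one_gcd_pow_sub_one p k h
  rw [Nat.gcd_eq_left hdvd] at h1
  have h2 := Nat.one_le_pow k p (by omega)
  have h3 := Nat.one_le_pow (k.gcd h) p (by omega)
  have h4 : k = k.gcd h := Nat.pow_right_injective hp (show p ^ k = p ^ k.gcd h by omega)
  rw [h4]
  exact Nat.gcd_dvd_right k h

lemma eq_of_pow_eq_one_iff {K : Type*} [Field K] [IsAlgClosed K] {p : ℕ} [Fact p.Prime]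
    [CharP K p] {m k v : ℕ} (hm : ¬ p ∣ m) (hv : ¬ p ∣ v)
    (H : ∀ z : K, z ^ m = 1 ↔ z ^ (p ^ k * v) = 1) : m = v := by
  have : NeZero (m : K) := ⟨fun h0 => hm ((CharP.cast_eq_zero_iff K p m).1 h0)⟩
  have : NeZero (v : K) := ⟨fun h0 => hv ((CharP.cast_eq_zero_iff K p v).1 h0)⟩
  obtain ⟨ζ, hζ⟩ := HasEnoughRootsOfUnity.exists_primitiveRoot K m
  obtain ⟨ξ, hξ⟩ := HasEnoughRootsOfUnity.exists_primitiveRoot K v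
  have hcop : m.Coprime (p ^ k) :=
    (((Fact.out : p.Prime).coprime_iff_not_dvd.2 hm).pow_left k).symm
  refine Nat.dvd_antisymm ?_ ?_
  · exact hcop.dvd_of_dvd_mul_left (hζ.dvd_of_pow_eq_one _ ((H ζ).1 hζ.pow_eq_one))
  · exact hξ.dvd_of_pow_eq_one _ ((H ξ).2 (by rw [mul_comm, pow_mul, hξ.pow_eq_one, one_pow]))

lemma natDegree_one_sub_C_mul_X_pow_pow {K : Type*} [Field K] {a : K} (ha : a ≠ 0) {n : ℕ}
    (hn : 0 < n) (t : ℕ) : ((1 - Polynomial.C a * Polynomial.X ^ n) ^ t).natDegree = t * n := by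
  rw [Polynomial.natDegree_pow,
    Polynomial.natDegree_sub_eq_right_of_natDegree_lt,
    Polynomial.natDegree_C_mul_X_pow n a ha]
  rw [Polynomial.natDegree_C_mul_X_pow n a ha]
  simpa using hn

/-- Eliminating `y` from the implication between the two curve equations. -/
lemma one_sub_pow_eq_of_forall_curve {K : Type*} [Field K] [IsAlgClosed K] {a b : K} (hb : b ≠ 0)
    {n n' m N q : ℕ} (hm : 0 < m) (hN : N + 1 = m + q) (hbq : b ^ q = b)
    (H : ∀ x y : K, a * x ^ n + b * y ^ m = 1 → a * x ^ n' + b * y ^ N = 1) (x : K) :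
    (1 - a * x ^ n) ^ N = (1 - a * x ^ n') ^ m := by
  obtain ⟨y, hy⟩ := IsAlgClosed.exists_pow_nat_eq (b⁻¹ * (1 - a * x ^ n)) hm
  have h1 : b * y ^ m = 1 - a * x ^ n := by rw [hy]; field_simp
  have h2 : b * y ^ N = 1 - a * x ^ n' := by linear_combination H x y (by rw [h1]; ring)
  have hbN : b ^ N = b ^ m := by
    apply mul_right_cancel₀ hb
    rw [← pow_succ, hN, pow_add, hbq]
  rw [← h1, ← h2, mul_pow, mul_pow, hbN, ← pow_mul, ← pow_mul, mul_comm m N]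

theorem frobenius_nonclassical_conics_n2_m1
    (p h q : ℕ) (hp : p.Prime) (hp5 : 5 < p) (hh : 0 < h) (hq : q = p ^ h)
    (F : Type*) [Field F] [Fintype F] (hcard : Fintype.card F = q)
    (m n : ℕ) (hm : 2 < m) (hmn : m ≤ n) (hpmn : ¬ p ∣ m * n)
    (hpn : p ∣ n - 2) (hpm : p ∣ m - 1)
    (a b : F) (ha : a ≠ 0) (hb : b ≠ 0) :
    ((C a * X 0 ^ n + C b * X 1 ^ m - 1 : MvPolynomial (Fin 2) F) ∣
        (C a * X 0 ^ (n - 2 + 2 * q) + C b * X 1 ^ (m - 1 + q) - 1)) ↔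
      ∃ r : ℕ, 0 < r ∧ r < h ∧ r ∣ h ∧ n = 2 * m ∧ m * (p ^ r - 1) = q - 1 ∧
        a ^ p ^ r = a ∧ b ^ p ^ r = b := by
  have : Fact p.Prime := ⟨hp⟩
  have : CharP F p := charP_of_card_eq_prime_pow (hcard.trans hq)
  have hq1 : 1 < q := hcard ▸ Fintype.one_lt_card
  constructor
  · rintro ⟨w, hw⟩
    let K := AlgebraicClosure F
    let φ : F →+* K := algebraMap F K
    have : CharP K p := charP_of_injective_algebraMap φ.injective p
    have ha' : φ a ≠ 0 := (map_ne_zero φ).2 ha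
    have hb' : φ b ≠ 0 := (map_ne_zero φ).2 hb
    have H (x y : K) (hxy : φ a * x ^ n + φ b * y ^ m = 1) :
        φ a * x ^ (n - 2 + 2 * q) + φ b * y ^ (m - 1 + q) = 1 := by
      have := congrArg (eval₂ φ ![x, y]) hw
      simp only [eval₂_mul, eval₂_sub, eval₂_add, eval₂_C, eval₂_pow, eval₂_X, eval₂_one,
        Matrix.cons_val_zero, Matrix.cons_val_one, hxy, sub_self, zero_mul] at this
      exact sub_eq_zero.1 this
    have hbq : φ b ^ q = φ b := by rw [← map_pow, ← hcard, FiniteField.pow_card]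
    have E := one_sub_pow_eq_of_forall_curve hb' (by omega) (by omega) hbq H
    have hn : n = 2 * m := by
      have hpoly : (1 - Polynomial.C (φ a) * Polynomial.X ^ n) ^ (m - 1 + q) =
          (1 - Polynomial.C (φ a) * Polynomial.X ^ (n - 2 + 2 * q)) ^ m :=
        Polynomial.funext fun x => by simpa using E x
      have hdeg := congrArg Polynomial.natDegree hpoly
      rw [natDegree_one_sub_C_mul_X_pow_pow ha' (by omega),
        natDegree_one_sub_C_mul_X_pow_pow ha' (by omega)] at hdeg
      obtain ⟨m, rfl⟩ := Nat.exists_eq_add_of_lt hm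
      obtain ⟨n, rfl⟩ := Nat.exists_eq_add_of_le (show 2 ≤ n by omega)
      obtain ⟨q, rfl⟩ := Nat.exists_eq_add_of_lt hq1
      simp only [Nat.add_sub_cancel_left, show 2 + m + 1 - 1 = 2 + m by omega] at hdeg ⊢
      apply Nat.eq_of_mul_eq_mul_left (show 0 < q + 1 by omega)
      linarith
    have hN0 : m - 1 + q ≠ 0 := by omega
    obtain ⟨k, v, hv, hN⟩ := Nat.exists_eq_pow_mul_and_not_dvd hN0 p hp.ne_one
    have hroot (x : K) : φ a * (x ^ 2) ^ m = 1 ↔ φ a * (x ^ 2) ^ (m - 1 + q) = 1 := by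
      have hx := E x
      rw [show n - 2 + 2 * q = 2 * (m - 1 + q) by omega, hn, pow_mul, pow_mul] at hx
      rw [eq_comm, ← sub_eq_zero, ← pow_eq_zero_iff hN0, hx, pow_eq_zero_iff (by omega),
        sub_eq_zero, eq_comm]
    have hroot' (z : K) : φ a * z ^ m = 1 ↔ φ a * z ^ (m - 1 + q) = 1 := by
      obtain ⟨x, rfl⟩ := IsAlgClosed.exists_pow_nat_eq z (show 0 < 2 by omega)
      exact hroot x
    have hpm' : ¬ p ∣ m := fun hd => hpmn (hd.mul_right n)
    obtain ⟨z₀, hz₀⟩ := IsAlgClosed.exists_pow_nat_eq (φ a)⁻¹ (show 0 < m by omega)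
    have hz₁ : φ a * z₀ ^ m = 1 := by rw [hz₀, mul_inv_cancel₀ ha']
    have hz₂ := (hroot' z₀).1 hz₁
    have hmv : m = v := eq_of_pow_eq_one_iff (K := K) (k := k) hpm' hv fun z => by
      have := hroot' (z₀ * z)
      rwa [mul_pow, mul_pow, ← mul_assoc, ← mul_assoc, hz₁, hz₂, one_mul, one_mul, hN] at this
    subst hmv
    have hpk := Nat.one_le_pow k p hp.pos
    have hmk : m * (p ^ k - 1) = q - 1 := by
      rw [Nat.mul_sub, mul_comm, ← hN]; omega
    have hfix (c : F) (z : K) (h1 : φ c * z ^ m = 1) (h2 : φ c * z ^ (m - 1 + q) = 1) :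
        c ^ p ^ k = c := by
      apply φ.injective
      have hz : (z ^ m) ^ p ^ k ≠ 0 := pow_ne_zero _ (right_ne_zero_of_mul_eq_one h1)
      apply mul_right_cancel₀ hz
      rw [map_pow, ← mul_pow, h1, one_pow, ← pow_mul, mul_comm m, ← hN, h2]
    refine ⟨k, ?_, ?_, ?_, hn, hmk, hfix a z₀ hz₁ hz₂, ?_⟩
    · rw [Nat.pos_iff_ne_zero]
      rintro rfl
      simp at hmk
      omega
    · rw [← Nat.pow_lt_pow_iff_right hp.one_lt, ← hq]
      by_contra! hle
      have : 2 * (p ^ k - 1) ≤ m * (p ^ k - 1) := Nat.mul_le_mul_right _ (by omega)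
      omega
    · exact pow_sub_one_dvd_pow_sub_one_imp_dvd hp.one_lt
        (hq ▸ hmk ▸ Dvd.intro_left m rfl)
    · obtain ⟨y, hy⟩ := IsAlgClosed.exists_pow_nat_eq (φ b)⁻¹ (show 0 < m by omega)
      have hy₁ : φ b * y ^ m = 1 := by rw [hy, mul_inv_cancel₀ hb']
      refine hfix b y hy₁ ?_
      have := H 0 y
      rw [zero_pow (by omega), zero_pow (by omega), mul_zero, zero_add, zero_add] at this
      exact this hy₁
  · rintro ⟨r, -, -, -, hn, hmr, har, hbr⟩
    have hpr := Nat.one_le_pow r p hp.pos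
    have hle : m ≤ m * p ^ r := Nat.le_mul_of_pos_right m hpr
    have hN : m - 1 + q = m * p ^ r := by
      rw [Nat.mul_sub] at hmr; omega
    have hN' : n - 2 + 2 * q = n * p ^ r := by
      rw [hn, mul_assoc, ← hN]; omega
    have hpow : (C a * X 0 ^ n + C b * X 1 ^ m - 1 : MvPolynomial (Fin 2) F) ^ p ^ r =
        C a * X 0 ^ (n - 2 + 2 * q) + C b * X 1 ^ (m - 1 + q) - 1 := by
      rw [sub_pow_char_pow, add_pow_char_pow, mul_pow, mul_pow, ← C_pow, ← C_pow, har, hbr,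
        ← pow_mul, ← pow_mul, one_pow, hN, hN']
    rw [← hpow]
    exact dvd_pow_self _ (by omega)
end

section
/- Let p > 5 be a prime, h a positive integer, q = p^h, and let F be a finite field with q elements. Let m, n be integers with n ≥ m > 2, p not dividing m·n, p dividing n − 1 and p dividing 2m − 1, and let a, b ∈ F be nonzero. Then, in the polynomial ring F[X, Y], the polynomial a·X^n + b·Y^m − 1 divides the polynomial b²·Y^(2m−1+q) − a²·X^(2n−2+2q) + 2a·X^(n−1+q) − 1 if and only if there exists a positive integer r < h with r dividing h such that n = 2m, n·(p^r − 1) = q − 1, a^(p^r) = a, and either b^(p^r) = b or b^(p^r) = −b. -/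
/-- Over a domain, if `C b * Y ^ m - C u` divides `C v * Y ^ e - C w` with `b` a unit and `u`, `v`
nonzero, then `m ∣ e`, and substituting `Y ^ m = u / b` gives an identity in the base ring. -/
theorem Polynomial.exists_eq_of_binomial_dvd_binomial {A : Type*} [CommRing A] [IsDomain A]
    {b u v w : A} {m e : ℕ} (hm : 0 < m) (hb : b ≠ 0) (hu : u ≠ 0) (hv : v ≠ 0)
    (H : (Polynomial.C b * Polynomial.X ^ m - Polynomial.C u : Polynomial A) ∣
      Polynomial.C v * Polynomial.X ^ e - Polynomial.C w) :
    ∃ k, e = m * k ∧ v * u ^ k = b ^ k * w := by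
  set f : Polynomial A := C b * X ^ m - C u with hf
  have he : m * (e / m) + e % m = e := Nat.div_add_mod e m
  have hs : e % m < m := Nat.mod_lt e hm
  generalize e / m = k at he
  generalize e % m = s at he hs
  subst he
  have hfdeg : f.natDegree = m := by
    rw [hf, natDegree_sub_C, natDegree_C_mul_X_pow m b hb]
  have h1 : f ∣ (C b * X ^ m) ^ k - C u ^ k := sub_dvd_pow_sub_pow _ _ k
  have h2 : f ∣ C (v * u ^ k) * X ^ s - C (b ^ k * w) := by
    have h3 := dvd_sub (H.mul_left (C b ^ k)) (h1.mul_left (C v * X ^ s))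
    convert h3 using 1
    simp only [map_mul, map_pow]
    ring
  have h0 : C (v * u ^ k) * X ^ s - C (b ^ k * w) = 0 := by
    by_contra hne
    have h4 := natDegree_le_of_dvd h2 hne
    rw [hfdeg, natDegree_sub_C] at h4
    have h5 := natDegree_C_mul_X_pow_le (v * u ^ k) s
    omega
  have hs0 : s = 0 := by
    by_contra hs0
    have h6 := congrArg (fun P => coeff P s) h0
    simp only [coeff_sub, coeff_C_mul, coeff_X_pow_self, mul_one, coeff_C, if_neg hs0, sub_zero,
      coeff_zero] at h6
    exact mul_ne_zero hv (pow_ne_zero k hu) h6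
  subst hs0
  refine ⟨k, by simp, ?_⟩
  rw [pow_zero, mul_one, sub_eq_zero] at h0
  exact C_injective h0

open Polynomial in
/-- If `(1 - a T²) ^ j = (1 - c T ^ j)²` with `j` and `2` invertible, then `j = 2` and `a = c`. -/
theorem eq_two_of_one_sub_pow_eq_sq {F : Type*} [Field F] {a c : F} {j : ℕ}
    (ha : a ≠ 0) (hc : c ≠ 0) (h2 : (2 : F) ≠ 0) (hj : (j : F) ≠ 0)
    (H : (1 - C a * X ^ 2 : F[X]) ^ j = (1 - C c * X ^ j) ^ 2) :
    j = 2 ∧ a = c := by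
  obtain _ | i := j
  · simp at hj
  have hd := congrArg derivative H
  simp only [derivative_pow, derivative_sub, derivative_mul, derivative_C, derivative_X,
    derivative_one, zero_mul, zero_add, zero_sub, mul_one, Nat.add_sub_cancel] at hd
  have hK : (C ((2 : F) * ((i + 1 : ℕ) : F)) : F[X]) ≠ 0 := by
    rw [Ne, C_eq_zero]
    exact mul_ne_zero h2 hj
  have hd' : C a * X * (1 - C a * X ^ 2 : F[X]) ^ i = C c * X ^ i * (1 - C c * X ^ (i + 1)) := by
    apply mul_left_cancel₀ hK
    simp only [map_mul, map_natCast, map_ofNat] at hd ⊢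
    push_cast at hd ⊢
    linear_combination -hd
  obtain _ | _ | i := i
  · have := congrArg (eval 0) hd'
    simp at this
    exact absurd this.symm hc
  · have h3 : C a * (1 - C a * X ^ 2 : F[X]) = C c * (1 - C c * X ^ 2) := by
      apply mul_left_cancel₀ (X_ne_zero (R := F))
      linear_combination hd'
    have := congrArg (eval 0) h3
    simp at this
    exact ⟨rfl, this⟩
  · have h3 : C a * (1 - C a * X ^ 2 : F[X]) ^ (i + 2) =
        C c * X ^ (i + 1) * (1 - C c * X ^ (i + 3)) := by
      apply mul_left_cancel₀ (X_ne_zero (R := F))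
      linear_combination hd'
    have := congrArg (eval 0) h3
    simp at this
    exact absurd this ha

open Polynomial in
/-- Over a perfect field of odd characteristic `p`, the identity `(1 - a T²) ^ k = (1 - a T ^ k)²`
forces `k = 2 p ^ r` and `a ^ (p ^ r) = a`. -/
theorem exists_eq_two_mul_pow_of_one_sub_pow_eq_sq {F : Type*} [Field F] (p : ℕ) [Fact p.Prime]
    [CharP F p] [PerfectRing F p] {a : F} {k : ℕ} (ha : a ≠ 0) (h2 : (2 : F) ≠ 0) (hk : k ≠ 0)
    (H : (1 - C a * X ^ 2 : F[X]) ^ k = (1 - C a * X ^ k) ^ 2) :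
    ∃ r, k = 2 * p ^ r ∧ a ^ p ^ r = a := by
  have hp : p.Prime := Fact.out
  obtain ⟨r, j, hj, rfl⟩ := Nat.exists_eq_pow_mul_and_not_dvd hk p hp.ne_one
  obtain ⟨c, rfl⟩ : ∃ c : F, c ^ p ^ r = a :=
    ⟨(iterateFrobeniusEquiv F p r).symm a, by
      rw [← iterateFrobeniusEquiv_def, RingEquiv.apply_symm_apply]⟩
  have hc : c ≠ 0 := by
    rintro rfl
    simp [hp.ne_zero] at ha
  have key : (1 - C (c ^ p ^ r) * X ^ 2 : F[X]) ^ j = (1 - C c * X ^ j) ^ 2 := by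
    apply iterateFrobenius_inj F[X] p r
    simp only [iterateFrobenius_def]
    rw [← pow_mul, mul_comm j, H, pow_right_comm, sub_pow_char_pow, one_pow,
      mul_pow, ← pow_mul, mul_comm j, C_pow]
  obtain ⟨rfl, h⟩ := eq_two_of_one_sub_pow_eq_sq ha hc h2
    (by rwa [Ne, CharP.cast_eq_zero_iff F p]) key
  exact ⟨r, mul_comm _ _, by rw [h, h]⟩

open MvPolynomial

theorem frobenius_nonclassical_conics_n1_2m1
    (p h q : ℕ) (hp : p.Prime) (hp5 : 5 < p) (hh : 0 < h) (hq : q = p ^ h)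
    (F : Type*) [Field F] [Fintype F] (hcard : Fintype.card F = q)
    (m n : ℕ) (hm : 2 < m) (hmn : m ≤ n) (hpmn : ¬ p ∣ m * n)
    (hpn : p ∣ n - 1) (hpm : p ∣ 2 * m - 1)
    (a b : F) (ha : a ≠ 0) (hb : b ≠ 0) :
    ((C a * X 0 ^ n + C b * X 1 ^ m - 1 : MvPolynomial (Fin 2) F) ∣
        (C (b ^ 2) * X 1 ^ (2 * m - 1 + q) - C (a ^ 2) * X 0 ^ (2 * n - 2 + 2 * q)
          + C (2 * a) * X 0 ^ (n - 1 + q) - 1)) ↔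
      ∃ r : ℕ, 0 < r ∧ r < h ∧ r ∣ h ∧ n = 2 * m ∧ n * (p ^ r - 1) = q - 1 ∧
        a ^ p ^ r = a ∧ (b ^ p ^ r = b ∨ b ^ p ^ r = -b) := by
  have : Fact p.Prime := ⟨hp⟩
  have : CharP F p := charP_of_card_eq_prime_pow (f := h) (by rw [hcard, hq])
  have hqpos : 1 < q := hq ▸ Nat.one_lt_pow hh.ne' hp.one_lt
  have h2 : (2 : F) ≠ 0 := by
    have : ((2 : ℕ) : F) ≠ 0 := by
      rw [Ne, CharP.cast_eq_zero_iff F p]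
      exact fun hd => by have := Nat.le_of_dvd two_pos hd; omega
    exact_mod_cast this
  have hsq : 2 * n - 2 + 2 * q = (n - 1 + q) * 2 := by omega
  constructor
  · intro H
    have H' := map_dvd (aeval (R := F) ![(Polynomial.C Polynomial.X : Polynomial (Polynomial F)),
      Polynomial.X]) H
    have h10 : (1 - Polynomial.C a * Polynomial.X ^ n : Polynomial F) ≠ 0 := by
      intro h0
      have := congrArg (Polynomial.eval 0) h0
      simp [show n ≠ 0 by omega] at this
    have hE := Polynomial.exists_eq_of_binomial_dvd_binomial (A := Polynomial F) (m := m)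
      (e := 2 * m - 1 + q) (b := Polynomial.C b) (u := 1 - Polynomial.C a * Polynomial.X ^ n)
      (v := Polynomial.C (b ^ 2)) (w := (1 - Polynomial.C a * Polynomial.X ^ (n - 1 + q)) ^ 2)
      (by omega) (by simpa using hb) h10 (by simpa using hb) (by
        convert H' using 1
        · simp
          ring
        · rw [hsq]
          simp only [map_sub, map_add, map_mul, map_pow, map_one, map_ofNat, aeval_X, aeval_C,
            Polynomial.algebraMap_apply, Algebra.algebraMap_self, RingHom.id_apply,
            Matrix.cons_val_zero, Matrix.cons_val_one]
          ring)
    obtain ⟨k, hk, hid⟩ := hE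
    have hconst : b ^ 2 = b ^ k := by
      have := congrArg (Polynomial.eval 0) hid
      simpa [show n ≠ 0 by omega, show q ≠ 0 by omega] using this
    have hid' : (1 - Polynomial.C a * Polynomial.X ^ n : Polynomial F) ^ k =
        (1 - Polynomial.C a * Polynomial.X ^ (n - 1 + q)) ^ 2 := by
      rw [← Polynomial.C_pow, ← hconst] at hid
      exact mul_left_cancel₀ (by simpa using hb) hid
    have hdeg : ∀ d : ℕ, 0 < d →
        (1 - Polynomial.C a * Polynomial.X ^ d : Polynomial F).natDegree = d := by
      intro d hd
      rw [Polynomial.natDegree_sub, ← Polynomial.C_1, Polynomial.natDegree_sub_C,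
        Polynomial.natDegree_C_mul_X_pow d a ha]
    have hnk : k * n = 2 * (n - 1 + q) := by
      have := congrArg Polynomial.natDegree hid'
      rwa [Polynomial.natDegree_pow, Polynomial.natDegree_pow, hdeg n (by omega),
        hdeg _ (by omega)] at this
    have hn : n = 2 * m := by
      obtain ⟨t, rfl⟩ : ∃ t, q = t + 1 := ⟨q - 1, by omega⟩
      have e1 : m * k = 2 * m + t := by omega
      have e2 : k * n = 2 * n + 2 * t := by omega
      have e3 : t * n = t * (2 * m) := by
        zify at *
        linear_combination (m : ℤ) * e2 - n * e1
      exact Nat.eq_of_mul_eq_mul_left (by omega) e3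
    subst hn
    have hpk : p ∣ k := by
      have : p ∣ m * k := hk ▸ dvd_add hpm (hq ▸ dvd_pow_self p hh.ne')
      exact (hp.dvd_mul.1 this).resolve_left fun hd => hpmn (hd.mul_right _)
    have hk0 : k ≠ 0 := by
      rintro rfl
      omega
    have hexp : (1 - Polynomial.C a * Polynomial.X ^ 2 : Polynomial F) ^ k =
        (1 - Polynomial.C a * Polynomial.X ^ k) ^ 2 := by
      apply Polynomial.expand_injective (R := F) (n := m) (by omega)
      simp only [map_pow, map_sub, map_mul, map_one, Polynomial.expand_C, Polynomial.expand_X]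
      rw [← pow_mul, ← pow_mul, mul_comm m 2, hid', ← hk]
    obtain ⟨r, rfl, har⟩ := exists_eq_two_mul_pow_of_one_sub_pow_eq_sq p ha h2 hk0 hexp
    have hr : 0 < r := by
      rcases Nat.eq_zero_or_pos r with rfl | hr
      · have := Nat.le_of_dvd (by norm_num) hpk
        rw [pow_zero] at this
        omega
      · exact hr
    have hpr : 1 < p ^ r := Nat.one_lt_pow hr.ne' hp.one_lt
    have hmul : 2 * m * (p ^ r - 1) = q - 1 := by
      rw [Nat.mul_sub, mul_one]
      have : m * (2 * p ^ r) = 2 * m * p ^ r := by ring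
      omega
    refine ⟨r, hr, ?_, ?_, rfl, hmul, har, ?_⟩
    · rw [← Nat.pow_lt_pow_iff_right hp.one_lt, ← hq]
      have : 2 * (p ^ r - 1) ≤ 2 * m * (p ^ r - 1) := Nat.mul_le_mul_right _ (by omega)
      omega
    · have hd : p ^ r - 1 ∣ p ^ h - 1 := hq ▸ hmul ▸ dvd_mul_left _ _
      have hg := Nat.gcd_eq_left hd
      rw [Nat.pow_sub_one_gcd_pow_sub_one] at hg
      have hg' : p ^ r.gcd h = p ^ r := by
        have := pow_pos hp.pos (r.gcd h)
        omega
      exact Nat.gcd_eq_left_iff_dvd.1 (Nat.pow_right_injective hp.two_le hg')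
    · apply sq_eq_sq_iff_eq_or_eq_neg.1
      rw [hconst, ← pow_mul, mul_comm 2]
  · rintro ⟨r, -, -, -, hn, hmul, har, hbr⟩
    have hpr : 0 < p ^ r := pow_pos hp.pos r
    have hnr : n * p ^ r = n - 1 + q := by
      rw [Nat.mul_sub, mul_one] at hmul
      have := Nat.le_mul_of_pos_right n hpr
      omega
    have hmr : 2 * m - 1 + q = m * (2 * p ^ r) := by
      rw [← hn, ← hnr, hn]
      ring
    have hb2 : b ^ 2 = b ^ (2 * p ^ r) := by
      rw [mul_comm, pow_mul]
      rcases hbr with h | h <;> simp [h]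
    have hu : (1 - C a * X 0 ^ n : MvPolynomial (Fin 2) F) ^ p ^ r =
        1 - C a * X 0 ^ (n - 1 + q) := by
      rw [sub_pow_char_pow, one_pow, mul_pow, ← C_pow, har, ← pow_mul, hnr]
    have hdvd := sub_dvd_pow_sub_pow (C b * X 1 ^ m : MvPolynomial (Fin 2) F)
      (1 - C a * X 0 ^ n) (2 * p ^ r)
    convert hdvd using 1
    · ring
    · rw [mul_pow, ← C_pow, ← hb2, ← pow_mul, ← hmr, mul_comm 2 (p ^ r), pow_mul, hu, hsq]
      simp only [map_mul, map_pow, map_ofNat]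
      ring
end

section
/- Let p > 5 be a prime, h a positive integer, q = p^h, and let F be a finite field with q elements. Let m, n be integers with n ≥ m > 2, p not dividing m·n, p dividing 2n − 1 and p dividing m − 1, and let a, b ∈ F be nonzero. Then, in the polynomial ring F[X, Y], the polynomial a·X^n + b·Y^m − 1 does not divide the polynomial a²·X^(2n−1+q) − b²·Y^(2m−2+2q) + 2b·Y^(m−1+q) − 1. -/
open MvPolynomial

/-- If `X ^ n - u` divides `c * X ^ N - d` over a commutative ring, then `c * u ^ (N / n) = d`:
reducing modulo the monic polynomial `X ^ n - u` gives `c * u ^ (N / n) * X ^ (N % n) - d = 0`,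
which is then evaluated at `1`. -/
theorem mul_pow_div_eq_of_X_pow_sub_C_dvd {R : Type*} [CommRing R] [Nontrivial R]
    {n N : ℕ} (hn : n ≠ 0) {c d u : R}
    (hdvd : (Polynomial.X ^ n - Polynomial.C u : Polynomial R) ∣
      Polynomial.C c * Polynomial.X ^ N - Polynomial.C d) :
    c * u ^ (N / n) = d := by
  have hpow : (Polynomial.X ^ n - Polynomial.C u : Polynomial R) ∣
      (Polynomial.X ^ n) ^ (N / n) - Polynomial.C u ^ (N / n) := sub_dvd_pow_sub_pow _ _ _
  have hred : (Polynomial.X ^ n - Polynomial.C u : Polynomial R) ∣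
      Polynomial.C (c * u ^ (N / n)) * Polynomial.X ^ (N % n) - Polynomial.C d := by
    have h := dvd_sub hdvd (hpow.mul_left (Polynomial.C c * Polynomial.X ^ (N % n)))
    convert h using 1
    have hX : (Polynomial.X : Polynomial R) ^ N
        = Polynomial.X ^ (N % n) * (Polynomial.X ^ n) ^ (N / n) := by
      rw [← pow_mul, ← pow_add, Nat.mod_add_div]
    rw [hX, Polynomial.C_mul, Polynomial.C_pow]
    ring
  have hmonic := Polynomial.monic_X_pow_sub_C u hn
  have hzero : Polynomial.C (c * u ^ (N / n)) * Polynomial.X ^ (N % n) - Polynomial.C d = 0 := by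
    by_contra hne
    refine hmonic.not_dvd_of_degree_lt hne ?_ hred
    rw [Polynomial.degree_X_pow_sub_C (Nat.pos_of_ne_zero hn)]
    refine (Polynomial.degree_sub_le _ _).trans_lt (max_lt ?_ ?_)
    · exact (Polynomial.degree_C_mul_X_pow_le _ _).trans_lt
        (by exact_mod_cast Nat.mod_lt N (Nat.pos_of_ne_zero hn))
    · exact Polynomial.degree_C_le.trans_lt (by exact_mod_cast Nat.pos_of_ne_zero hn)
  have heval := congrArg (Polynomial.eval 1) hzero
  simpa [sub_eq_zero] using heval

theorem frobenius_classical_conics_2n1_m1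
    (p h q : ℕ) (hp : p.Prime) (hp5 : 5 < p) (hh : 0 < h) (hq : q = p ^ h)
    (F : Type*) [Field F] [Fintype F] (hcard : Fintype.card F = q)
    (m n : ℕ) (hm : 2 < m) (hmn : m ≤ n) (hpmn : ¬ p ∣ m * n)
    (hpn : p ∣ 2 * n - 1) (hpm : p ∣ m - 1)
    (a b : F) (ha : a ≠ 0) (hb : b ≠ 0) :
    ¬ ((C a * X 0 ^ n + C b * X 1 ^ m - 1 : MvPolynomial (Fin 2) F) ∣
        (C (a ^ 2) * X 0 ^ (2 * n - 1 + q) - C (b ^ 2) * X 1 ^ (2 * m - 2 + 2 * q)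
          + C (2 * b) * X 1 ^ (m - 1 + q) - 1)) := by
  intro hdvd
  have hq1 : 1 < q := hcard ▸ Fintype.one_lt_card
  set k := m - 1 + q with hk
  set N := 2 * n - 1 + q with hN
  have h2k : 2 * m - 2 + 2 * q = k * 2 := by omega
  rw [h2k] at hdvd
  -- View both polynomials as polynomials in `X 0` over `F[X 1]`.
  have hmap := map_dvd (MvPolynomial.aeval (R := F)
    ![(Polynomial.X : Polynomial (Polynomial F)), Polynomial.C Polynomial.X]) hdvd
  have hCa : (Polynomial.C a * Polynomial.C a⁻¹ : Polynomial F) = 1 := by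
    rw [← Polynomial.C_mul, mul_inv_cancel₀ ha, Polynomial.C_1]
  have hred : Polynomial.C (a ^ 2) *
      (Polynomial.C a⁻¹ * (1 - Polynomial.C b * Polynomial.X ^ m)) ^ (N / n)
        = (Polynomial.C b * Polynomial.X ^ k - 1) ^ 2 := by
    apply mul_pow_div_eq_of_X_pow_sub_C_dvd (by omega)
    have hleft : (Polynomial.X ^ n - Polynomial.C
        (Polynomial.C a⁻¹ * (1 - Polynomial.C b * Polynomial.X ^ m)) :
          Polynomial (Polynomial F)) ∣ _ :=
      Dvd.intro_left (Polynomial.C (Polynomial.C a)) rfl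
    convert hleft.trans (dvd_trans (dvd_of_eq ?_) hmap) using 1
    · simp only [map_sub, map_add, map_mul, map_pow, map_one, MvPolynomial.aeval_X,
        MvPolynomial.algHom_C, Polynomial.algebraMap_apply, Algebra.algebraMap_self,
        RingHom.id_apply, Matrix.cons_val_zero, Matrix.cons_val_one, map_ofNat]
      ring
    · have hCCa := congrArg Polynomial.C hCa
      simp only [map_mul, map_one] at hCCa
      simp only [map_sub, map_add, map_mul, map_pow, map_one, MvPolynomial.aeval_X,
        MvPolynomial.algHom_C, Polynomial.algebraMap_apply, Algebra.algebraMap_self,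
        RingHom.id_apply, Matrix.cons_val_zero, Matrix.cons_val_one]
      linear_combination (Polynomial.C (Polynomial.C b) * Polynomial.C Polynomial.X ^ m - 1) * hCCa
  have hdeg : ((Polynomial.C b * Polynomial.X ^ k - 1) ^ 2 : Polynomial F).natDegree = 2 * k := by
    rw [Polynomial.natDegree_pow, ← Polynomial.C_1, Polynomial.natDegree_sub_C,
      Polynomial.natDegree_C_mul_X_pow _ _ hb]
  have hle : (Polynomial.C (a ^ 2) *
      (Polynomial.C a⁻¹ * (1 - Polynomial.C b * Polynomial.X ^ m)) ^ (N / n)).natDegree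
        ≤ N / n * m := by
    refine (Polynomial.natDegree_C_mul_le _ _).trans (Polynomial.natDegree_pow_le_of_le _ ?_)
    refine (Polynomial.natDegree_C_mul_le _ _).trans ?_
    refine (Polynomial.natDegree_sub_le _ _).trans (max_le (by simp) ?_)
    exact Polynomial.natDegree_C_mul_X_pow_le _ _
  rw [hred, hdeg] at hle
  have hdiv : N / n * n ≤ N := Nat.div_mul_le_self N n
  have hNz : (N : ℤ) = 2 * n - 1 + q := by omega
  have hkz : (k : ℤ) = m - 1 + q := by omega
  zify at hle hdiv hq1 hmn hm
  nlinarith [mul_le_mul_of_nonneg_right hle (by positivity : (0 : ℤ) ≤ n),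
    mul_le_mul_of_nonneg_right hdiv (by positivity : (0 : ℤ) ≤ m),
    mul_le_mul_of_nonneg_right hmn (by linarith : (0 : ℤ) ≤ q - 1),
    mul_pos (by linarith : (0 : ℤ) < n) (by linarith : (0 : ℤ) < q - 1)]
end

section
/- Let p > 5 be a prime, h a positive integer, q = p^h, and let F be a finite field with q elements. Let m, n be integers with n ≥ m > 2, p not dividing m·n, p dividing n − 1 and p dividing m − 2, and let a, b ∈ F be nonzero. Then, in the polynomial ring F[X, Y], the polynomial a·X^n + b·Y^m − 1 does not divide the polynomial a·X^(n−1+q) + b·Y^(m−2+2q) − 1. -/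
open MvPolynomial

/-- Leading coefficient of a polynomial whose other terms are at most one term of lower degree
and a constant. -/
theorem Polynomial.leadingCoeff_C_mul_X_pow_add_sub_one {R : Type*} [CommRing R] [Nontrivial R]
    {c d : R} {k l : ℕ} (hd : d ≠ 0) (hkl : k < l) :
    (Polynomial.C c * Polynomial.X ^ k + Polynomial.C d * Polynomial.X ^ l - 1).leadingCoeff
      = d := by
  have hdeg : (Polynomial.C d * Polynomial.X ^ l).degree = (l : WithBot ℕ) :=
    Polynomial.degree_C_mul_X_pow l hd
  have hk : (Polynomial.C c * Polynomial.X ^ k).degree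
      < (Polynomial.C d * Polynomial.X ^ l).degree := by
    rw [hdeg]
    exact (Polynomial.degree_C_mul_X_pow_le k c).trans_lt (by exact_mod_cast hkl)
  rw [Polynomial.leadingCoeff_sub_of_degree_lt, Polynomial.leadingCoeff_add_of_degree_lt hk,
    Polynomial.leadingCoeff_C_mul_X_pow]
  rw [Polynomial.degree_add_eq_right_of_degree_lt hk, hdeg, Polynomial.degree_one]
  exact_mod_cast (Nat.zero_le k).trans_lt hkl

theorem frobenius_classical_conics_n1_m2
    (p h q : ℕ) (hp : p.Prime) (hp5 : 5 < p) (hh : 0 < h) (hq : q = p ^ h)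
    (F : Type*) [Field F] [Fintype F] (hcard : Fintype.card F = q)
    (m n : ℕ) (hm : 2 < m) (hmn : m ≤ n) (hpmn : ¬ p ∣ m * n)
    (hpn : p ∣ n - 1) (hpm : p ∣ m - 2)
    (a b : F) (ha : a ≠ 0) (hb : b ≠ 0) :
    ¬ ((C a * X 0 ^ n + C b * X 1 ^ m - 1 : MvPolynomial (Fin 2) F) ∣
        (C a * X 0 ^ (n - 1 + q) + C b * X 1 ^ (m - 2 + 2 * q) - 1)) := by
  intro hdvd
  have hq1 : 1 < q := hcard ▸ Fintype.one_lt_card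
  have hmn0 : 0 < n * m := Nat.mul_pos (by omega) (by omega)
  -- Compare leading coefficients in `T` after `X ↦ X T ^ m`, `Y ↦ T ^ n`.
  let φ : MvPolynomial (Fin 2) F →ₐ[F] Polynomial (Polynomial F) :=
    aeval ![Polynomial.C Polynomial.X * Polynomial.X ^ m, Polynomial.X ^ n]
  have hC (x : F) : φ (C x) = Polynomial.C (Polynomial.C x) := by
    simp [φ, Polynomial.algebraMap_apply]
  have hX : φ (X 0) = Polynomial.C Polynomial.X * Polynomial.X ^ m := by simp [φ]
  have hY : φ (X 1) = Polynomial.X ^ n := by simp [φ]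
  have hf : φ (C a * X 0 ^ n + C b * X 1 ^ m - 1) =
      Polynomial.C 0 * Polynomial.X ^ 0 +
        Polynomial.C (Polynomial.C a * Polynomial.X ^ n + Polynomial.C b) *
          Polynomial.X ^ (n * m) - 1 := by
    simp only [map_sub, map_add, map_mul, map_pow, map_one, hC, hX, hY, map_zero]
    ring
  have hg : φ (C a * X 0 ^ (n - 1 + q) + C b * X 1 ^ (m - 2 + 2 * q) - 1) =
      Polynomial.C (Polynomial.C a * Polynomial.X ^ (n - 1 + q)) *
          Polynomial.X ^ (m * (n - 1 + q)) +
        Polynomial.C (Polynomial.C b) * Polynomial.X ^ (n * (m - 2 + 2 * q)) - 1 := by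
    simp only [map_sub, map_add, map_mul, map_pow, map_one, hC, hX, hY, mul_pow, ← pow_mul]
    ring
  have hlt : m * (n - 1 + q) < n * (m - 2 + 2 * q) := by
    obtain ⟨m, rfl⟩ := Nat.exists_eq_add_of_lt hm
    obtain ⟨n, rfl⟩ := Nat.exists_eq_add_of_le hmn
    obtain ⟨q, rfl⟩ := Nat.exists_eq_add_of_lt hq1
    rw [show 2 + m + 1 + n - 1 = 2 + m + n by omega, show 2 + m + 1 - 2 = m + 1 by omega]
    ring_nf
    nlinarith [Nat.zero_le (m * q), Nat.zero_le (n * q), Nat.zero_le (m * n)]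
  have hdeg : (Polynomial.C a * Polynomial.X ^ n + Polynomial.C b).natDegree = n := by
    rw [Polynomial.natDegree_add_C, Polynomial.natDegree_C_mul_X_pow n a ha]
  have hne : Polynomial.C a * Polynomial.X ^ n + Polynomial.C b ≠ 0 := by
    intro h0
    rw [h0, Polynomial.natDegree_zero] at hdeg
    omega
  have hlead := Polynomial.leadingCoeff_dvd_leadingCoeff (map_dvd φ hdvd)
  rw [hf, hg, Polynomial.leadingCoeff_C_mul_X_pow_add_sub_one hne hmn0,
    Polynomial.leadingCoeff_C_mul_X_pow_add_sub_one (Polynomial.C_ne_zero.mpr hb) hlt] at hlead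
  have hle := Polynomial.natDegree_le_of_dvd hlead (Polynomial.C_ne_zero.mpr hb)
  rw [hdeg, Polynomial.natDegree_C] at hle
  omega
end

section
/- Let p > 5 be a prime, h a positive integer, q = p^h, and let F be a finite field with q elements. Let m, n be integers with n ≥ m > 2, p not dividing m·n, p dividing n + 1 and p dividing m − 1, and let a, b ∈ F be nonzero. Then, in the polynomial ring F[X, Y], the polynomial a·X^n + b·Y^m − 1 does not divide the polynomial a·X^(n+1) + b·X^q·Y^(m−1+q) − X^q. -/
open MvPolynomial

/-- A point of the curve `a X ^ n + b Y ^ m = 1` at which the second polynomial vanishes satisfies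
a relation involving the second coordinate only. -/
theorem fermat_point_relation {K : Type*} [Field K] {m n q : ℕ} (hn : n ≠ 0)
    (hq : 1 < q) {a b x y : K} (h : a * x ^ n + b * y ^ m - 1 = 0)
    (h' : a * x ^ (n + 1) + b * x ^ q * y ^ (m - 1 + q) - x ^ q = 0) :
    (-(b * y ^ m - 1)) ^ (q - 1) * (b * y ^ (m - 1 + q) - 1) ^ n =
      a ^ (q - 1) * (b * y ^ m - 1) ^ n := by
  have hA : -(b * y ^ m - 1) = a * x ^ n := by linear_combination -h
  have hqx : x ^ q = x * x ^ (q - 1) := by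
    rw [← pow_succ', Nat.sub_add_cancel hq.le]
  by_cases hx : x = 0
  · have hA0 : b * y ^ m - 1 = 0 := by
      rw [hx, zero_pow hn, mul_zero] at hA
      exact neg_eq_zero.mp hA
    rw [hA0, neg_zero, zero_pow (by omega), zero_pow hn, zero_mul, mul_zero]
  · have hB : x ^ (q - 1) * (b * y ^ (m - 1 + q) - 1) = b * y ^ m - 1 := by
      apply mul_left_cancel₀ hx
      rw [hqx] at h'
      linear_combination h' - x * h
    rw [hA, ← hB, mul_pow, mul_pow, ← pow_mul, ← pow_mul, mul_comm n, mul_assoc]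

theorem frobenius_classical_conics_nplus1_m1
    (p h q : ℕ) (hp : p.Prime) (hp5 : 5 < p) (hh : 0 < h) (hq : q = p ^ h)
    (F : Type*) [Field F] [Fintype F] (hcard : Fintype.card F = q)
    (m n : ℕ) (hm : 2 < m) (hmn : m ≤ n) (hpmn : ¬ p ∣ m * n)
    (hpn : p ∣ n + 1) (hpm : p ∣ m - 1)
    (a b : F) (ha : a ≠ 0) (hb : b ≠ 0) :
    ¬ ((C a * X 0 ^ n + C b * X 1 ^ m - 1 : MvPolynomial (Fin 2) F) ∣
        (C a * X 0 ^ (n + 1) + C b * X 0 ^ q * X 1 ^ (m - 1 + q) - X 0 ^ q)) := by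
  rintro ⟨g, hg⟩
  have hq1 : 1 < q := hcard ▸ Fintype.one_lt_card
  let K := AlgebraicClosure F
  set c : K := algebraMap F K a with hc
  set d : K := algebraMap F K b with hd
  have hc0 : c ≠ 0 := by simpa [hc] using ha
  have hd0 : d ≠ 0 := by simpa [hd] using hb
  have key : (-(Polynomial.C d * Polynomial.X ^ m - 1)) ^ (q - 1) *
      (Polynomial.C d * Polynomial.X ^ (m - 1 + q) - 1) ^ n =
      Polynomial.C (c ^ (q - 1)) * (Polynomial.C d * Polynomial.X ^ m - 1) ^ n := by
    refine Polynomial.funext fun y => ?_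
    obtain ⟨x, hx⟩ := IsAlgClosed.exists_pow_nat_eq ((1 - d * y ^ m) / c) (n := n) (by omega)
    have h1 : c * x ^ n + d * y ^ m - 1 = 0 := by
      rw [hx, mul_div_cancel₀ _ hc0]
      ring
    have h2 := congrArg (aeval ![x, y]) hg
    simp only [map_mul, map_add, map_sub, map_pow, map_one, aeval_C, aeval_X,
      Matrix.cons_val_zero, Matrix.cons_val_one] at h2
    rw [← hc, ← hd, h1, zero_mul] at h2
    simpa using fermat_point_relation (by omega) hq1 h1 h2
  have hdeg : ∀ k, (Polynomial.C d * Polynomial.X ^ k - 1).natDegree = k := fun k => by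
    rw [← Polynomial.C_1, Polynomial.natDegree_sub_C, Polynomial.natDegree_C_mul_X_pow _ _ hd0]
  have hne : ∀ k, 0 < k → Polynomial.C d * Polynomial.X ^ k - 1 ≠ 0 := fun k hk h0 => by
    have := hdeg k
    rw [h0, Polynomial.natDegree_zero] at this
    omega
  have hdegrees := congrArg Polynomial.natDegree key
  rw [Polynomial.natDegree_mul (pow_ne_zero _ (neg_ne_zero.mpr (hne m (by omega))))
      (pow_ne_zero _ (hne _ (by omega))),
    Polynomial.natDegree_C_mul (pow_ne_zero _ hc0), Polynomial.natDegree_pow,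
    Polynomial.natDegree_pow, Polynomial.natDegree_pow, Polynomial.natDegree_neg,
    hdeg, hdeg] at hdegrees
  have hpos : 0 < (q - 1) * m := Nat.mul_pos (by omega) (by omega)
  have hle : n * m ≤ n * (m - 1 + q) := Nat.mul_le_mul_left n (by omega)
  omega
end

section
/- Let p > 5 be a prime, h a positive integer, q = p^h, and let F be a finite field with q elements. Let m, n be integers with n ≥ m > 2, p not dividing m·n, p dividing n − 1 and p dividing m − 1, and let a, b, c ∈ F be nonzero with b·c ≠ −a. Then, in the polynomial ring F[X, Y], the polynomial a·X^n·Y^m + b·X^n + c·Y^m − 1 divides the polynomial a·X^(n−1+q)·Y^(m−1+q) + b·X^(n−1+q) + c·Y^(m−1+q) − 1 if and only if there exists a positive integer r < h with r dividing h such that m = n, n·(p^r − 1) = q − 1, a^(p^r) = a, b^(p^r) = b, and c^(p^r) = c. -/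
open MvPolynomial

/-- If `(1 - bX)^k = 1 - bX^k` in characteristic `p` with `b ≠ 0`, then `k` is a power of `p`. -/
theorem exists_eq_prime_pow_of_one_sub_pow_eq {K : Type*} [Field K] (p : ℕ) [Fact p.Prime]
    [CharP K p] {b : K} (hb : b ≠ 0) {k : ℕ} (hk : k ≠ 0)
    (h : (1 - Polynomial.C b * Polynomial.X) ^ k = 1 - Polynomial.C b * Polynomial.X ^ k) :
    ∃ r, k = p ^ r := by
  have hp : p.Prime := Fact.out
  obtain ⟨r, k', hpk', rfl⟩ := Nat.exists_eq_pow_mul_and_not_dvd hk p hp.ne_one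
  refine ⟨r, ?_⟩
  have hexp : Polynomial.expand K (p ^ r)
        ((1 - Polynomial.C (b ^ p ^ r) * Polynomial.X) ^ k') =
      Polynomial.expand K (p ^ r) (1 - Polynomial.C b * Polynomial.X ^ k') := by
    simp only [map_pow, map_sub, map_one, map_mul, Polynomial.expand_C, Polynomial.expand_X]
    rw [← pow_mul, ← h, pow_mul, sub_pow_char_pow, one_pow, mul_pow]
  have hpoly := Polynomial.expand_injective (pow_pos hp.pos r) hexp
  have hder := congrArg (fun P : Polynomial K => P.derivative.eval 0) hpoly
  by_contra hne
  have hk1 : k' ≠ 1 := by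
    rintro rfl
    simp at hne
  have hk0 : k' ≠ 0 := by
    rintro rfl
    simp at hpk'
  have hcast : (k' : K) ≠ 0 := fun h0 => hpk' ((CharP.cast_eq_zero_iff K p k').1 h0)
  have hk2 : k' - 1 ≠ 0 := by omega
  simp [Polynomial.derivative_pow, hk2, hcast, hb] at hder

/-- Coefficient and exponent constraints forced by the identity
`(1 - bX)^k (aX^k + c) = (1 - bX^k) (aX + c)^k` in characteristic `p`. -/
theorem prime_pow_and_fixed_of_moebius_pow_identity {K : Type*} [Field K] (p : ℕ) [Fact p.Prime]
    [CharP K p] {a b c : K} (ha : a ≠ 0) (hb : b ≠ 0) (hbc : b * c ≠ -a)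
    {k l : ℕ} (hk : k ≠ 0) (hkl : k ≤ l)
    (h : (1 - Polynomial.C b * Polynomial.X) ^ l *
        (Polynomial.C a * Polynomial.X ^ k + Polynomial.C c) =
      (1 - Polynomial.C b * Polynomial.X ^ k) *
        (Polynomial.C a * Polynomial.X + Polynomial.C c) ^ l) :
    k = l ∧ (∃ r, k = p ^ r) ∧ a ^ k = a ∧ b ^ k = b ∧ c ^ k = c := by
  have hdet : a + b * c ≠ 0 := fun h0 => hbc (by linear_combination h0)
  have hcop : IsCoprime (Polynomial.C a * Polynomial.X + Polynomial.C c)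
      (1 - Polynomial.C b * Polynomial.X) := by
    refine ⟨Polynomial.C (b / (a + b * c)), Polynomial.C (a / (a + b * c)), ?_⟩
    have h1 : b / (a + b * c) * a = a / (a + b * c) * b := by ring
    have h2 : b / (a + b * c) * c + a / (a + b * c) = 1 := by field_simp; ring
    have h1' := congrArg (Polynomial.C : K → Polynomial K) h1
    have h2' := congrArg (Polynomial.C : K → Polynomial K) h2
    simp only [Polynomial.C_mul, Polynomial.C_add, Polynomial.C_1] at h1' h2'
    linear_combination Polynomial.X * h1' + h2'
  have hP2deg : (Polynomial.C a * Polynomial.X ^ k + Polynomial.C c).natDegree = k := by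
    rw [Polynomial.natDegree_add_C, Polynomial.natDegree_C_mul_X_pow _ _ ha]
  have hL2deg : (Polynomial.C a * Polynomial.X + Polynomial.C c).natDegree = 1 :=
    Polynomial.natDegree_linear ha
  have hP2 : (Polynomial.C a * Polynomial.X ^ k + Polynomial.C c) ≠ 0 := by
    intro h0
    rw [h0] at hP2deg
    simp at hP2deg
    omega
  have hL2 : (Polynomial.C a * Polynomial.X + Polynomial.C c) ≠ 0 := by
    intro h0
    rw [h0] at hL2deg
    simp at hL2deg
  have hdvd : (Polynomial.C a * Polynomial.X + Polynomial.C c) ^ l ∣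
      Polynomial.C a * Polynomial.X ^ k + Polynomial.C c :=
    (hcop.pow).dvd_of_dvd_mul_left (Dvd.intro_left _ h.symm)
  have hle := Polynomial.natDegree_le_of_dvd hdvd hP2
  rw [Polynomial.natDegree_pow, hL2deg, hP2deg, mul_one] at hle
  obtain rfl : k = l := le_antisymm hkl hle
  obtain ⟨t, ht⟩ := hdvd
  have htne : t ≠ 0 := by
    rintro rfl
    exact hP2 (by rw [ht, mul_zero])
  have htdeg : t.natDegree = 0 := by
    have := congrArg Polynomial.natDegree ht
    rw [hP2deg, Polynomial.natDegree_mul (pow_ne_zero _ hL2) htne, Polynomial.natDegree_pow,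
      hL2deg] at this
    omega
  have hP1 : (1 - Polynomial.C b * Polynomial.X) ^ k * t =
      1 - Polynomial.C b * Polynomial.X ^ k := by
    apply mul_right_cancel₀ (pow_ne_zero k hL2)
    rw [← h, ht]
    ring
  have ht1 : t = 1 := by
    rw [Polynomial.eq_C_of_natDegree_eq_zero htdeg] at hP1 ⊢
    have := congrArg (Polynomial.eval 0) hP1
    simp [hk] at this
    simp [this]
  subst ht1
  rw [mul_one] at hP1 ht
  obtain ⟨r, hr⟩ := exists_eq_prime_pow_of_one_sub_pow_eq p hb hk hP1
  have hb1 := congrArg (Polynomial.eval 1) hP1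
  have hc0 := congrArg (Polynomial.eval 0) ht
  have ha1 := congrArg (Polynomial.eval 1) ht
  simp [hk] at hb1 hc0 ha1
  refine ⟨rfl, ⟨r, hr⟩, ?_, ?_, hc0.symm⟩
  · rw [hr, add_pow_char_pow, ← hr, ← hc0] at ha1
    exact (add_right_cancel ha1).symm
  · rw [hr, sub_pow_char_pow, ← hr, one_pow] at hb1
    exact sub_right_injective hb1

/-- If the vanishing of `a x^n y^m + b x^n + c y^m - 1` forces that of the same form with
exponents `N` and `M`, then `n ∣ N`. -/
theorem dvd_exponent_of_vanishing {K : Type*} [Field K] [IsAlgClosed K]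
    {a b c : K} (hbc : b * c ≠ -a) {n m N M : ℕ} [NeZero (n : K)] (hm : m ≠ 0)
    (hvan : ∀ x y : K, a * x ^ n * y ^ m + b * x ^ n + c * y ^ m - 1 = 0 →
      a * x ^ N * y ^ M + b * x ^ N + c * y ^ M - 1 = 0)
    {u : K} (hu : u ≠ 0) (hu' : a * u + c ≠ 0) : n ∣ N := by
  have hn : n ≠ 0 := by
    rintro rfl
    exact NeZero.ne ((0 : ℕ) : K) Nat.cast_zero
  obtain ⟨ζ, hζ⟩ := HasEnoughRootsOfUnity.exists_primitiveRoot K n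
  obtain ⟨x, hx⟩ := IsAlgClosed.exists_pow_nat_eq u (Nat.pos_of_ne_zero hn)
  obtain ⟨y, hy⟩ := IsAlgClosed.exists_pow_nat_eq ((1 - b * u) / (a * u + c))
    (Nat.pos_of_ne_zero hm)
  have hx0 : x ≠ 0 := by
    rintro rfl
    exact hu (by rw [← hx, zero_pow hn])
  have hcurve : a * u * ((1 - b * u) / (a * u + c)) + b * u
      + c * ((1 - b * u) / (a * u + c)) - 1 = 0 := by
    field_simp
    ring
  have h1 := hvan x y (by rw [hx, hy]; exact hcurve)
  have h2 := hvan (ζ * x) y (by rw [mul_pow, hζ.pow_eq_one, one_mul, hx, hy]; exact hcurve)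
  rw [mul_pow] at h2
  have hprod : (ζ ^ N - 1) * (x ^ N * (a * y ^ M + b)) = 0 := by linear_combination h2 - h1
  rcases mul_eq_zero.1 hprod with h0 | h0
  · exact hζ.dvd_of_pow_eq_one N (sub_eq_zero.1 h0)
  · rcases mul_eq_zero.1 h0 with h0 | h0
    · exact absurd h0 (pow_ne_zero _ hx0)
    · exact absurd (by linear_combination (-a) * h1 + (a * x ^ N + c) * h0) hbc

/-- Over an algebraically closed field of characteristic `p`, if every point of the curve
`a x^n y^m + b x^n + c y^m = 1` satisfies the equation with both exponents shifted by `q - 1`,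
then `q - 1 = n (k - 1)` for a power `k` of `p` whose Frobenius map fixes the coefficients. -/
theorem exists_prime_pow_of_shifted_vanishing {K : Type*} [Field K] [IsAlgClosed K] (p : ℕ)
    [Fact p.Prime] [CharP K p] {a b c : K} (ha : a ≠ 0) (hb : b ≠ 0) (hbc : b * c ≠ -a)
    {n m q : ℕ} [NeZero (n : K)] [NeZero (m : K)] (hm : 0 < m) (hmn : m ≤ n) (hq1 : 1 < q)
    (hvan : ∀ x y : K, a * x ^ n * y ^ m + b * x ^ n + c * y ^ m - 1 = 0 →
      a * x ^ (n - 1 + q) * y ^ (m - 1 + q) + b * x ^ (n - 1 + q)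
        + c * y ^ (m - 1 + q) - 1 = 0) :
    ∃ r, n * (p ^ r - 1) = q - 1 ∧ m * (p ^ r - 1) = q - 1 ∧
      a ^ p ^ r = a ∧ b ^ p ^ r = b ∧ c ^ p ^ r = c := by
  classical
  have hlin : ∀ d : K, ∃ u : K, u ≠ 0 ∧ a * u + d ≠ 0 := by
    intro d
    obtain ⟨u, hu⟩ := Infinite.exists_notMem_finset ({0, -d / a} : Finset K)
    simp only [Finset.mem_insert, Finset.mem_singleton, not_or] at hu
    refine ⟨u, hu.1, fun h0 => hu.2 ?_⟩
    field_simp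
    linear_combination h0
  obtain ⟨k, hk⟩ : n ∣ n - 1 + q := by
    obtain ⟨u, hu, hu'⟩ := hlin c
    exact dvd_exponent_of_vanishing hbc (by omega) hvan hu hu'
  obtain ⟨l, hl⟩ : m ∣ m - 1 + q := by
    obtain ⟨u, hu, hu'⟩ := hlin b
    refine dvd_exponent_of_vanishing (a := a) (b := c) (c := b) (n := m) (m := n)
      (M := n - 1 + q) (by rwa [mul_comm]) (by omega) (fun x y hxy => ?_) hu hu'
    linear_combination hvan y x (by linear_combination hxy)
  have hk0 : k ≠ 0 := by
    rintro rfl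
    omega
  have hl0 : l ≠ 0 := by
    rintro rfl
    omega
  have hnk : n * (k - 1) = q - 1 := by
    rw [Nat.mul_sub, ← hk]
    omega
  have hml : m * (l - 1) = q - 1 := by
    rw [Nat.mul_sub, ← hl]
    omega
  have hkl : k ≤ l := by
    by_contra! hlt
    have h1 : m * (l - 1) < n * (k - 1) :=
      Nat.mul_lt_mul_of_le_of_lt hmn (by omega) (by omega)
    omega
  have hid : (1 - Polynomial.C b * Polynomial.X) ^ l *
        (Polynomial.C a * Polynomial.X ^ k + Polynomial.C c) =
      (1 - Polynomial.C b * Polynomial.X ^ k) *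
        (Polynomial.C a * Polynomial.X + Polynomial.C c) ^ l := by
    refine Polynomial.eq_of_infinite_eval_eq _ _
      (Set.Infinite.mono ?_ (Set.finite_singleton (-c / a)).infinite_compl)
    intro u hu
    have hu' : a * u + c ≠ 0 := by
      intro h0
      apply hu
      rw [Set.mem_singleton_iff]
      field_simp
      linear_combination h0
    obtain ⟨x, hx⟩ := IsAlgClosed.exists_pow_nat_eq u (show 0 < n by omega)
    obtain ⟨y, hy⟩ := IsAlgClosed.exists_pow_nat_eq ((1 - b * u) / (a * u + c))
      (show 0 < m by omega)
    have hxy := hvan x y (by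
      rw [hx, hy]
      field_simp
      ring)
    rw [hk, hl, pow_mul, pow_mul, hx, hy, div_pow] at hxy
    have hne := pow_ne_zero l hu'
    field_simp at hxy
    simp only [Set.mem_ofPred_eq, Polynomial.eval_mul, Polynomial.eval_pow, Polynomial.eval_sub,
      Polynomial.eval_add, Polynomial.eval_one, Polynomial.eval_C, Polynomial.eval_X]
    linear_combination hxy
  obtain ⟨rfl, ⟨r, rfl⟩, hak, hbk, hck⟩ :=
    prime_pow_and_fixed_of_moebius_pow_identity p ha hb hbc hk0 hkl hid
  exact ⟨r, hnk, hml, hak, hbk, hck⟩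

theorem frobenius_nonclassical_conics_gen_n1_m1
    (p h q : ℕ) (hp : p.Prime) (hp5 : 5 < p) (hh : 0 < h) (hq : q = p ^ h)
    (F : Type*) [Field F] [Fintype F] (hcard : Fintype.card F = q)
    (m n : ℕ) (hm : 2 < m) (hmn : m ≤ n) (hpmn : ¬ p ∣ m * n)
    (hpn : p ∣ n - 1) (hpm : p ∣ m - 1)
    (a b c : F) (ha : a ≠ 0) (hb : b ≠ 0) (hc : c ≠ 0) (hbc : b * c ≠ -a) :
    ((C a * X 0 ^ n * X 1 ^ m + C b * X 0 ^ n + C c * X 1 ^ m - 1 :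
        MvPolynomial (Fin 2) F) ∣
        (C a * X 0 ^ (n - 1 + q) * X 1 ^ (m - 1 + q) + C b * X 0 ^ (n - 1 + q)
          + C c * X 1 ^ (m - 1 + q) - 1)) ↔
      ∃ r : ℕ, 0 < r ∧ r < h ∧ r ∣ h ∧ m = n ∧ n * (p ^ r - 1) = q - 1 ∧
        a ^ p ^ r = a ∧ b ^ p ^ r = b ∧ c ^ p ^ r = c := by
  have : Fact p.Prime := ⟨hp⟩
  have : CharP F p := charP_of_card_eq_prime_pow (hcard.trans hq)
  have hq1 : 1 < q := hq ▸ Nat.one_lt_pow hh.ne' hp.one_lt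
  constructor
  · rintro ⟨g, hg⟩
    let K := AlgebraicClosure F
    have : CharP K p := charP_of_injective_algebraMap (algebraMap F K).injective p
    have hinj := (algebraMap F K).injective
    set a' := algebraMap F K a with ha'
    set b' := algebraMap F K b with hb'
    set c' := algebraMap F K c with hc'
    have ha0 : a' ≠ 0 := (map_ne_zero _).2 ha
    have hb0 : b' ≠ 0 := (map_ne_zero _).2 hb
    have hbc' : b' * c' ≠ -a' := by
      rw [ha', hb', hc', ← map_mul, ← map_neg]
      exact hinj.ne hbc
    have hvan : ∀ x y : K, a' * x ^ n * y ^ m + b' * x ^ n + c' * y ^ m - 1 = 0 →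
        a' * x ^ (n - 1 + q) * y ^ (m - 1 + q) + b' * x ^ (n - 1 + q)
          + c' * y ^ (m - 1 + q) - 1 = 0 := by
      intro x y hxy
      have := congrArg (aeval ![x, y]) hg
      simp only [map_mul, map_sub, map_add, map_pow, map_one, aeval_X, aeval_C,
        Matrix.cons_val_zero, Matrix.cons_val_one] at this
      rw [this, hxy, zero_mul]
    have : NeZero (n : K) :=
      ⟨fun h0 => hpmn (dvd_mul_of_dvd_right ((CharP.cast_eq_zero_iff K p n).1 h0) m)⟩
    have : NeZero (m : K) :=
      ⟨fun h0 => hpmn (dvd_mul_of_dvd_left ((CharP.cast_eq_zero_iff K p m).1 h0) n)⟩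
    obtain ⟨r, hnk, hml, hak, hbk, hck⟩ := exists_prime_pow_of_shifted_vanishing p ha0 hb0 hbc'
      (by omega) hmn hq1 hvan
    have hpr : p ^ r - 1 ≠ 0 := by
      intro h0
      rw [h0] at hnk
      omega
    have hr0 : r ≠ 0 := by
      rintro rfl
      simp at hpr
    have hrh : r < h := by
      rw [← Nat.pow_lt_pow_iff_right hp.one_lt, ← hq]
      have : 2 * (p ^ r - 1) ≤ n * (p ^ r - 1) := Nat.mul_le_mul_right _ (by omega)
      omega
    refine ⟨r, Nat.pos_of_ne_zero hr0, hrh, ?_, ?_, hnk, ?_, ?_, ?_⟩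
    · have hgcd := Nat.pow_sub_one_gcd_pow_sub_one p r h
      rw [← hq, ← hnk, Nat.gcd_eq_left (dvd_mul_left _ _)] at hgcd
      have h1 := Nat.one_le_pow r p hp.pos
      have h2 := Nat.one_le_pow (r.gcd h) p hp.pos
      have h3 : r = r.gcd h := Nat.pow_right_injective hp.two_le (by simp only; omega)
      exact h3 ▸ Nat.gcd_dvd_right r h
    · exact Nat.eq_of_mul_eq_mul_right (Nat.pos_of_ne_zero hpr) (hml.trans hnk.symm)
    · exact hinj (by rw [map_pow]; exact hak)
    · exact hinj (by rw [map_pow]; exact hbk)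
    · exact hinj (by rw [map_pow]; exact hck)
  · rintro ⟨r, hr, -, -, rfl, hn, har, hbr, hcr⟩
    have hexp : m - 1 + q = m * p ^ r := by
      have h1 := Nat.one_le_pow r p hp.pos
      have h2 : m ≤ m * p ^ r := Nat.le_mul_of_pos_right m h1
      rw [Nat.mul_sub, mul_one] at hn
      omega
    have hpow : (C a * X 0 ^ (m - 1 + q) * X 1 ^ (m - 1 + q) + C b * X 0 ^ (m - 1 + q)
          + C c * X 1 ^ (m - 1 + q) - 1 : MvPolynomial (Fin 2) F) =
        (C a * X 0 ^ m * X 1 ^ m + C b * X 0 ^ m + C c * X 1 ^ m - 1) ^ p ^ r := by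
      rw [sub_pow_char_pow, add_pow_char_pow, add_pow_char_pow, one_pow]
      simp only [mul_pow, ← C_pow, har, hbr, hcr, ← pow_mul, hexp]
    rw [hpow]
    exact dvd_pow_self _ (pow_pos hp.pos r).ne'
end

section
/- Let p > 5 be a prime, h a positive integer, q = p^h, and let F be a finite field with q elements. Let m, n be integers with n ≥ m > 2, p not dividing m·n, p dividing n − 1 and p dividing m + 1, and let a, b, c ∈ F be nonzero with b·c ≠ −a. Then, in the polynomial ring F[X, Y], the polynomial a·X^n·Y^m + b·X^n + c·Y^m − 1 divides the polynomial a·X^(n−1+q)·Y^(m+1) + b·X^(n−1+q)·Y^q + c·Y^(m+1) − Y^q if and only if there exists a positive integer r < h such that n·(p^r − 1) = q − 1, m·(p^r + 1) = q − 1, c·a^(p^r) = −b, c·b^(p^r) = −a, and c^(p^r + 1) = 1. -/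
open MvPolynomial

section Binomials

variable {K : Type*} [Field K]

/-- If a binomial `P X ^ n - Q` with `P, Q ≠ 0` divides `A X ^ N + B X ^ M`, and `A`, `B` do not
both vanish, then `N ≡ M` modulo `n`. -/
lemma Polynomial.modEq_of_binomial_dvd {P Q A B : K} {n N M : ℕ} (hn : 0 < n) (hP : P ≠ 0)
    (hQ : Q ≠ 0) (hAB : ¬ (A = 0 ∧ B = 0))
    (hdvd : (Polynomial.C P * Polynomial.X ^ n - Polynomial.C Q : Polynomial K) ∣
      Polynomial.C A * Polynomial.X ^ N + Polynomial.C B * Polynomial.X ^ M) :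
    N ≡ M [MOD n] := by
  set s : K := Q / P with hs
  have hs0 : s ≠ 0 := div_ne_zero hQ hP
  have hdvd' : (Polynomial.X ^ n - Polynomial.C s : Polynomial K) ∣
      Polynomial.C A * Polynomial.X ^ N + Polynomial.C B * Polynomial.X ^ M := by
    refine dvd_trans ⟨Polynomial.C P, ?_⟩ hdvd
    rw [sub_mul, ← Polynomial.C_mul, hs, div_mul_cancel₀ _ hP, mul_comm]
  have hred : ∀ j : ℕ, (Polynomial.X ^ n - Polynomial.C s : Polynomial K) ∣
      Polynomial.X ^ j - Polynomial.C (s ^ (j / n)) * Polynomial.X ^ (j % n) := by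
    intro j
    have h1 := (sub_dvd_pow_sub_pow (Polynomial.X ^ n : Polynomial K) (Polynomial.C s)
      (j / n)).mul_right (Polynomial.X ^ (j % n))
    convert h1 using 1
    conv_lhs => rw [← Nat.div_add_mod j n]
    rw [Nat.mul_add_div hn, Nat.mul_add_mod, Nat.mod_mod, Nat.mod_div_self, pow_add, pow_mul,
      Polynomial.C_pow, add_zero]
    ring
  have hrem : (Polynomial.X ^ n - Polynomial.C s : Polynomial K) ∣
      Polynomial.C (A * s ^ (N / n)) * Polynomial.X ^ (N % n) +
        Polynomial.C (B * s ^ (M / n)) * Polynomial.X ^ (M % n) := by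
    have h1 := dvd_sub hdvd' (dvd_add ((hred N).mul_left (Polynomial.C A))
      ((hred M).mul_left (Polynomial.C B)))
    convert h1 using 1
    rw [Polynomial.C_mul, Polynomial.C_mul]
    ring
  have hzero := Polynomial.eq_zero_of_dvd_of_degree_lt hrem (by
    rw [Polynomial.degree_X_pow_sub_C hn]
    refine lt_of_le_of_lt (Polynomial.degree_add_le _ _) (max_lt ?_ ?_)
    · exact lt_of_le_of_lt (Polynomial.degree_C_mul_X_pow_le _ _)
        (by exact_mod_cast Nat.mod_lt N hn)
    · exact lt_of_le_of_lt (Polynomial.degree_C_mul_X_pow_le _ _)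
        (by exact_mod_cast Nat.mod_lt M hn))
  by_contra hne
  have hne' : N % n ≠ M % n := hne
  have hN := congrArg (fun f => Polynomial.coeff f (N % n)) hzero
  have hM := congrArg (fun f => Polynomial.coeff f (M % n)) hzero
  simp only [Polynomial.coeff_add, Polynomial.coeff_C_mul_X_pow, Polynomial.coeff_zero,
    if_true, if_neg hne', if_neg hne'.symm, add_zero, zero_add] at hN hM
  exact hAB ⟨(mul_eq_zero.1 hN).resolve_right (pow_ne_zero _ hs0),
    (mul_eq_zero.1 hM).resolve_right (pow_ne_zero _ hs0)⟩

/-- The resultant-type identity satisfied when `P X ^ n - Q` divides `A X ^ (n k) + B`. -/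
lemma Polynomial.eq_zero_of_binomial_dvd {P Q A B : K} {n k : ℕ} (hn : 0 < n) (hP : P ≠ 0)
    (hdvd : (Polynomial.C P * Polynomial.X ^ n - Polynomial.C Q : Polynomial K) ∣
      Polynomial.C A * Polynomial.X ^ (n * k) + Polynomial.C B) :
    A * Q ^ k + B * P ^ k = 0 := by
  have h1 := (sub_dvd_pow_sub_pow (Polynomial.C P * Polynomial.X ^ n : Polynomial K)
    (Polynomial.C Q) k).mul_left (Polynomial.C A)
  have h2 := dvd_sub (hdvd.mul_left (Polynomial.C P ^ k)) h1
  have h3 : (Polynomial.C P * Polynomial.X ^ n - Polynomial.C Q : Polynomial K) ∣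
      Polynomial.C (A * Q ^ k + B * P ^ k) := by
    convert h2 using 1
    simp only [Polynomial.C_add, Polynomial.C_mul, Polynomial.C_pow]
    rw [pow_mul]
    ring
  refine Polynomial.C_eq_zero.1 (Polynomial.eq_zero_of_dvd_of_degree_lt h3 ?_)
  have hdeg : (Polynomial.C P * Polynomial.X ^ n - Polynomial.C Q : Polynomial K).degree = n := by
    rw [Polynomial.degree_sub_eq_left_of_degree_lt, Polynomial.degree_C_mul_X_pow n hP]
    rw [Polynomial.degree_C_mul_X_pow n hP]
    exact lt_of_le_of_lt Polynomial.degree_C_le (by exact_mod_cast hn)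
  rw [hdeg]
  exact lt_of_le_of_lt Polynomial.degree_C_le (by exact_mod_cast hn)

/-- If `X ^ t - c` is a multiple of the `t`-th power of a linear polynomial in characteristic `p`
and `c ≠ 0`, then `t` is a power of `p`. -/
lemma Polynomial.exists_eq_pow_of_X_pow_sub_C_eq {p : ℕ} (hp : p.Prime) [CharP K p] {c d g : K}
    {t : ℕ} (ht : 0 < t) (hc : c ≠ 0)
    (h : (Polynomial.X ^ t - Polynomial.C c : Polynomial K) =
      Polynomial.C d * (Polynomial.X - Polynomial.C g) ^ t) :
    ∃ r, t = p ^ r := by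
  have := Fact.mk hp
  obtain ⟨r, u, hpu, rfl⟩ := Nat.exists_eq_pow_mul_and_not_dvd ht.ne' p hp.ne_one
  refine ⟨r, ?_⟩
  have hu : u ≠ 0 := by rintro rfl; simp at ht
  have huK : (u : K) ≠ 0 := fun h0 => hpu ((CharP.cast_eq_zero_iff K p u).1 h0)
  have hw : (Polynomial.X ^ u - Polynomial.C c : Polynomial K) =
      Polynomial.C d * (Polynomial.X - Polynomial.C (g ^ p ^ r)) ^ u := by
    apply Polynomial.expand_injective (pow_pos hp.pos r)
    rw [pow_mul, pow_mul, sub_pow_char_pow] at h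
    simpa using h
  by_contra hne
  have hu1 : u - 1 ≠ 0 := fun h0 => hne (by rw [show u = 1 by omega, mul_one])
  have hder := congrArg (fun f => f.derivative.eval (g ^ p ^ r)) hw
  have hev := congrArg (fun f => f.eval (g ^ p ^ r)) hw
  simp [Polynomial.derivative_pow, hu1, huK] at hder
  simp [hder, hu, hc, hp.ne_zero] at hev

/-- The shape of the solutions of the one-variable identity obtained by eliminating a variable
from a Fermat-type curve. -/
lemma Polynomial.eq_pow_of_mul_pow_eq {p : ℕ} (hp : p.Prime) [CharP K p] {a b c : K} {k t : ℕ}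
    (ht : 0 < t) (hc : c ≠ 0) (hbc : b * c ≠ -a)
    (h : (Polynomial.C a + Polynomial.C b * Polynomial.X ^ t) *
        (1 - Polynomial.C c * Polynomial.X) ^ k =
      (Polynomial.X ^ t - Polynomial.C c) *
        (Polynomial.C a * Polynomial.X + Polynomial.C b : Polynomial K) ^ k) :
    k = t ∧ (∃ r, t = p ^ r) ∧ c ^ (t + 1) = 1 := by
  have hu : a + b * c ≠ 0 := fun h0 => hbc (by linear_combination h0)
  have hunit : (Polynomial.C (a + b * c)⁻¹ * (Polynomial.C a + Polynomial.C b * Polynomial.C c) :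
      Polynomial K) = 1 := by
    rw [← Polynomial.C_mul, ← Polynomial.C_add, ← Polynomial.C_mul, inv_mul_cancel₀ hu,
      Polynomial.C_1]
  have hlin : IsCoprime (1 - Polynomial.C c * Polynomial.X : Polynomial K)
      (Polynomial.C a * Polynomial.X + Polynomial.C b) :=
    ⟨Polynomial.C (a + b * c)⁻¹ * Polynomial.C a, Polynomial.C (a + b * c)⁻¹ * Polynomial.C c, by
      linear_combination hunit⟩
  have hpow : IsCoprime (Polynomial.X ^ t - Polynomial.C c : Polynomial K)
      (Polynomial.C a + Polynomial.C b * Polynomial.X ^ t) :=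
    ⟨-(Polynomial.C (a + b * c)⁻¹ * Polynomial.C b), Polynomial.C (a + b * c)⁻¹, by
      linear_combination hunit⟩
  have hd1 : (1 - Polynomial.C c * Polynomial.X : Polynomial K) ^ k ∣
      Polynomial.X ^ t - Polynomial.C c :=
    (hlin.pow (m := k) (n := k)).dvd_of_dvd_mul_right (h ▸ dvd_mul_left _ _)
  have hd2 : (Polynomial.X ^ t - Polynomial.C c : Polynomial K) ∣
      (1 - Polynomial.C c * Polynomial.X : Polynomial K) ^ k :=
    hpow.dvd_of_dvd_mul_left (h ▸ dvd_mul_right _ _)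
  have hfac : (1 - Polynomial.C c * Polynomial.X : Polynomial K) =
      Polynomial.C (-c) * (Polynomial.X - Polynomial.C c⁻¹) := by
    rw [mul_sub, ← Polynomial.C_mul, neg_mul, mul_inv_cancel₀ hc]
    simp only [Polynomial.C_neg, Polynomial.C_1]
    ring
  have hass := associated_of_dvd_dvd hd1 hd2
  have hkt : k = t := by
    have h1 := Polynomial.natDegree_eq_of_degree_eq (Polynomial.degree_eq_degree_of_associated hass)
    rwa [hfac, mul_pow, ← Polynomial.C_pow, Polynomial.natDegree_C_mul
      (pow_ne_zero _ (neg_ne_zero.2 hc)), Polynomial.natDegree_pow, Polynomial.natDegree_X_sub_C,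
      Polynomial.natDegree_X_pow_sub_C, mul_one] at h1
  refine ⟨hkt, ?_, ?_⟩
  · obtain ⟨v, hv⟩ := hass
    obtain ⟨d, -, hd⟩ := Polynomial.isUnit_iff.1 v.isUnit
    refine Polynomial.exists_eq_pow_of_X_pow_sub_C_eq hp ht hc
      (d := d * (-c) ^ k) (g := c⁻¹) ?_
    rw [← hv, ← hd, hfac, mul_pow, hkt, Polynomial.C_mul, Polynomial.C_pow]
    ring
  · have hev := congrArg (fun f => f.eval c⁻¹) h
    have hk : k ≠ 0 := by omega
    have hne : a * c⁻¹ + b ≠ 0 := by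
      intro h0
      apply hu
      field_simp at h0
      linear_combination h0
    simp [hc, hk, hne] at hev
    rw [pow_succ]
    nth_rewrite 2 [← sub_eq_zero.1 hev]
    exact mul_inv_cancel₀ (pow_ne_zero t hc)

end Binomials

/-- A two-term polynomial in a transcendental element does not vanish. -/
lemma Transcendental.mul_pow_add_ne_zero {F K : Type*} [Field F] [Field K] [Algebra F K] {y : K}
    (hy : Transcendental F y) {m : ℕ} (hm : 0 < m) {u : F} (v : F) (hu : u ≠ 0) :
    algebraMap F K u * y ^ m + algebraMap F K v ≠ 0 := by
  intro h0
  have h1 := transcendental_iff.1 hy (Polynomial.C u * Polynomial.X ^ m + Polynomial.C v)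
    (by simpa using h0)
  have h2 := congrArg (fun f => Polynomial.coeff f m) h1
  simp [Polynomial.coeff_C, hm.ne', hu] at h2

/-- Necessary conditions for the curve `a x ^ n y ^ m + b x ^ n + c y ^ m = 1` to be a component of
`a x ^ N y ^ (m + 1) + b x ^ N y ^ q + c y ^ (m + 1) = y ^ q`. -/
lemma MvPolynomial.identity_of_fermat_type_dvd {F K : Type*} [Field F] [Field K] [Algebra F K]
    {y : K} (hy : Transcendental F y) {m n N q : ℕ} (hm : 0 < m) (hn : 0 < n) {a b c : F}
    (ha : a ≠ 0) (hb : b ≠ 0) (hc : c ≠ 0) (hbc : b * c ≠ -a)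
    (hdvd : (C a * X 0 ^ n * X 1 ^ m + C b * X 0 ^ n + C c * X 1 ^ m - 1 :
        MvPolynomial (Fin 2) F) ∣
        (C a * X 0 ^ N * X 1 ^ (m + 1) + C b * X 0 ^ N * X 1 ^ q
          + C c * X 1 ^ (m + 1) - X 1 ^ q)) :
    n ∣ N ∧ m + 1 ≡ q [MOD m] ∧ ∀ k t : ℕ, N = n * k → q = m * t + (m + 1) →
      (Polynomial.C a + Polynomial.C b * Polynomial.X ^ t) *
        (1 - Polynomial.C c * Polynomial.X) ^ k =
        (Polynomial.X ^ t - Polynomial.C c) *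
          (Polynomial.C a * Polynomial.X + Polynomial.C b : Polynomial F) ^ k := by
  have hu : a + b * c ≠ 0 := fun h0 => hbc (by linear_combination h0)
  have hy0 : y ≠ 0 := fun h0 => hy (h0 ▸ isAlgebraic_zero)
  obtain ⟨ι, hι⟩ : ∃ ι, ι = algebraMap F K := ⟨_, rfl⟩
  have huK : ι a + ι b * ι c ≠ 0 := by
    rw [← map_mul, ← map_add]
    exact (map_ne_zero ι).2 hu
  have hdX := map_dvd (MvPolynomial.aeval (R := F) ![Polynomial.X, Polynomial.C y]) hdvd
  have hdY := map_dvd (MvPolynomial.aeval (R := F) ![Polynomial.C y, Polynomial.X]) hdvd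
  simp only [map_add, map_sub, map_mul, map_pow, map_one, MvPolynomial.aeval_X,
    MvPolynomial.algHom_C, Matrix.cons_val_zero, Matrix.cons_val_one,
    Polynomial.algebraMap_apply, ← hι] at hdX hdY
  have hne : ∀ {j : ℕ} {u : F} (v : F), 0 < j → u ≠ 0 → ι u * y ^ j + ι v ≠ 0 := by
    intro j u v hj hu0
    rw [hι]
    exact hy.mul_pow_add_ne_zero hj v hu0
  have hne' : ∀ {j : ℕ} {u : F}, 0 < j → u ≠ 0 → 1 - ι u * y ^ j ≠ 0 := by
    intro j u hj hu0 h0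
    refine hne (-1) hj hu0 ?_
    rw [map_neg, map_one]
    linear_combination -h0
  have hP := hne b hm ha
  replace hdX : (Polynomial.C (ι a * y ^ m + ι b) * Polynomial.X ^ n -
      Polynomial.C (1 - ι c * y ^ m) : Polynomial K) ∣
      Polynomial.C (ι a * y ^ (m + 1) + ι b * y ^ q) * Polynomial.X ^ N +
        Polynomial.C (ι c * y ^ (m + 1) - y ^ q) := by
    convert hdX using 1
    · simp only [map_add, map_sub, map_mul, map_pow, map_one]; ring
    · simp only [map_add, map_sub, map_mul, map_pow]; ring
  refine ⟨(Nat.modEq_zero_iff_dvd).1 ?_, ?_, ?_⟩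
  · refine Polynomial.modEq_of_binomial_dvd hn hP (hne' hm hc) (N := N) (M := 0)
      (A := ι a * y ^ (m + 1) + ι b * y ^ q) (B := ι c * y ^ (m + 1) - y ^ q) ?_
      (by rwa [pow_zero, mul_one])
    rintro ⟨h1, h2⟩
    refine mul_ne_zero huK (pow_ne_zero q hy0) ?_
    linear_combination ι c * h1 - ι a * h2
  · refine Polynomial.modEq_of_binomial_dvd (K := K) (P := ι a * y ^ n + ι c)
      (Q := 1 - ι b * y ^ n) (A := ι a * y ^ N + ι c) (B := ι b * y ^ N - 1)
      hm (hne c hn ha) (hne' hn hb) ?_ ?_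
    · rintro ⟨h1, h2⟩
      exact huK (by linear_combination ι b * h1 - ι a * h2)
    · convert hdY using 1
      · simp only [map_add, map_sub, map_mul, map_pow, map_one]; ring
      · simp only [map_add, map_sub, map_mul, map_pow, map_one]; ring
  · rintro k t rfl hq
    have hid := Polynomial.eq_zero_of_binomial_dvd hn hP hdX
    refine sub_eq_zero.1 (transcendental_iff.1 (hy.pow (n := m) hm) _ ?_)
    simp only [map_add, map_sub, map_mul, map_pow, map_one, Polynomial.aeval_X,
      Polynomial.aeval_C, ← hι]
    refine (mul_eq_zero.1 ?_).resolve_left (pow_ne_zero (m + 1) hy0)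
    rw [hq, pow_add y (m * t), pow_mul] at hid
    linear_combination hid

theorem frobenius_nonclassical_conics_gen_n1_mplus1
    (p h q : ℕ) (hp : p.Prime) (hp5 : 5 < p) (hh : 0 < h) (hq : q = p ^ h)
    (F : Type*) [Field F] [Fintype F] (hcard : Fintype.card F = q)
    (m n : ℕ) (hm : 2 < m) (hmn : m ≤ n) (hpmn : ¬ p ∣ m * n)
    (hpn : p ∣ n - 1) (hpm : p ∣ m + 1)
    (a b c : F) (ha : a ≠ 0) (hb : b ≠ 0) (hc : c ≠ 0) (hbc : b * c ≠ -a) :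
    ((C a * X 0 ^ n * X 1 ^ m + C b * X 0 ^ n + C c * X 1 ^ m - 1 :
        MvPolynomial (Fin 2) F) ∣
        (C a * X 0 ^ (n - 1 + q) * X 1 ^ (m + 1) + C b * X 0 ^ (n - 1 + q) * X 1 ^ q
          + C c * X 1 ^ (m + 1) - X 1 ^ q)) ↔
      ∃ r : ℕ, 0 < r ∧ r < h ∧ n * (p ^ r - 1) = q - 1 ∧ m * (p ^ r + 1) = q - 1 ∧
        c * a ^ p ^ r = -b ∧ c * b ^ p ^ r = -a ∧ c ^ (p ^ r + 1) = 1 := by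
  have hpF := Fact.mk hp
  have : CharP F p := charP_of_card_eq_prime_pow (f := h) (by rw [hcard, hq])
  have hpq : p ∣ q := hq ▸ dvd_pow_self p hh.ne'
  have hq1 : 1 < q := hq ▸ Nat.one_lt_pow hh.ne' hp.one_lt
  have hu : a + b * c ≠ 0 := fun h0 => hbc (by linear_combination h0)
  constructor
  · intro hdvd
    obtain ⟨⟨k, hk⟩, hm_mod, hpoly⟩ := MvPolynomial.identity_of_fermat_type_dvd
      (RatFunc.transcendental_X (K := F)) (by omega) (by omega) ha hb hc hbc hdvd
    have hk1 : 1 < k := by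
      by_contra h0
      have : n * k ≤ n * 1 := Nat.mul_le_mul_left n (by omega)
      omega
    obtain ⟨k', rfl⟩ : ∃ k', k = k' + 1 := ⟨k - 1, by omega⟩
    have hqn : q = n * k' + 1 := by rw [mul_add] at hk; omega
    have hnq : n ≤ n * k' := Nat.le_mul_of_pos_right n (by omega)
    obtain ⟨t, ht⟩ := (Nat.modEq_iff_dvd' (by omega)).1 hm_mod
    have hqm : q = m * t + (m + 1) := by omega
    have hpt : p ∣ t := by
      have h1 : p ∣ m * t := (Nat.dvd_add_left hpm).1 (hqm ▸ hpq)
      exact (hp.dvd_mul.1 h1).resolve_left fun h0 => hpmn (h0.mul_right n)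
    have ht0 : 0 < t := by
      rcases Nat.eq_zero_or_pos t with rfl | h0
      · have hnm : n = m := by omega
        have h2 := Nat.dvd_sub hpm hpn
        rw [show m + 1 - (n - 1) = 2 by omega] at h2
        have := Nat.le_of_dvd (by norm_num) h2
        omega
      · exact h0
    replace hpoly := hpoly (k' + 1) t hk hqm
    obtain ⟨hkt, ⟨r, hr⟩, hct⟩ := Polynomial.eq_pow_of_mul_pow_eq hp ht0 hc hbc hpoly
    have hr0 : 0 < r := by
      rcases Nat.eq_zero_or_pos r with rfl | h0
      · rw [hr, pow_zero] at hpt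
        exact absurd hpt hp.not_dvd_one
      · exact h0
    have hcoef := congrArg (fun f => f.eval 0) hpoly
    simp [ht0.ne'] at hcoef
    have hcb : c * b ^ t = -a := by rw [← hkt]; linear_combination hcoef
    have hca : c * a ^ t = -b := by
      have hodd : Odd t := hr ▸ (hp.odd_of_ne_two (by omega)).pow
      have hev := congrArg (fun f => f.eval (-b / a)) hpoly
      have h1 : 1 - c * (-b / a) ≠ 0 := by
        intro h0
        field_simp at h0
        exact hu (by linear_combination h0)
      have h2 : a * (-b / a) + b = 0 := by field_simp; ring
      simp only [Polynomial.eval_mul, Polynomial.eval_add, Polynomial.eval_sub,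
        Polynomial.eval_pow, Polynomial.eval_C, Polynomial.eval_X, Polynomial.eval_one, h2,
        zero_pow k'.succ_ne_zero, mul_zero] at hev
      have h3 := (mul_eq_zero.1 hev).resolve_right (pow_ne_zero _ h1)
      rw [div_pow, hodd.neg_pow] at h3
      field_simp at h3
      refine mul_left_cancel₀ ha ?_
      linear_combination c * h3 + b * hcb
    refine ⟨r, hr0, ?_, ?_, ?_, ?_, ?_, ?_⟩ <;> try rw [← hr]
    · have h1 : t < q := by nlinarith
      rw [hr, hq] at h1
      exact (Nat.pow_lt_pow_iff_right hp.one_lt).1 h1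
    · rw [hqn, ← hkt]; simp
    · rw [hqm]; ring_nf; omega
    · exact hca
    · exact hcb
    · exact hct
  · rintro ⟨r, -, -, hn, hm', hca, hcb, hcc⟩
    have hQ : 0 < p ^ r := pow_pos hp.pos r
    have h1 : q = m * (p ^ r + 1) + 1 := by omega
    have h2 : n - 1 + q = n * p ^ r := by
      obtain ⟨s, hs⟩ : ∃ s, p ^ r = s + 1 := ⟨p ^ r - 1, by omega⟩
      rw [hs] at hn ⊢
      rw [mul_add, Nat.add_sub_cancel] at *
      omega
    have hca' : (C c * C a ^ p ^ r : MvPolynomial (Fin 2) F) = -C b := by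
      rw [← C_pow, ← C_mul, hca, C_neg]
    have hcb' : (C c * C b ^ p ^ r : MvPolynomial (Fin 2) F) = -C a := by
      rw [← C_pow, ← C_mul, hcb, C_neg]
    have hcc' : (C c ^ (p ^ r + 1) : MvPolynomial (Fin 2) F) = 1 := by
      rw [← C_pow, hcc, C_1]
    refine (dvd_pow_self _ hQ.ne').trans
      (Dvd.intro_left (-C c * X 1 ^ (m + 1)) ?_)
    rw [sub_pow_char_pow, add_pow_char_pow, add_pow_char_pow, h2, h1]
    simp only [mul_pow, one_pow, ← pow_mul]
    rw [pow_succ] at hcc'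
    rw [show m * (p ^ r + 1) + 1 = m * p ^ r + (m + 1) by ring, pow_add _ (m * p ^ r)]
    linear_combination (-X 0 ^ (n * p ^ r) * X 1 ^ (m * p ^ r) * X 1 ^ (m + 1)) * hca' -
      (X 0 ^ (n * p ^ r) * X 1 ^ (m + 1)) * hcb' - (X 1 ^ (m * p ^ r) * X 1 ^ (m + 1)) * hcc'
end
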